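/- arXiv:1611.10056 — 3 statements merged into one kernel-verified Lean document; each statement's English description precedes it below -/
import Mathlib

section
/- Fix real numbers ℓ ≥ 1 and b > 2(eℓ)^{1/ℓ}, and let β ∈ (0, ℓ^{1/ℓ}) satisfy 2β·exp(1/β^ℓ) = b (equivalently, f_{−β}(β) = β). Then for every c ≥ −β and every integer q ≥ 1 such that f_c^q(0) = 0 and f_c^j(0) ≠ 0 for all 1 ≤ j < q, the positive transversality condition holds: ∑_{n=0}^{q−1} 1/Df_c^n(c) > 0. -/
/-- The unimodal map with a flat critical point:
`f_c(x) = b·exp(−1/|x|^ℓ) + c` for `x ≠ 0`, and `f_c(0) = c`. -/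
noncomputable def flatMap (ℓ b c : ℝ) : ℝ → ℝ :=
  fun x => if x = 0 then c else b * Real.exp (-1 / |x| ^ ℓ) + c

/-- `Df_c^n(c) = ∏_{k=0}^{n−1} f_c'(f_c^k(c))`, the derivative of the `n`-th iterate at `c`. -/
noncomputable def flatDfn (ℓ b c : ℝ) (n : ℕ) : ℝ :=
  ∏ k ∈ Finset.range n, deriv (flatMap ℓ b c) ((flatMap ℓ b c)^[k] c)

open Polynomial in
lemma hermite_exists (S : Finset ℂ) :
    ∃ Q : ℂ[X], ∀ v ∈ S, Q.eval v = 0 ∧ Q.derivative.eval v = 1 := by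
  classical
  refine ⟨Lagrange.nodal S id * Lagrange.interpolate S id
    (fun v => ((Lagrange.nodal S id).derivative.eval v)⁻¹), fun v hv => ?_⟩
  have h0 : (Lagrange.nodal S (id : ℂ → ℂ)).eval v = 0 :=
    Lagrange.eval_nodal_at_node (v := id) hv
  have h1 := Lagrange.eval_interpolate_at_node
    (r := fun v => ((Lagrange.nodal S id).derivative.eval v)⁻¹) (s := S) (v := (id : ℂ → ℂ))
    (fun _ _ _ _ h => h) hv
  have h2 : (Lagrange.nodal S (id : ℂ → ℂ)).derivative.eval v ≠ 0 := by
    have := Lagrange.eval_nodal_derivative_eval_node_eq (v := (id : ℂ → ℂ)) hv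
    simp only [id] at this
    erw [this, Lagrange.eval_nodal]
    refine Finset.prod_ne_zero_iff.2 fun w hw => ?_
    exact sub_ne_zero.2 (Finset.ne_of_mem_erase hw).symm
  simp only [id] at h1
  constructor
  · simp [h0]
  · rw [derivative_mul, eval_add, eval_mul, eval_mul, h0, h1, mul_inv_cancel₀ h2]
    simp

open Polynomial in
lemma phi_exists (S : Finset ℂ) (R r : ℝ) (hR : 0 < R) (hr : R < r) :
    ∃ ε : ℝ, 0 < ε ∧ ∃ Φ : ℂ[X], (∀ v ∈ S, Φ.eval v = v ∧ Φ.derivative.eval v = 1 + ε) ∧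
      (∀ z, ‖z‖ < R → ‖Φ.eval z‖ < r) ∧
      (∀ z w, ‖z‖ < R → ‖w‖ < R → Φ.eval z = Φ.eval w → z = w) := by
  obtain ⟨Q, hQ⟩ := hermite_exists S
  obtain ⟨M, hM⟩ := (isCompact_closedBall (0:ℂ) R).exists_bound_of_continuousOn
    (f := fun z => Q.eval z) (by fun_prop)
  obtain ⟨L, hL⟩ := (isCompact_closedBall (0:ℂ) R).exists_bound_of_continuousOn
    (f := fun z => Q.derivative.eval z) (by fun_prop)
  have hM0 : 0 ≤ M := (norm_nonneg _).trans (hM 0 (by simp [hR.le]))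
  have hL0 : 0 ≤ L := (norm_nonneg _).trans (hL 0 (by simp [hR.le]))
  obtain ⟨ε, hε, hεM, hεL⟩ : ∃ ε : ℝ, 0 < ε ∧ ε * M ≤ r - R ∧ ε * L < 1 := by
    refine ⟨min ((r - R) / (M + 1)) (1 / (L + 1)), ?_, ?_, ?_⟩
    · have : 0 < r - R := by linarith
      positivity
    · calc _ ≤ (r - R) / (M + 1) * M := by gcongr; exact min_le_left _ _
        _ ≤ (r - R) / (M + 1) * (M + 1) := by
          have : 0 < r - R := by linarith
          gcongr; linarith
        _ = _ := by field_simp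
    · calc _ ≤ 1 / (L + 1) * L := by gcongr; exact min_le_right _ _
        _ < 1 := by rw [div_mul_eq_mul_div, div_lt_one (by linarith)]; linarith
  refine ⟨ε, hε, X + C (ε : ℂ) * Q, fun v hv => ?_, fun z hz => ?_, fun z w hz hw h => ?_⟩
  · simp [hQ v hv]
  · have := hM z (by simpa using hz.le)
    simp only [eval_add, eval_X, eval_mul, eval_C]
    calc _ ≤ ‖z‖ + ‖(ε : ℂ) * Q.eval z‖ := norm_add_le _ _
      _ = ‖z‖ + ε * ‖Q.eval z‖ := by simp [abs_of_pos hε]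
      _ < R + ε * M := add_lt_add_of_lt_of_le hz (mul_le_mul_of_nonneg_left this hε.le)
      _ ≤ r := by linarith
  · simp only [eval_add, eval_X, eval_mul, eval_C] at h
    have hlip := (convex_closedBall (0:ℂ) R).norm_image_sub_le_of_norm_deriv_le (𝕜 := ℂ)
      (f := fun z => Q.eval z) (C := L) (fun x _ => Q.differentiable.differentiableAt)
      (fun x hx => by rw [Polynomial.deriv]; exact hL x hx)
      (x := w) (y := z) (by simpa using hw.le) (by simpa using hz.le)
    have h3 : z - w = - (ε * (Q.eval z - Q.eval w)) := by linear_combination h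
    have h4 : ‖z - w‖ = ε * ‖Q.eval z - Q.eval w‖ := by
      rw [h3]; simp [abs_of_pos hε]
    by_contra hne
    have h5 : 0 < ‖z - w‖ := norm_pos_iff.2 (sub_ne_zero.2 hne)
    have : ‖z - w‖ ≤ ε * (L * ‖z - w‖) := by
      rw [h4, ← h4]; exact h4.le.trans (mul_le_mul_of_nonneg_left hlip hε.le)
    nlinarith

lemma cpow_re_ge (w : ℂ) (hw : 0 < w.re) (s : ℝ) (hs : 0 < s) (hs1 : s ≤ 1) :
    w.re ^ s ≤ (w ^ (s : ℂ)).re := by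
  rw [Complex.cpow_ofReal_re]
  have hn : 0 < ‖w‖ := lt_of_lt_of_le hw (Complex.re_le_norm w)
  have hre : w.re = ‖w‖ * Real.cos w.arg := (Complex.norm_mul_cos_arg w).symm
  have harg := Complex.abs_arg_lt_pi_div_two_iff.2 (Or.inl hw)
  have hcos : 0 < Real.cos w.arg := by
    by_contra h
    nlinarith
  rw [hre, Real.mul_rpow hn.le hcos.le]
  gcongr
  have h1 := Real.geom_mean_le_arith_mean2_weighted hs.le (sub_nonneg.2 hs1) hcos.le
    zero_le_one (by ring)
  rw [Real.one_rpow, mul_one, mul_one] at h1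
  rw [abs_lt] at harg
  have h2 := strictConcaveOn_cos_Icc.concaveOn.2 (x := w.arg) (y := 0)
    ⟨harg.1.le, harg.2.le⟩ ⟨by linarith [Real.pi_pos], by linarith [Real.pi_pos]⟩ hs.le (sub_nonneg.2 hs1) (by ring)
  simp only [smul_eq_mul, Real.cos_zero, mul_zero, add_zero, mul_one] at h2
  rw [mul_comm w.arg]
  linarith

lemma inv_mem_disc (u : ℂ) (x : ℝ) (hx : 0 < x) (hu : 1 / x < u.re) :
    ‖u⁻¹ - (x / 2 : ℝ)‖ < x / 2 := by
  have hu0 : u ≠ 0 := by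
    rintro rfl
    have : 0 < 1 / x := by positivity
    simp at hu; linarith
  have hux : 1 < u.re * x := by rwa [div_lt_iff₀ hx] at hu
  have h1 : u⁻¹ - (x / 2 : ℝ) = (2 - x * u) / (2 * u) := by
    push_cast; field_simp
  have hn : 0 < ‖u‖ := norm_pos_iff.2 hu0
  rw [h1, norm_div, norm_mul, Complex.norm_ofNat, div_lt_iff₀ (by positivity)]
  have : ‖(2:ℂ) - x * u‖ < x * ‖u‖ := by
    apply lt_of_pow_lt_pow_left₀ 2 (by positivity)
    rw [mul_pow, Complex.sq_norm, Complex.sq_norm, Complex.normSq_apply, Complex.normSq_apply]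
    simp
    nlinarith
  linarith

lemma exists_x (ℓ b β : ℝ) (hℓ : 1 ≤ ℓ) (hβ0 : 0 < β) (hβ1 : β < ℓ ^ (1 / ℓ))
    (hβ : 2 * β * Real.exp (1 / β ^ ℓ) = b) :
    ∃ x, β < x ∧ 2 * x < b * Real.exp (- (x ^ ℓ)⁻¹) := by
  have hℓ0 : 0 < ℓ := by linarith
  have hβℓ : β ^ ℓ < ℓ := by
    calc β ^ ℓ < (ℓ ^ (1 / ℓ)) ^ ℓ := Real.rpow_lt_rpow hβ0.le hβ1 hℓ0
      _ = ℓ := by rw [← Real.rpow_mul hℓ0.le]; field_simp; simp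
  have hp : 0 < β ^ ℓ := Real.rpow_pos_of_pos hβ0 _
  have hd : HasDerivAt (fun x : ℝ => b * Real.exp (- (x ^ ℓ)⁻¹) - 2 * x)
      (b * (Real.exp (-(β ^ ℓ)⁻¹) * (-(-(ℓ * β ^ (ℓ - 1)) / (β ^ ℓ) ^ 2))) - 2 * 1) β := by
    have h1 := Real.hasDerivAt_rpow_const (x := β) (p := ℓ) (Or.inl hβ0.ne')
    exact (((h1.inv hp.ne').neg.exp).const_mul b).sub ((hasDerivAt_id β).const_mul 2)
  have hbv : b * Real.exp (-(β ^ ℓ)⁻¹) = 2 * β := by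
    rw [← hβ, mul_assoc, ← Real.exp_add]; simp
  have hpos : 0 < b * (Real.exp (-(β ^ ℓ)⁻¹) * (-(-(ℓ * β ^ (ℓ - 1)) / (β ^ ℓ) ^ 2))) - 2 * 1 := by
    rw [← mul_assoc, hbv, Real.rpow_sub_one hβ0.ne']
    have : 2 * β * -(-(ℓ * (β ^ ℓ / β)) / (β ^ ℓ) ^ 2) = 2 * (ℓ / β ^ ℓ) := by field_simp
    rw [this]
    have : 1 < ℓ / β ^ ℓ := by rwa [one_lt_div hp]
    linarith
  have hev := (hasDerivWithinAt_iff_tendsto_slope' (by simp)).1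
    (hd.hasDerivWithinAt (s := Set.Ioi β))
  have h2 := hev.eventually (lt_mem_nhds hpos)
  obtain ⟨x, hx, hx2⟩ := (h2.and self_mem_nhdsWithin).exists
  have hx2 : β < x := hx2
  refine ⟨x, hx2, ?_⟩
  rw [slope_def_field, hbv] at hx
  have := (div_pos_iff_of_pos_right (sub_pos.2 hx2)).1 hx
  linarith

lemma exists_log_ball (δ : ℝ) (hδ : 0 < δ) (g : ℂ → ℂ) (L0 : ℂ)
    (hg : DifferentiableOn ℂ g (Metric.ball 0 δ)) (hg0 : ∀ t ∈ Metric.ball (0:ℂ) δ, g t ≠ 0)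
    (h0 : g 0 = Complex.exp L0) :
    ∃ W : ℂ → ℂ, W 0 = L0 ∧ (∀ t ∈ Metric.ball (0:ℂ) δ, HasDerivAt W (deriv g t / g t) t) ∧
      ∀ t ∈ Metric.ball (0:ℂ) δ, g t = Complex.exp (W t) := by
  have hd : DifferentiableOn ℂ (fun t => deriv g t / g t) (Metric.ball 0 δ) :=
    (hg.deriv Metric.isOpen_ball).div hg hg0
  obtain ⟨W, hW0, hW⟩ := hd.isExactOn_ball.with_val_at 0 L0
  refine ⟨W, hW0, hW, fun t ht => ?_⟩
  have hgd : ∀ t ∈ Metric.ball (0:ℂ) δ, HasDerivAt g (deriv g t) t := fun t ht =>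
    (hg.differentiableAt (Metric.isOpen_ball.mem_nhds ht)).hasDerivAt
  have hq : ∀ t ∈ Metric.ball (0:ℂ) δ,
      HasDerivAt (fun t => Complex.exp (-W t) * g t) 0 t := fun t ht => by
    have := (hW t ht).neg.cexp.mul (hgd t ht)
    refine this.congr_deriv ?_
    have := hg0 t ht
    simp only [Pi.neg_apply]
    field_simp
    ring
  have hconst := (convex_ball (0:ℂ) δ).norm_image_sub_le_of_norm_hasDerivWithin_le (C := 0)
    (fun t ht => (hq t ht).hasDerivWithinAt) (fun _ _ => by simp)
    (Metric.mem_ball_self hδ) ht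
  simp only [zero_mul, norm_le_zero_iff, sub_eq_zero] at hconst
  rw [hW0, h0, ← Complex.exp_add, neg_add_cancel, Complex.exp_zero, Complex.exp_neg] at hconst
  field_simp [Complex.exp_ne_zero] at hconst
  exact hconst

lemma flat_deriv (ℓ b c y σ : ℝ) (hy : 0 < |y|) (hσy : y = σ * |y|) :
    HasDerivAt (flatMap ℓ b c)
      (b * (Real.exp (-(|y| ^ ℓ)⁻¹) * (-(-(ℓ * |y| ^ (ℓ - 1) * σ) / (|y| ^ ℓ) ^ 2)))) y := by
  have hy0 : y ≠ 0 := abs_pos.1 hy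
  have habs : HasDerivAt (fun x : ℝ => |x|) σ y := by
    have h := hasDerivAt_abs hy0
    convert h using 1
    rcases lt_or_gt_of_ne hy0 with h | h
    · rw [sign_neg h]; rw [abs_of_neg h] at hσy
      have : y * (σ + 1) = 0 := by linarith
      rcases mul_eq_zero.1 this with h' | h'
      · exact absurd h' hy0
      · simp; linarith
    · rw [sign_pos h]; rw [abs_of_pos h] at hσy
      have : y * (σ - 1) = 0 := by linarith
      rcases mul_eq_zero.1 this with h' | h'
      · exact absurd h' hy0
      · simp; linarith
  have h1 := (Real.hasDerivAt_rpow_const (x := |y|) (p := ℓ) (Or.inl hy.ne')).comp y habs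
  have hp : |y| ^ ℓ ≠ 0 := (Real.rpow_pos_of_pos hy ℓ).ne'
  have h2 := ((((h1.inv hp).neg.exp).const_mul b).add_const c)
  refine h2.congr_of_eventuallyEq ?_
  filter_upwards [isOpen_ne.mem_nhds hy0] with x hx
  have hx : x ≠ 0 := hx
  simp [flatMap, hx, neg_div]

lemma lift_step (ℓ b x δ y σ c : ℝ) (hℓ : 1 ≤ ℓ) (hb : 0 < b) (hx : 0 < x) (hδ : 0 < δ)
    (hσ : σ = 1 ∨ σ = -1) (hy : 0 < |y|) (hσy : y = σ * |y|) (g : ℂ → ℂ)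
    (hg : DifferentiableOn ℂ g (Metric.ball 0 δ)) (hg0 : ∀ t ∈ Metric.ball (0:ℂ) δ, g t ≠ 0)
    (hgr : ∀ t ∈ Metric.ball (0:ℂ) δ, ‖g t‖ < b * Real.exp (-(x ^ ℓ)⁻¹))
    (hgv : g 0 = (b * Real.exp (-(|y| ^ ℓ)⁻¹) : ℝ)) (a : ℂ) (hga : HasDerivAt g a 0) :
    ∃ Z : ℂ → ℂ, DifferentiableOn ℂ Z (Metric.ball 0 δ) ∧ Z 0 = y ∧
      (∀ t ∈ Metric.ball (0:ℂ) δ, ‖Z t - (σ * (x / 2) : ℝ)‖ < x / 2) ∧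
      (∀ t ∈ Metric.ball (0:ℂ) δ, g t = b * Complex.exp (-((σ * Z t)⁻¹ ^ (ℓ : ℂ)))) ∧
      HasDerivAt Z (a / (deriv (flatMap ℓ b c) y : ℝ)) 0 := by
  have hℓ0 : 0 < ℓ := by linarith
  have hbc : (b : ℂ) ≠ 0 := by exact_mod_cast hb.ne'
  have hσ2 : σ * σ = 1 := by rcases hσ with h | h <;> rw [h] <;> norm_num
  have hσ2c : (σ : ℂ) * σ = 1 := by exact_mod_cast hσ2
  have hσ0 : (σ : ℂ) ≠ 0 := left_ne_zero_of_mul_eq_one hσ2c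
  have hp : 0 < |y| ^ ℓ := Real.rpow_pos_of_pos hy ℓ
  have h0mem : (0:ℂ) ∈ Metric.ball (0:ℂ) δ := Metric.mem_ball_self hδ
  obtain ⟨W, hW0, hW, hgW⟩ := exists_log_ball δ hδ (fun t => g t / b) ((-(|y| ^ ℓ)⁻¹ : ℝ) : ℂ)
    (hg.div_const _) (fun t ht => div_ne_zero (hg0 t ht) hbc)
    (by simp only [hgv]; push_cast; field_simp)
  have hre : ∀ t ∈ Metric.ball (0:ℂ) δ, (x ^ ℓ)⁻¹ < (-W t).re := fun t ht => by
    have h1 := hgr t ht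
    have h2 : g t = b * Complex.exp (W t) := by
      rw [← hgW t ht]; field_simp
    rw [h2, norm_mul, Complex.norm_exp, Complex.norm_real, Real.norm_of_nonneg hb.le,
      mul_lt_mul_iff_right₀ hb, Real.exp_lt_exp] at h1
    simp; linarith
  have hxl : 0 < x ^ ℓ := Real.rpow_pos_of_pos hx ℓ
  have hslit : ∀ t ∈ Metric.ball (0:ℂ) δ, -W t ∈ Complex.slitPlane := fun t ht =>
    Or.inl ((inv_pos.2 hxl).trans (hre t ht))
  have hne : ∀ t ∈ Metric.ball (0:ℂ) δ, (-W t) ^ ((1 / ℓ : ℝ) : ℂ) ≠ 0 := fun t ht => by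
    rw [Complex.cpow_ne_zero_iff]
    exact Or.inl (Complex.slitPlane_ne_zero (hslit t ht))
  have hder : ∀ t ∈ Metric.ball (0:ℂ) δ, HasDerivAt
      (fun t => (σ : ℂ) * ((-W t) ^ ((1 / ℓ : ℝ) : ℂ))⁻¹) _ t := fun t ht =>
    ((((hW t ht).neg.cpow_const (c := ((1 / ℓ : ℝ) : ℂ)) (hslit t ht)).inv
      (hne t ht)).const_mul (σ : ℂ))
  have hval : (-W 0) ^ ((1 / ℓ : ℝ) : ℂ) = ((|y|⁻¹ : ℝ) : ℂ) := by
    rw [hW0, ← Complex.ofReal_neg, neg_neg, ← Complex.ofReal_cpow (by positivity),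
      Real.inv_rpow hp.le, ← Real.rpow_mul hy.le]
    congr 2
    rw [mul_one_div_cancel hℓ0.ne', Real.rpow_one]
  refine ⟨_, fun t ht => (hder t ht).differentiableAt.differentiableWithinAt, ?_, ?_, ?_, ?_⟩
  · simp only [hval]
    rw [Complex.ofReal_inv, inv_inv, ← Complex.ofReal_mul, ← hσy]
  · intro t ht
    have h1 := hre t ht
    have h2 := cpow_re_ge (-W t) ((inv_pos.2 hxl).trans h1) (1 / ℓ) (by positivity)
      (by rw [div_le_one hℓ0]; exact hℓ)
    have h3 : 1 / x < (-W t).re ^ (1 / ℓ) := by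
      calc 1 / x = ((x ^ ℓ)⁻¹) ^ (1 / ℓ) := by
            rw [Real.inv_rpow hxl.le, ← Real.rpow_mul hx.le, mul_one_div_cancel hℓ0.ne',
              Real.rpow_one, one_div]
        _ < _ := Real.rpow_lt_rpow (by positivity) h1 (by positivity)
    have h4 := inv_mem_disc _ x hx (h3.trans_le h2)
    have h5 : ‖(σ:ℂ)‖ = 1 := by rcases hσ with h | h <;> simp [h]
    rw [Complex.ofReal_mul, ← mul_sub, norm_mul, h5, one_mul]
    exact h4
  · intro t ht
    rw [← mul_assoc, hσ2c, one_mul, inv_inv, ← Complex.cpow_mul]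
    · rw [← Complex.ofReal_mul, one_div_mul_cancel hℓ0.ne', Complex.ofReal_one, Complex.cpow_one,
        neg_neg, ← hgW t ht]
      field_simp
    all_goals
      have ha := Complex.abs_arg_lt_pi_div_two_iff.2 (Or.inl ((inv_pos.2 hxl).trans (hre t ht)))
      rw [Complex.im_mul_ofReal, Complex.log_im]
      have hs1 : 1 / ℓ ≤ 1 := by rw [div_le_one hℓ0]; exact hℓ
      have hs0 : 0 < 1 / ℓ := by positivity
      rw [abs_lt] at ha
      have := Real.pi_pos
      nlinarith
  · have h1 := hder 0 h0mem
    refine h1.congr_deriv ?_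
    rw [(flat_deriv ℓ b c y σ hy hσy).deriv]
    have hdg : deriv (fun t => g t / (b:ℂ)) 0 = a / b := (hga.div_const _).deriv
    have hw0 : -W 0 ≠ 0 := Complex.slitPlane_ne_zero (hslit 0 h0mem)
    simp only [Pi.neg_apply]
    rw [hdg, Complex.cpow_sub _ _ hw0, Complex.cpow_one, hval, hW0, hgv,
      Real.rpow_sub_one hy.ne']
    have hyc : ((|y| : ℝ) : ℂ) ≠ 0 := by exact_mod_cast hy.ne'
    have hpc : ((|y| ^ ℓ : ℝ) : ℂ) ≠ 0 := by exact_mod_cast hp.ne'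
    have hec : ((Real.exp (-(|y| ^ ℓ)⁻¹) : ℝ) : ℂ) ≠ 0 := by
      exact_mod_cast (Real.exp_pos _).ne'
    have hlc : (ℓ : ℂ) ≠ 0 := by exact_mod_cast hℓ0.ne'
    simp only [Complex.ofReal_mul, Complex.ofReal_div, Complex.ofReal_neg, Complex.ofReal_inv,
      Complex.ofReal_pow, Complex.ofReal_one]
    generalize ((Real.exp (-(|y| ^ ℓ)⁻¹) : ℝ) : ℂ) = e at *
    generalize ((|y| ^ ℓ : ℝ) : ℂ) = P at *
    generalize ((|y| : ℝ) : ℂ) = Y at *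
    field_simp
    linear_combination (a) * hσ2c

lemma flat_deriv_ne (ℓ b c y : ℝ) (hℓ : 1 ≤ ℓ) (hb : 0 < b) (hy : y ≠ 0) :
    deriv (flatMap ℓ b c) y ≠ 0 := by
  have hy' : 0 < |y| := abs_pos.2 hy
  have h1 : y = (y / |y|) * |y| := by field_simp
  rw [(flat_deriv ℓ b c y _ hy' h1).deriv]
  have h2 : y / |y| ≠ 0 := div_ne_zero hy hy'.ne'
  have h3 := (Real.rpow_pos_of_pos hy' ℓ).ne'
  have h4 := (Real.rpow_pos_of_pos hy' (ℓ - 1)).ne'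
  have h5 := (Real.exp_pos (-(|y| ^ ℓ)⁻¹)).ne'
  have h6 : ℓ ≠ 0 := by linarith
  have h7 := hb.ne'
  refine mul_ne_zero h7 (mul_ne_zero h5 (neg_ne_zero.2 (div_ne_zero (neg_ne_zero.2
    (mul_ne_zero (mul_ne_zero h6 h4) h2)) (pow_ne_zero 2 h3))))

/-- The holomorphically moving points, all staying in two tangent discs. -/
def MotionInv (m : ℕ) (p σ : ℕ → ℝ) (x δ : ℝ) (h : ℕ → ℂ → ℂ) : Prop :=
  (∀ k ≤ m, DifferentiableOn ℂ (h k) (Metric.ball 0 δ)) ∧ (∀ k ≤ m, h k 0 = p k) ∧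
  (∀ t, h m t = 0) ∧
  (∀ k < m, ∀ t ∈ Metric.ball (0:ℂ) δ, ‖h k t - (σ k * (x / 2) : ℝ)‖ < x / 2) ∧
  (∀ t ∈ Metric.ball (0:ℂ) δ, ∀ i ≤ m, ∀ k ≤ m, h i t = h k t → i = k)

lemma disc_norm (u : ℂ) (σ x : ℝ) (hσ : σ = 1 ∨ σ = -1) (hx : 0 < x)
    (h : ‖u - (σ * (x / 2) : ℝ)‖ < x / 2) : ‖u‖ < x := by
  have h1 : ‖((σ * (x / 2) : ℝ) : ℂ)‖ = x / 2 := by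
    rw [Complex.norm_real, Real.norm_eq_abs]
    rcases hσ with h | h <;> simp [h] <;> linarith
  have := norm_sub_norm_le u ((σ * (x / 2) : ℝ) : ℂ)
  linarith

lemma disc_re (u : ℂ) (σ x : ℝ) (hσ : σ = 1 ∨ σ = -1) (hx : 0 < x)
    (h : ‖u - (σ * (x / 2) : ℝ)‖ < x / 2) : 0 < σ * u.re := by
  have h1 := (Complex.abs_re_le_norm _).trans_lt h
  rw [abs_lt] at h1
  simp only [Complex.sub_re, Complex.ofReal_re] at h1
  rcases hσ with h | h <;> subst h <;> linarith

lemma motion_base (m : ℕ) (p σ v : ℕ → ℝ) (x : ℝ) (hσ : ∀ k, σ k = 1 ∨ σ k = -1)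
    (hσp : ∀ k, p k = σ k * |p k|) (hpm : p m = 0) (hpne : ∀ k < m, p k ≠ 0)
    (hpx : ∀ k < m, |p k| < x) (hinj : ∀ i ≤ m, ∀ k ≤ m, p i = p k → i = k) (hvm : v m = 0) :
    ∃ δ > 0, MotionInv m p σ x δ (fun k t => p k + t * v k) := by
  have hc : ∀ k, ContinuousAt (fun t : ℂ => (p k : ℂ) + t * v k) 0 := fun k => by fun_prop
  have e1 : ∀ᶠ t in nhds (0:ℂ), ∀ k ∈ Finset.range m,
      ‖((p k : ℂ) + t * v k) - (σ k * (x / 2) : ℝ)‖ < x / 2 := by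
    rw [Filter.eventually_all_finset]
    intro k hk
    have hk := Finset.mem_range.1 hk
    have : ContinuousAt (fun t : ℂ => ‖((p k : ℂ) + t * v k) - (σ k * (x / 2) : ℝ)‖) 0 := by
      fun_prop
    refine this.eventually_lt continuousAt_const ?_
    rw [zero_mul, add_zero, ← Complex.ofReal_sub, Complex.norm_real, Real.norm_eq_abs]
    have h1 := hpx k hk
    have h2 := abs_pos.2 (hpne k hk)
    rw [hσp k, ← mul_sub, abs_mul]
    have h3 : |σ k| = 1 := by rcases hσ k with h | h <;> simp [h]
    rw [h3, one_mul, abs_lt]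
    constructor <;> linarith
  have e2 : ∀ᶠ t in nhds (0:ℂ), ∀ i ∈ Finset.range (m + 1), ∀ k ∈ Finset.range (m + 1),
      (p i : ℂ) + t * v i = (p k : ℂ) + t * v k → i = k := by
    rw [Filter.eventually_all_finset]
    intro i hi
    rw [Filter.eventually_all_finset]
    intro k hk
    by_cases hik : i = k
    · exact Filter.Eventually.of_forall fun _ _ => hik
    · have : (p i : ℂ) + 0 * v i ≠ (p k : ℂ) + 0 * v k := by
        simp only [zero_mul, add_zero]
        intro h
        exact hik (hinj i (by simpa [Nat.lt_succ_iff] using hi) k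
          (by simpa [Nat.lt_succ_iff] using hk) (by exact_mod_cast h))
      have hs : ContinuousAt (fun t : ℂ => ((p i : ℂ) + t * v i) - ((p k : ℂ) + t * v k)) 0 :=
        (hc i).sub (hc k)
      filter_upwards [hs.eventually_ne (sub_ne_zero.2 this)] with t ht h
      exact absurd (sub_eq_zero.2 h) ht
  obtain ⟨δ, hδ, hball⟩ := Metric.eventually_nhds_iff_ball.1 (e1.and e2)
  refine ⟨δ, hδ, fun k _ => by fun_prop, fun k _ => by simp, fun t => by simp [hpm, hvm],
    fun k hk t ht => (hball t ht).1 k (Finset.mem_range.2 hk), fun t ht i hi k hk h =>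
      (hball t ht).2 i (Finset.mem_range.2 (by omega)) k (Finset.mem_range.2 (by omega)) h⟩

open Polynomial in
lemma motion_step (ℓ b x c δ ε μ : ℝ) (hℓ : 1 ≤ ℓ) (hb : 0 < b) (hx : 0 < x) (hδ : 0 < δ)
    (m : ℕ) (p σ v : ℕ → ℝ) (hm : 1 ≤ m)
    (hσ : ∀ k, σ k = 1 ∨ σ k = -1)
    (hσp : ∀ k, p k = σ k * |p k|) (hpm : p m = 0) (hpne : ∀ k < m, p k ≠ 0)
    (hstep : ∀ k < m, p (k + 1) - p 0 = b * Real.exp (-(|p k| ^ ℓ)⁻¹))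
    (hvm : v m = 0)
    (hv : ∀ k < m, μ * (v k * deriv (flatMap ℓ b c) (p k)) = (1 + ε) * (v (k + 1) - v 0))
    (Φ : ℂ[X]) (hΦ0 : Φ.eval 0 = 0)
    (hΦ : ∀ k < m, Φ.eval ((p (k + 1) - p 0 : ℝ) : ℂ) = ((p (k + 1) - p 0 : ℝ) : ℂ) ∧
      Φ.derivative.eval ((p (k + 1) - p 0 : ℝ) : ℂ) = 1 + ε)
    (hΦr : ∀ z, ‖z‖ < 2 * x → ‖Φ.eval z‖ < b * Real.exp (-(x ^ ℓ)⁻¹))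
    (hΦi : ∀ z w, ‖z‖ < 2 * x → ‖w‖ < 2 * x → Φ.eval z = Φ.eval w → z = w)
    (h : ℕ → ℂ → ℂ) (hI : MotionInv m p σ x δ h) (M : ℂ)
    (hd : ∀ k ≤ m, HasDerivAt (h k) (M * v k) 0) :
    ∃ h' : ℕ → ℂ → ℂ, MotionInv m p σ x δ h' ∧
      ∀ k ≤ m, HasDerivAt (h' k) (M * μ * v k) 0 := by
  obtain ⟨hI1, hI2, hI3, hI4, hI5⟩ := hI
  have hnorm : ∀ k ≤ m, ∀ t ∈ Metric.ball (0:ℂ) δ, ‖h k t‖ < x := fun k hk t ht => by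
    rcases hk.lt_or_eq with hk | rfl
    · exact disc_norm _ _ _ (hσ k) hx (hI4 k hk t ht)
    · rw [hI3]; simpa using hx
  have hdiff : ∀ k < m, ∀ t ∈ Metric.ball (0:ℂ) δ, ‖h (k + 1) t - h 0 t‖ < 2 * x :=
    fun k hk t ht => by
      have h1 := hnorm (k + 1) hk t ht
      have h2 := hnorm 0 (by omega) t ht
      have h3 := norm_sub_le (h (k + 1) t) (h 0 t)
      linarith
  have hZ : ∀ k, ∃ Z : ℂ → ℂ, k < m → DifferentiableOn ℂ Z (Metric.ball 0 δ) ∧ Z 0 = p k ∧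
      (∀ t ∈ Metric.ball (0:ℂ) δ, ‖Z t - (σ k * (x / 2) : ℝ)‖ < x / 2) ∧
      (∀ t ∈ Metric.ball (0:ℂ) δ, Φ.eval (h (k + 1) t - h 0 t) =
        b * Complex.exp (-((σ k * Z t)⁻¹ ^ (ℓ : ℂ)))) ∧
      HasDerivAt Z (M * μ * v k) 0 := by
    intro k
    by_cases hk : k < m
    swap
    · exact ⟨0, fun h => absurd h hk⟩
    have hval : h (k + 1) 0 - h 0 0 = ((p (k + 1) - p 0 : ℝ) : ℂ) := by
      rw [hI2 _ hk, hI2 0 (by omega)]; push_cast; ring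
    have hder : HasDerivAt (fun t => Φ.eval (h (k + 1) t - h 0 t))
        ((1 + ε) * (M * v (k + 1) - M * v 0)) 0 := by
      have h1 := (hd (k + 1) hk).sub (hd 0 (by omega))
      have h2 := Φ.hasDerivAt (h (k + 1) 0 - h 0 0)
      have h3 := HasDerivAt.comp (0:ℂ) h2 h1
      rw [hval, (hΦ k hk).2] at h3
      exact h3
    obtain ⟨Z, hZ1, hZ2, hZ3, hZ4, hZ5⟩ := lift_step ℓ b x δ (p k) (σ k) c hℓ hb hx hδ (hσ k)
      (abs_pos.2 (hpne k hk)) (hσp k) (fun t => Φ.eval (h (k + 1) t - h 0 t))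
      (Φ.differentiable.comp_differentiableOn ((hI1 _ hk).sub (hI1 0 (by omega))))
      (fun t ht hz => by
        have h1 := hΦi _ 0 (hdiff k hk t ht) (by simpa using hx) (hz.trans hΦ0.symm)
        have h2 := hI5 t ht (k + 1) hk 0 (by omega) (sub_eq_zero.1 h1)
        omega)
      (fun t ht => hΦr _ (hdiff k hk t ht))
      (by simp only [hval]; rw [(hΦ k hk).1, hstep k hk]) _ hder
    refine ⟨Z, fun _ => ⟨hZ1, hZ2, hZ3, hZ4, hZ5.congr_deriv ?_⟩⟩
    have hne : ((deriv (flatMap ℓ b c) (p k) : ℝ) : ℂ) ≠ 0 := by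
      exact_mod_cast flat_deriv_ne ℓ b c (p k) hℓ hb (hpne k hk)
    rw [div_eq_iff hne]
    have := hv k hk
    have h2 : (μ : ℂ) * (v k * (deriv (flatMap ℓ b c) (p k) : ℝ)) =
        (1 + ε) * (v (k + 1) - v 0) := by exact_mod_cast this
    linear_combination (-M) * h2
  choose Z hZ using hZ
  refine ⟨fun k t => if k < m then Z k t else 0, ⟨fun k hk => ?_, fun k hk => ?_, fun t => ?_,
    fun k hk t ht => ?_, fun t ht i hi k hk hik => ?_⟩, fun k hk => ?_⟩
  · rcases hk.lt_or_eq with hk | rfl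
    · simp only [hk, if_true]; exact (hZ k hk).1
    · simp only [lt_irrefl, if_false]; exact differentiableOn_const _
  · rcases hk.lt_or_eq with hk | rfl
    · simp only [hk, if_true]; exact (hZ k hk).2.1
    · simp [hpm]
  · simp
  · simp only [hk, if_true]; exact (hZ k hk).2.2.1 t ht
  · have hnz : ∀ k < m, Z k t ≠ 0 := fun k hk h0 => by
      have := disc_re _ _ _ (hσ k) hx ((hZ k hk).2.2.1 t ht)
      rw [h0] at this; simp at this
    rcases hi.lt_or_eq with hi' | rfl <;> rcases hk.lt_or_eq with hk' | rfl
    · simp only [hi', hk', if_true] at hik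
      by_cases hs : σ i = σ k
      · have h1 := (hZ i hi').2.2.2.1 t ht
        have h2 := (hZ k hk').2.2.2.1 t ht
        rw [hik, hs, ← h2] at h1
        have h3 := hΦi _ _ (hdiff i hi' t ht) (hdiff k hk' t ht) h1
        have h4 := hI5 t ht (i + 1) hi' (k + 1) hk' (sub_left_injective h3)
        omega
      · exfalso
        have h1 := disc_re _ _ _ (hσ i) hx ((hZ i hi').2.2.1 t ht)
        have h2 := disc_re _ _ _ (hσ k) hx ((hZ k hk').2.2.1 t ht)
        rw [hik] at h1
        rcases hσ i with ha | ha <;> rcases hσ k with hb | hb <;> rw [ha, hb] at hs <;>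
          first
          | exact hs rfl
          | (rw [ha] at h1; rw [hb] at h2; linarith)
    · simp only [hi', if_true, lt_irrefl, if_false] at hik
      exact absurd hik (hnz i hi')
    · simp only [hk', if_true, lt_irrefl, if_false] at hik
      exact absurd hik.symm (hnz k hk')
    · rfl
  · rcases hk.lt_or_eq with hk | rfl
    · simp only [hk, if_true]; exact (hZ k hk).2.2.2.2
    · simp only [lt_irrefl, if_false, hvm, Complex.ofReal_zero, mul_zero]
      exact hasDerivAt_const _ _

lemma core (ℓ b x c ρ : ℝ) (hℓ : 1 ≤ ℓ) (hb : 0 < b) (hx : 0 < x)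
    (hx2 : 2 * x < b * Real.exp (-(x ^ ℓ)⁻¹))
    (m : ℕ) (p v : ℕ → ℝ) (hm : 1 ≤ m) (hpm : p m = 0) (hpne : ∀ k < m, p k ≠ 0)
    (hpx : ∀ k < m, |p k| < x) (hinj : ∀ i ≤ m, ∀ k ≤ m, p i = p k → i = k)
    (hstep : ∀ k < m, p (k + 1) - p 0 = b * Real.exp (-(|p k| ^ ℓ)⁻¹))
    (hρ : 0 < ρ) (hρ1 : ρ ≤ 1) (hv0 : v 0 = 1) (hvm : v m = 0)
    (hv : ∀ k < m, v k * deriv (flatMap ℓ b c) (p k) = ρ * (v (k + 1) - v 0)) : False := by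
  classical
  obtain ⟨σ, hσ, hσp⟩ : ∃ σ : ℕ → ℝ, (∀ k, σ k = 1 ∨ σ k = -1) ∧ ∀ k, p k = σ k * |p k| := by
    refine ⟨fun k => if 0 ≤ p k then 1 else -1, fun k => ?_, fun k => ?_⟩
    · by_cases h : 0 ≤ p k <;> simp [h]
    · by_cases h : 0 ≤ p k
      · simp [h, abs_of_nonneg h]
      · simp only [h, if_false]; rw [abs_of_neg (not_le.1 h)]; ring
  obtain ⟨δ, hδ, hbase⟩ := motion_base m p σ v x hσ hσp hpm hpne hpx hinj hvm
  obtain ⟨ε, hε, Φ, hΦ, hΦr, hΦi⟩ := phi_exists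
    (insert 0 ((Finset.range m).image fun k => ((p (k + 1) - p 0 : ℝ) : ℂ))) (2 * x) _
    (by linarith) hx2
  have hμ : 1 < (1 + ε) / ρ := by rw [one_lt_div hρ]; linarith
  have key : ∀ n : ℕ, ∃ h : ℕ → ℂ → ℂ, MotionInv m p σ x δ h ∧
      ∀ k ≤ m, HasDerivAt (h k) ((((1 + ε) / ρ : ℝ) : ℂ) ^ n * v k) 0 := by
    intro n
    induction n with
    | zero =>
      refine ⟨_, hbase, fun k _ => ?_⟩
      have := ((hasDerivAt_id (0:ℂ)).mul_const (v k : ℂ)).const_add (p k : ℂ)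
      simpa using this
    | succ n ih =>
      obtain ⟨h, hI, hd⟩ := ih
      obtain ⟨h', hI', hd'⟩ := motion_step ℓ b x c δ ε ((1 + ε) / ρ) hℓ hb hx hδ m p σ v hm hσ hσp
        hpm hpne hstep hvm (fun k hk => by rw [hv k hk]; field_simp) Φ
        (hΦ 0 (by simp)).1 (fun k hk => hΦ _ (Finset.mem_insert_of_mem
          (Finset.mem_image_of_mem _ (Finset.mem_range.2 hk)))) hΦr hΦi h hI _ hd
      exact ⟨h', hI', fun k hk => by rw [pow_succ]; exact hd' k hk⟩
  obtain ⟨n, hn⟩ := pow_unbounded_of_one_lt (x / (δ / 2)) hμ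
  obtain ⟨h, hI, hd⟩ := key n
  have h1 := Complex.norm_deriv_le_of_forall_mem_sphere_norm_le (c := 0) (R := δ / 2) (C := x)
    (f := h 0) (by linarith)
    ((hI.1 0 (by omega)).diffContOnCl_ball (Metric.closedBall_subset_ball (by linarith)))
    (fun z hz => (disc_norm _ _ _ (hσ 0) hx (hI.2.2.2.1 0 (by omega) z (by
      simp at hz ⊢; linarith))).le)
  rw [(hd 0 (by omega)).deriv, hv0, Complex.ofReal_one, mul_one, norm_pow, Complex.norm_real,
    Real.norm_of_nonneg (by linarith)] at h1
  linarith

theorem stmt0 (ℓ b β : ℝ) (hℓ : 1 ≤ ℓ)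
    (hb : 2 * (Real.exp 1 * ℓ) ^ (1 / ℓ) < b)
    (hβ0 : 0 < β) (hβ1 : β < ℓ ^ (1 / ℓ))
    (hβ : 2 * β * Real.exp (1 / β ^ ℓ) = b)
    (c : ℝ) (hc : -β ≤ c) (q : ℕ) (hq : 1 ≤ q)
    (hper : (flatMap ℓ b c)^[q] 0 = 0)
    (hne : ∀ j, 1 ≤ j → j < q → (flatMap ℓ b c)^[j] 0 ≠ 0) :
    0 < ∑ n ∈ Finset.range q, 1 / flatDfn ℓ b c n := by
  have hb0 : 0 < b := by rw [← hβ]; positivity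
  have hℓ0 : 0 < ℓ := by linarith
  obtain ⟨m, rfl⟩ : ∃ m, q = m + 1 := ⟨q - 1, by omega⟩
  rcases Nat.eq_zero_or_pos m with rfl | hm
  · simp [flatDfn]
  obtain ⟨x, hβx, hx2⟩ := exists_x ℓ b β hℓ hβ0 hβ1 hβ
  have hf0 : flatMap ℓ b c 0 = c := by simp [flatMap]
  set p : ℕ → ℝ := fun k => (flatMap ℓ b c)^[k] c with hp
  have hpit : ∀ k, p k = (flatMap ℓ b c)^[k + 1] 0 := fun k => by
    rw [Function.iterate_succ_apply, hf0]
  have hpm : p m = 0 := by rw [hpit]; exact hper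
  have hpne : ∀ k < m, p k ≠ 0 := fun k hk => by
    rw [hpit]; exact hne _ (by omega) (by omega)
  have hpadd : ∀ i j, p (i + j) = (flatMap ℓ b c)^[i] (p j) := fun i j =>
    Function.iterate_add_apply _ _ _ _
  have hpsucc : ∀ k, p (k + 1) = flatMap ℓ b c (p k) := fun k =>
    Function.iterate_succ_apply' _ _ _
  have hlt : ∀ i ≤ m, ∀ k ≤ m, i < k → p i ≠ p k := fun i hi k hk hik h => by
    have h1 : p (m - k + i) = p (m - k + k) := by rw [hpadd, hpadd, h]
    rw [Nat.sub_add_cancel hk, hpm] at h1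
    exact hpne _ (by omega) h1
  have hinj : ∀ i ≤ m, ∀ k ≤ m, p i = p k → i = k := fun i hi k hk h => by
    rcases lt_trichotomy i k with h1 | h1 | h1
    · exact absurd h (hlt i hi k hk h1)
    · exact h1
    · exact absurd h.symm (hlt k hk i hi h1)
  have hstep : ∀ k < m, p (k + 1) - p 0 = b * Real.exp (-(|p k| ^ ℓ)⁻¹) := fun k hk => by
    rw [hpsucc, flatMap, if_neg (hpne k hk)]
    simp [hp, neg_div]
  have hinv : ∀ y, β ≤ |y| → β ≤ flatMap ℓ b c y := fun y hy => by
    have hy0 : y ≠ 0 := abs_pos.1 (hβ0.trans_le hy)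
    rw [flatMap, if_neg hy0]
    have hbv : b * Real.exp (-1 / β ^ ℓ) = 2 * β := by
      rw [← hβ, mul_assoc, ← Real.exp_add]; simp [neg_div]
    have : b * Real.exp (-1 / β ^ ℓ) ≤ b * Real.exp (-1 / |y| ^ ℓ) := by
      have h1 : β ^ ℓ ≤ |y| ^ ℓ := Real.rpow_le_rpow hβ0.le hy hℓ0.le
      have h2 : 0 < β ^ ℓ := Real.rpow_pos_of_pos hβ0 _
      have h3 : 1 / |y| ^ ℓ ≤ 1 / β ^ ℓ := one_div_le_one_div_of_le h2 h1
      refine mul_le_mul_of_nonneg_left (Real.exp_le_exp.2 ?_) hb0.le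
      rw [neg_div, neg_div]; linarith
    linarith
  have hpx : ∀ k < m, |p k| < x := fun k hk => by
    by_contra hcon
    have hcon : β ≤ |p k| := by linarith [not_lt.1 hcon]
    have hall : ∀ j, β ≤ |p (k + j)| := fun j => by
      induction j with
      | zero => exact hcon
      | succ j ih => rw [← add_assoc, hpsucc]; exact (hinv _ ih).trans (le_abs_self _)
    have := hall (m - k)
    rw [Nat.add_sub_cancel' hk.le, hpm, abs_zero] at this
    linarith
  have hdne : ∀ k < m, deriv (flatMap ℓ b c) (p k) ≠ 0 := fun k hk =>
    flat_deriv_ne ℓ b c (p k) hℓ hb0 (hpne k hk)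
  have hDsucc : ∀ k, flatDfn ℓ b c (k + 1) = flatDfn ℓ b c k * deriv (flatMap ℓ b c) (p k) :=
    fun k => Finset.prod_range_succ _ _
  have hDne : ∀ k ≤ m, flatDfn ℓ b c k ≠ 0 := fun k hk =>
    Finset.prod_ne_zero_iff.2 fun i hi => hdne i (by have := Finset.mem_range.1 hi; omega)
  by_contra hcon
  have hcon := not_lt.1 hcon
  obtain ⟨ρ, hρ, hρ0⟩ : ∃ ρ ∈ Set.Icc (0:ℝ) 1,
      ∑ n ∈ Finset.range (m + 1), ρ ^ n / flatDfn ℓ b c n = 0 := by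
    have hcont : ContinuousOn
        (fun ρ : ℝ => ∑ n ∈ Finset.range (m + 1), ρ ^ n / flatDfn ℓ b c n) (Set.Icc 0 1) := by
      fun_prop
    refine intermediate_value_Icc' zero_le_one hcont ⟨?_, ?_⟩
    · simpa using hcon
    · rw [Finset.sum_range_succ']
      simp [flatDfn]
  have hρpos : 0 < ρ := by
    rcases hρ.1.lt_or_eq with h | h
    · exact h
    · rw [← h, Finset.sum_range_succ'] at hρ0
      simp [flatDfn] at hρ0
  refine core ℓ b x c ρ hℓ hb0 (hβ0.trans hβx) hx2 m p
    (fun k => flatDfn ℓ b c k / ρ ^ k * ∑ n ∈ Finset.range (k + 1), ρ ^ n / flatDfn ℓ b c n)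
    hm hpm hpne hpx hinj hstep hρpos hρ.2 (by simp [flatDfn]) (by simp only [hρ0, mul_zero]) ?_
  intro k hk
  have hv0 : flatDfn ℓ b c 0 / ρ ^ 0 * ∑ n ∈ Finset.range (0 + 1), ρ ^ n / flatDfn ℓ b c n = 1 := by
    simp [flatDfn]
  rw [hv0, Finset.sum_range_succ _ (k + 1), hDsucc k]
  have h1 := hDne k hk.le
  have h2 := hdne k hk
  generalize ∑ n ∈ Finset.range (k + 1), ρ ^ n / flatDfn ℓ b c n = s
  field_simp
  ring
end

section
/- Fix real numbers ℓ ≥ 1 and b > 2(eℓ)^{1/ℓ}, and let β ∈ (0, ℓ^{1/ℓ}) satisfy 2β·exp(1/β^ℓ) = b. Then the kneading sequence of f_c is monotone increasing in c on [−β, ∞): for all c, c′ with −β ≤ c ≤ c′, one has K(f_c) ⪯ K(f_{c′}). -/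
/-- The kneading sequence of `f_c`: `i_k = sign (f_c^k(0))` for `k ≥ 1`. -/
noncomputable def flatKnead (ℓ b c : ℝ) (k : ℕ) : ℤ :=
  if 0 < (flatMap ℓ b c)^[k] 0 then 1
  else if (flatMap ℓ b c)^[k] 0 = 0 then 0
  else -1

/-- The strict order `≺` on kneading sequences: `i ≺ j` iff there is `n ≥ 1` such that
`i_k = j_k` for `1 ≤ k < n` and `∏_{k=1}^n i_k < ∏_{k=1}^n j_k`. -/
def KneadLT (i j : ℕ → ℤ) : Prop :=
  ∃ n : ℕ, 1 ≤ n ∧ (∀ k, 1 ≤ k → k < n → i k = j k) ∧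
    (∏ k ∈ Finset.Icc 1 n, i k) < ∏ k ∈ Finset.Icc 1 n, j k

/-- `i ⪯ j` iff `i ≺ j` or `i_k = j_k` for all `k ≥ 1`. -/
def KneadLE (i j : ℕ → ℤ) : Prop :=
  KneadLT i j ∨ ∀ k, 1 ≤ k → i k = j k

open Metric Complex in
lemma fk_exists_log (δ : ℝ) (hδ : 0 < δ) (g : ℂ → ℂ) (hg : DifferentiableOn ℂ g (ball 0 δ))
    (h0 : ∀ z ∈ ball (0:ℂ) δ, g z ≠ 0) :
    ∃ G : ℂ → ℂ, G 0 = Complex.log (g 0) ∧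
      (∀ z ∈ ball (0:ℂ) δ, HasDerivAt G (deriv g z / g z) z) ∧
      (∀ z ∈ ball (0:ℂ) δ, Complex.exp (G z) = g z) := by
  have hd : DifferentiableOn ℂ (fun z => deriv g z / g z) (ball 0 δ) :=
    (hg.deriv isOpen_ball).div hg h0
  obtain ⟨G, hG0, hG⟩ := hd.isExactOn_ball.with_val_at 0 (Complex.log (g 0))
  refine ⟨G, hG0, hG, fun z hz => ?_⟩
  have h00 : (0:ℂ) ∈ ball (0:ℂ) δ := mem_ball_self hδ
  have hder : ∀ z ∈ ball (0:ℂ) δ, HasDerivAt (fun z => Complex.exp (-G z) * g z) 0 z := by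
    intro z hz
    have h1 := ((hG z hz).neg.cexp).mul
      ((hg.differentiableAt (isOpen_ball.mem_nhds hz)).hasDerivAt)
    refine HasDerivAt.congr_deriv h1 ?_
    have := h0 z hz
    field_simp
    simp
  have hc := isOpen_ball.is_const_of_deriv_eq_zero (convex_ball (0:ℂ) δ).isPreconnected
    (fun z hz => (hder z hz).differentiableAt.differentiableWithinAt)
    (fun z hz => (hder z hz).deriv) hz h00
  simp only [hG0, Complex.exp_neg, Complex.exp_log (h0 0 h00)] at hc
  rw [inv_mul_cancel₀ (h0 0 h00)] at hc
  field_simp at hc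
  exact hc.symm

open Metric Complex in
lemma fk_lift (ℓ b r δ X : ℝ) (hℓ : 1 ≤ ℓ) (hb : 0 < b) (hr : 0 < r) (hκ : 0 < Real.log (b / (2 * r)))
    (hδ : 0 < δ) (hX : 0 < X) (g : ℂ → ℂ) (hg : DifferentiableOn ℂ g (ball 0 δ))
    (h0 : ∀ z ∈ ball (0:ℂ) δ, g z ≠ 0) (hgr : ∀ z ∈ ball (0:ℂ) δ, ‖g z‖ < 2 * r)
    (hg0 : g 0 = ((b * Real.exp (-1 / X ^ ℓ) : ℝ) : ℂ)) :
    ∃ Z : ℂ → ℂ, DifferentiableOn ℂ Z (ball 0 δ) ∧ Z 0 = X ∧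
      (∀ z ∈ ball (0:ℂ) δ, 0 < (Z z).re ∧ ‖Z z‖ ≤ (Real.log (b / (2 * r))) ^ (-(1/ℓ)) ∧
        (b : ℂ) * Complex.exp (-(Z z ^ (-(ℓ:ℂ)))) = g z) ∧
      deriv Z 0 = (((b * Real.exp (-1 / X ^ ℓ) * ℓ * X ^ (-ℓ - 1))⁻¹ : ℝ) : ℂ) * deriv g 0 := by
  obtain ⟨G, hG0, hG, hGe⟩ := fk_exists_log δ hδ g hg h0
  have h00 : (0:ℂ) ∈ ball (0:ℂ) δ := mem_ball_self hδ
  have hℓ0 : 0 < ℓ := by linarith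
  set W : ℂ → ℂ := fun z => (Real.log b : ℂ) - G z with hW
  have hWre : ∀ z ∈ ball (0:ℂ) δ, Real.log (b / (2 * r)) < (W z).re := by
    intro z hz
    have h1 : Real.exp (G z).re = ‖g z‖ := by rw [← hGe z hz, Complex.norm_exp]
    have h2 : (G z).re < Real.log (2 * r) := by
      rw [Real.lt_log_iff_exp_lt (by linarith), h1]; exact hgr z hz
    simp only [hW, sub_re, ofReal_re]
    rw [Real.log_div hb.ne' (by positivity)]
    linarith
  have hWpos : ∀ z ∈ ball (0:ℂ) δ, 0 < (W z).re := fun z hz => hκ.trans (hWre z hz)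
  have hWd : ∀ z ∈ ball (0:ℂ) δ, HasDerivAt W (-(deriv g z / g z)) z := by
    intro z hz
    simpa [hW] using (hG z hz).const_sub (Real.log b : ℂ)
  have hW0 : W 0 = ((X ^ (-ℓ) : ℝ) : ℂ) := by
    simp only [hW, hG0, hg0]
    rw [← Complex.ofReal_log (by positivity), Real.log_mul hb.ne' (Real.exp_pos _).ne', Real.log_exp,
      Real.rpow_neg hX.le]
    push_cast
    ring
  have hslit : ∀ z ∈ ball (0:ℂ) δ, W z ∈ slitPlane := fun z hz => Or.inl (hWpos z hz)
  have hZd : ∀ z ∈ ball (0:ℂ) δ, HasDerivAt (fun z => W z ^ ((-(1/ℓ) : ℝ) : ℂ)) _ z :=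
    fun z hz => (hWd z hz).cpow_const (hslit z hz)
  refine ⟨fun z => W z ^ ((-(1/ℓ) : ℝ) : ℂ), fun z hz => (hZd z hz).differentiableAt.differentiableWithinAt,
    ?_, ?_, ?_⟩
  · simp only [hW0]
    rw [← Complex.ofReal_cpow (by positivity), ← Real.rpow_mul hX.le]
    field_simp
    simp
  · intro z hz
    have hne : W z ≠ 0 := slitPlane_ne_zero (hslit z hz)
    have harg : |arg (W z)| < Real.pi / 2 := abs_arg_lt_pi_div_two_iff.2 (Or.inl (hWpos z hz))
    have him : (Complex.log (W z) * ((-(1/ℓ) : ℝ) : ℂ)).im = arg (W z) * (-(1/ℓ)) := by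
      rw [Complex.im_mul_ofReal, Complex.log_im]
    have hle : |arg (W z) * (-(1/ℓ))| < Real.pi / 2 := by
      rw [abs_mul, abs_neg, abs_of_pos (by positivity : 0 < 1/ℓ)]
      have : 1/ℓ ≤ 1 := by rw [div_le_one hℓ0]; exact hℓ
      have h3 := abs_nonneg (arg (W z))
      nlinarith
    rw [abs_lt] at hle
    have hpi := Real.pi_pos
    beta_reduce
    refine ⟨?_, ?_, ?_⟩
    · rw [Complex.cpow_def_of_ne_zero hne, Complex.exp_re, him]
      exact mul_pos (Real.exp_pos _) (Real.cos_pos_of_mem_Ioo ⟨by linarith, by linarith⟩)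
    · rw [Complex.norm_cpow_real]
      apply Real.rpow_le_rpow_of_nonpos hκ ((hWre z hz).le.trans (Complex.re_le_norm _))
      simp; positivity
    · rw [← Complex.cpow_mul _ (by rw [him]; linarith) (by rw [him]; linarith)]
      have : ((-(1/ℓ) : ℝ) : ℂ) * (-(ℓ:ℂ)) = 1 := by
        push_cast
        have : (ℓ:ℂ) ≠ 0 := by exact_mod_cast hℓ0.ne'
        field_simp
      rw [this, Complex.cpow_one]
      simp only [hW, neg_sub]
      rw [Complex.exp_sub, hGe z hz, ← Complex.ofReal_exp, Real.exp_log hb]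
      have : (b:ℂ) ≠ 0 := by exact_mod_cast hb.ne'
      field_simp
  · rw [(hZd 0 h00).deriv, hW0, hg0]
    have : ((-(1/ℓ) : ℝ) : ℂ) - 1 = ((-(1/ℓ) - 1 : ℝ) : ℂ) := by push_cast; ring
    rw [this, ← Complex.ofReal_cpow (by positivity), ← Real.rpow_mul hX.le]
    have h2 : -ℓ * (-(1/ℓ) - 1) = -(-ℓ - 1) := by field_simp; ring
    rw [h2, Real.rpow_neg hX.le (-ℓ-1)]
    have hb' : (b:ℂ) ≠ 0 := by exact_mod_cast hb.ne'
    have h4 : (ℓ:ℂ) ≠ 0 := by exact_mod_cast hℓ0.ne'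
    push_cast
    have h5 : ((X ^ (-ℓ - 1) : ℝ) : ℂ) ≠ 0 := by
      exact_mod_cast (Real.rpow_pos_of_pos hX _).ne'
    have h6 : Complex.exp (-1 / ((X ^ ℓ : ℝ) : ℂ)) ≠ 0 := Complex.exp_ne_zero _
    field_simp
open Metric Complex in
lemma fk_psi (S : Finset ℂ) (ρ r : ℝ) (hρ : ρ < r) :
    ∃ (ε : ℝ) (ψ : ℂ → ℂ), 0 < ε ∧ Differentiable ℂ ψ ∧ Set.InjOn ψ (closedBall 0 ρ) ∧
      (∀ z ∈ closedBall (0:ℂ) ρ, ‖ψ z‖ < r) ∧ (∀ z ∈ S, ψ z = z) ∧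
      (∀ z ∈ S, deriv ψ z = 1 + ε) := by
  classical
  set q := Lagrange.nodal S (id : ℂ → ℂ) with hq
  set g := Lagrange.interpolate S (id : ℂ → ℂ) (fun a => (q.derivative.eval a)⁻¹) with hg
  set p := q * g with hp
  have hq0 : ∀ a ∈ S, q.eval a = 0 := fun a ha => Lagrange.eval_nodal_at_node (v := id) ha
  have hq1 : ∀ a ∈ S, q.derivative.eval a ≠ 0 := by
    intro a ha
    have := Lagrange.eval_nodal_derivative_eval_node_eq (v := (id : ℂ → ℂ)) ha
    simp only [id] at this
    rw [hq]
    erw [this]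
    apply Lagrange.eval_nodal_not_at_node
    intro i hi
    simpa using (Finset.ne_of_mem_erase hi).symm
  have hg1 : ∀ a ∈ S, g.eval a = (q.derivative.eval a)⁻¹ := by
    intro a ha
    exact Lagrange.eval_interpolate_at_node (v := id) _ (Set.injOn_id _) ha
  have hp0 : ∀ a ∈ S, p.eval a = 0 := fun a ha => by simp [hp, hq0 a ha]
  have hp1 : ∀ a ∈ S, p.derivative.eval a = 1 := fun a ha => by
    simp [hp, hq0 a ha, hg1 a ha, hq1 a ha]
  obtain ⟨M, hM⟩ := (isCompact_closedBall (0:ℂ) ρ).exists_bound_of_continuousOn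
    (p.continuous.continuousOn)
  obtain ⟨M', hM'⟩ := (isCompact_closedBall (0:ℂ) ρ).exists_bound_of_continuousOn
    (p.derivative.continuous.continuousOn)
  set N := max (max M M') 0 + 1 with hN
  have hN0 : 0 < N := by positivity
  have hMN : M < N := by
    have := le_max_left (max M M') 0; have := le_max_left M M'; linarith
  have hMN' : M' < N := by
    have := le_max_left (max M M') 0; have := le_max_right M M'; linarith
  set ε := min (r - ρ) 1 / N with hε
  have hε0 : 0 < ε := div_pos (lt_min (by linarith) one_pos) hN0
  have hεN : ε * N = min (r - ρ) 1 := by rw [hε]; field_simp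
  have hd : ∀ z, HasDerivAt (fun z => z + (ε:ℂ) * p.eval z) (1 + ε * p.derivative.eval z) z :=
    fun z => (hasDerivAt_id z).add ((p.hasDerivAt z).const_mul _)
  refine ⟨ε, fun z => z + ε * p.eval z, hε0, fun z => (hd z).differentiableAt, ?_, ?_, ?_, ?_⟩
  · intro z hz w hw hzw
    have h1 : ‖p.eval z - p.eval w‖ ≤ M' * ‖z - w‖ :=
      (convex_closedBall (0:ℂ) ρ).norm_image_sub_le_of_norm_hasDerivWithin_le
        (fun y _ => (p.hasDerivAt y).hasDerivWithinAt) hM' hw hz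
    by_contra hne
    have hpos : 0 < ‖z - w‖ := norm_pos_iff.2 (sub_ne_zero.2 hne)
    have h2 : z - w = -((ε:ℂ) * (p.eval z - p.eval w)) := by
      simp only at hzw; linear_combination hzw
    have h3 : ‖z - w‖ = ε * ‖p.eval z - p.eval w‖ := by
      conv_lhs => rw [h2]
      rw [norm_neg, norm_mul, Complex.norm_real, Real.norm_of_nonneg hε0.le]
    have h4 : ε * M' < 1 := by
      have := min_le_right (r - ρ) 1
      nlinarith
    nlinarith
  · intro z hz
    have h1 : ‖z + ε * p.eval z‖ ≤ ‖z‖ + ε * ‖p.eval z‖ := by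
      refine (norm_add_le _ _).trans ?_
      rw [norm_mul, Complex.norm_real, Real.norm_of_nonneg hε0.le]
    have h2 := hM z hz
    have h3 : ‖z‖ ≤ ρ := by simpa using hz
    have := min_le_left (r - ρ) 1
    have : ε * ‖p.eval z‖ < ε * N := by
      apply mul_lt_mul_of_pos_left _ hε0
      linarith
    show ‖z + ε * p.eval z‖ < r
    linarith
  · intro z hz
    simp [hp0 z hz]
  · intro z hz
    rw [(hd z).deriv, hp1 z hz, mul_one]

/-- Inverse of the derivative of the flat map at `y`. -/
noncomputable def fkA (ℓ b y : ℝ) : ℝ :=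
  (if 0 < y then 1 else -1) * (b * Real.exp (-1 / |y| ^ ℓ) * ℓ * |y| ^ (-ℓ - 1))⁻¹

/-- A holomorphic motion of the points `x 1, …, x n` over the disc of radius `δ`. -/
def FkMotion (n : ℕ) (x v : ℕ → ℝ) (r δ C : ℝ) (h : ℕ → ℂ → ℂ) : Prop :=
  (∀ i, 1 ≤ i → i ≤ n → DifferentiableOn ℂ (h i) (Metric.ball 0 δ) ∧ h i 0 = x i ∧
    deriv (h i) 0 = C * v i ∧ ∀ z ∈ Metric.ball (0:ℂ) δ, ‖h i z‖ < r) ∧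
  (∀ i j, 1 ≤ i → i ≤ n → 1 ≤ j → j ≤ n → i ≠ j → ∀ z ∈ Metric.ball (0:ℂ) δ, h i z ≠ h j z) ∧
  ∀ z ∈ Metric.ball (0:ℂ) δ, h n z = 0

open Metric Complex in
lemma fk_step (ℓ b r δ t ε C : ℝ) (n : ℕ) (x v : ℕ → ℝ) (ψ : ℂ → ℂ)
    (hℓ : 1 ≤ ℓ) (hb : 0 < b) (hr : 0 < r) (hκ : 0 < Real.log (b / (2 * r)))
    (hδ : 0 < δ) (ht : 0 < t) (hn : 1 ≤ n)
    (hψd : Differentiable ℂ ψ)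
    (hψi : Set.InjOn ψ (closedBall 0 ((Real.log (b / (2 * r))) ^ (-(1/ℓ)))))
    (hψr : ∀ z ∈ closedBall (0:ℂ) ((Real.log (b / (2 * r))) ^ (-(1/ℓ))), ‖ψ z‖ < r)
    (hψx : ∀ i, 1 ≤ i → i ≤ n → ψ (x i) = x i)
    (hψ' : ∀ i, 1 ≤ i → i ≤ n → deriv ψ (x i) = 1 + ε)
    (hx0 : ∀ i, 1 ≤ i → i < n → x i ≠ 0)
    (hx : ∀ i, 1 ≤ i → i < n → x (i+1) - x 1 = b * Real.exp (-1 / |x i| ^ ℓ))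
    (hxn : x n = 0) (hvn : v n = 0)
    (hv : ∀ i, 1 ≤ i → i < n → v i = t * fkA ℓ b (x i) * (v (i+1) - v 1))
    (h : ℕ → ℂ → ℂ) (hh : FkMotion n x v r δ C h) :
    ∃ h', FkMotion n x v r δ (C * ((1 + ε) / t)) h' := by
  obtain ⟨h1, h2, h3⟩ := hh
  have h00 : (0:ℂ) ∈ ball (0:ℂ) δ := mem_ball_self hδ
  have hlift : ∀ i, ∃ Z : ℂ → ℂ, 1 ≤ i → i < n → DifferentiableOn ℂ Z (ball 0 δ) ∧
      Z 0 = ((|x i| : ℝ) : ℂ) ∧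
      (∀ z ∈ ball (0:ℂ) δ, 0 < (Z z).re ∧ ‖Z z‖ ≤ (Real.log (b / (2 * r))) ^ (-(1/ℓ)) ∧
        (b : ℂ) * Complex.exp (-(Z z ^ (-(ℓ:ℂ)))) = h (i+1) z - h 1 z) ∧
      deriv Z 0 = (((b * Real.exp (-1 / |x i| ^ ℓ) * ℓ * |x i| ^ (-ℓ - 1))⁻¹ : ℝ) : ℂ) *
        (C * (v (i+1) - v 1)) := by
    intro i
    by_cases hi : 1 ≤ i ∧ i < n
    · obtain ⟨hi1, hi2⟩ := hi
      obtain ⟨d1, e1, f1, g1⟩ := h1 1 le_rfl (by omega)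
      obtain ⟨d2, e2, f2, g2⟩ := h1 (i+1) (by omega) (by omega)
      obtain ⟨Z, hZ1, hZ2, hZ3, hZ4⟩ := fk_lift ℓ b r δ (|x i|) hℓ hb hr hκ hδ
        (abs_pos.2 (hx0 i hi1 hi2)) (fun z => h (i+1) z - h 1 z) (d2.sub d1)
        (fun z hz => sub_ne_zero.2 (h2 (i+1) 1 (by omega) (by omega) le_rfl (by omega) (by omega) z hz))
        (fun z hz => (norm_sub_le _ _).trans_lt (by linarith [g1 z hz, g2 z hz]))
        (by rw [e1, e2, ← hx i hi1 hi2]; push_cast; ring)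
      refine ⟨Z, fun _ _ => ⟨hZ1, hZ2, hZ3, ?_⟩⟩
      rw [hZ4]
      congr 1
      have := ((d2.differentiableAt (isOpen_ball.mem_nhds h00)).hasDerivAt.sub
        (d1.differentiableAt (isOpen_ball.mem_nhds h00)).hasDerivAt).deriv
      rw [f1, f2] at this
      refine this.trans ?_
      ring
    · exact ⟨0, fun a b => absurd ⟨a, b⟩ hi⟩
  choose Z hZ using hlift
  set σ : ℕ → ℝ := fun i => if 0 < x i then 1 else -1 with hσ
  have hσ1 : ∀ i, σ i = 1 ∨ σ i = -1 := by
    intro i; simp only [hσ]; split_ifs <;> simp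
  have hσn : ∀ i, ‖(σ i : ℂ)‖ = 1 := by
    intro i; rcases hσ1 i with h | h <;> simp [h]
  have hσx : ∀ i, σ i * |x i| = x i := by
    intro i
    simp only [hσ]
    split_ifs with hp
    · rw [abs_of_pos hp, one_mul]
    · rw [abs_of_nonpos (not_lt.1 hp)]; ring
  set ρ := (Real.log (b / (2 * r))) ^ (-(1/ℓ)) with hρ
  have hρ0 : 0 < ρ := Real.rpow_pos_of_pos hκ _
  have hmem : ∀ i, 1 ≤ i → i < n → ∀ z ∈ ball (0:ℂ) δ, (σ i : ℂ) * Z i z ∈ closedBall (0:ℂ) ρ := by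
    intro i hi1 hi2 z hz
    rw [mem_closedBall_zero_iff, norm_mul, hσn, one_mul]
    exact ((hZ i hi1 hi2).2.2.1 z hz).2.1
  have hψ0 : ψ 0 = 0 := by
    have := hψx n hn le_rfl
    rwa [hxn, ofReal_zero] at this
  have hne0 : ∀ i, 1 ≤ i → i < n → ∀ z ∈ ball (0:ℂ) δ, ψ ((σ i : ℂ) * Z i z) ≠ 0 := by
    intro i hi1 hi2 z hz he
    rw [← hψ0] at he
    have h5 := hψi (hmem i hi1 hi2 z hz) (by simp [hρ0.le]) he
    have h6 : Z i z = 0 := by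
      rcases mul_eq_zero.1 h5 with h | h
      · have := hσn i; rw [h] at this; simp at this
      · exact h
    have := ((hZ i hi1 hi2).2.2.1 z hz).1
    rw [h6] at this
    simp at this
  refine ⟨fun i => if i < n then fun z => ψ ((σ i : ℂ) * Z i z) else 0, ?_, ?_, ?_⟩
  · intro i hi1 hi2
    rcases hi2.lt_or_eq with hi | hi
    · simp only [hi, if_true]
      obtain ⟨a1, a2, a3, a4⟩ := hZ i hi1 hi
      have h7 : (σ i : ℂ) * Z i 0 = x i := by rw [a2]; exact_mod_cast hσx i
      refine ⟨hψd.comp_differentiableOn (a1.const_mul _), ?_, ?_, ?_⟩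
      · rw [h7]; exact hψx i hi1 hi2
      · have hd := (a1.differentiableAt (isOpen_ball.mem_nhds h00)).hasDerivAt.const_mul (σ i : ℂ)
        have hd2 := HasDerivAt.comp (0:ℂ) (hψd ((σ i : ℂ) * Z i 0)).hasDerivAt hd
        refine hd2.deriv.trans ?_
        rw [h7, hψ' i hi1 hi2, a4, hv i hi1 hi]
        have ht' : (t:ℂ) ≠ 0 := by exact_mod_cast ht.ne'
        simp only [fkA]
        change _ = _ * ((t * (σ i * _) * _ : ℝ) : ℂ)
        push_cast
        field_simp
      · intro z hz
        exact hψr _ (hmem i hi1 hi z hz)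
    · subst hi
      simp [hxn, hvn, hr]
  · intro i j hi1 hi2 hj1 hj2 hij z hz
    rcases hi2.lt_or_eq with hi | hi <;> rcases hj2.lt_or_eq with hj | hj
    · simp only [hi, hj, if_true]
      intro he
      have h5 := hψi (hmem i hi1 hi z hz) (hmem j hj1 hj z hz) he
      have hri := ((hZ i hi1 hi).2.2.1 z hz).1
      have hrj := ((hZ j hj1 hj).2.2.1 z hz).1
      have h6 : Z i z = Z j z := by
        rcases hσ1 i with h | h <;> rcases hσ1 j with h' | h' <;> rw [h, h'] at h5
        · simpa using h5
        · have := congrArg Complex.re h5; simp at this; linarith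
        · have := congrArg Complex.re h5; simp at this; linarith
        · simpa using h5
      have e1 := ((hZ i hi1 hi).2.2.1 z hz).2.2
      have e2 := ((hZ j hj1 hj).2.2.1 z hz).2.2
      rw [h6, e2] at e1
      exact h2 (j+1) (i+1) (by omega) (by omega) (by omega) (by omega) (by omega) z hz
        (sub_left_injective e1)
    · subst hj
      simp only [hi, if_true, lt_irrefl, if_false]
      exact hne0 i hi1 hi z hz
    · subst hi
      simp only [hj, if_true, lt_irrefl, if_false]
      exact (hne0 j hj1 hj z hz).symm
    · omega
  · intro z _
    simp

open Metric Complex in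
lemma fk_no_eigen (ℓ b r t : ℝ) (n : ℕ) (x v : ℕ → ℝ)
    (hℓ : 1 ≤ ℓ) (hb : 0 < b) (hr : 0 < r) (hκ : 0 < Real.log (b / (2 * r)))
    (hρ : (Real.log (b / (2 * r))) ^ (-(1/ℓ)) < r)
    (ht : 0 < t) (ht1 : t ≤ 1) (hn : 1 ≤ n)
    (hx0 : ∀ i, 1 ≤ i → i < n → x i ≠ 0)
    (hx : ∀ i, 1 ≤ i → i < n → x (i+1) - x 1 = b * Real.exp (-1 / |x i| ^ ℓ))
    (hxr : ∀ i, 1 ≤ i → i ≤ n → |x i| < r)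
    (hxd : ∀ i j, 1 ≤ i → i ≤ n → 1 ≤ j → j ≤ n → i ≠ j → x i ≠ x j)
    (hxn : x n = 0) (hvn : v n = 0) (hv1 : v 1 = 1)
    (hv : ∀ i, 1 ≤ i → i < n → v i = t * fkA ℓ b (x i) * (v (i+1) - v 1)) : False := by
  classical
  obtain ⟨ε, ψ, hε, hψd, hψi, hψr, hψx, hψ'⟩ :=
    fk_psi ((Finset.Icc 1 n).image (fun i => (x i : ℂ))) _ r hρ
  have hS : ∀ i, 1 ≤ i → i ≤ n → (x i : ℂ) ∈ (Finset.Icc 1 n).image (fun i => (x i : ℂ)) :=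
    fun i h1 h2 => Finset.mem_image_of_mem (fun i => (x i : ℂ)) (Finset.mem_Icc.2 ⟨h1, h2⟩)
  -- initial motion
  have hcont : ∀ i, Continuous (fun z : ℂ => (x i : ℂ) + z * v i) := fun i => by fun_prop
  have ev1 : ∀ᶠ z in nhds (0:ℂ), ∀ i ∈ Finset.Icc 1 n, ‖(x i : ℂ) + z * v i‖ < r := by
    rw [Filter.eventually_all_finset]
    intro i hi
    rw [Finset.mem_Icc] at hi
    apply (hcont i).norm.continuousAt.eventually_lt continuousAt_const
    simpa using hxr i hi.1 hi.2
  have ev2 : ∀ᶠ z in nhds (0:ℂ), ∀ i ∈ Finset.Icc 1 n, ∀ j ∈ Finset.Icc 1 n, i ≠ j →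
      (x i : ℂ) + z * v i ≠ (x j : ℂ) + z * v j := by
    rw [Filter.eventually_all_finset]
    intro i hi
    rw [Filter.eventually_all_finset]
    intro j hj
    rw [Finset.mem_Icc] at hi hj
    by_cases hij : i = j
    · simp [hij]
    · have : ∀ᶠ z in nhds (0:ℂ), (x i : ℂ) + z * v i ≠ (x j : ℂ) + z * v j := by
        have hc : ContinuousAt (fun z : ℂ => ((x i : ℂ) + z * v i) - ((x j : ℂ) + z * v j)) 0 := by
          fun_prop
        have hne := hc.eventually_ne (y := 0)
          (by simpa [sub_eq_zero] using hxd i j hi.1 hi.2 hj.1 hj.2 hij)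
        exact hne.mono (fun z hz => sub_ne_zero.1 hz)
      exact this.mono (fun z hz _ => hz)
  obtain ⟨δ, hδ, hball⟩ := Metric.eventually_nhds_iff_ball.1 (ev1.and ev2)
  have hm0 : FkMotion n x v r δ 1 (fun i z => (x i : ℂ) + z * v i) := by
    refine ⟨?_, ?_, ?_⟩
    · intro i h1 h2
      have hd : HasDerivAt (fun z : ℂ => (x i : ℂ) + z * v i) (v i) 0 := by
        simpa using ((hasDerivAt_id (0:ℂ)).mul_const (v i : ℂ)).const_add (x i : ℂ)
      refine ⟨by fun_prop, by simp, by rw [hd.deriv]; simp, ?_⟩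
      intro z hz
      exact (hball z hz).1 i (Finset.mem_Icc.2 ⟨h1, h2⟩)
    · intro i j h1 h2 h3 h4 hij z hz
      exact (hball z hz).2 i (Finset.mem_Icc.2 ⟨h1, h2⟩) j (Finset.mem_Icc.2 ⟨h3, h4⟩) hij
    · intro z _
      simp [hxn, hvn]
  have hmk : ∀ k : ℕ, ∃ h, FkMotion n x v r δ (((1 + ε) / t) ^ k) h := by
    intro k
    induction k with
    | zero => exact ⟨_, by simpa using hm0⟩
    | succ k ih =>
      obtain ⟨h, hh⟩ := ih
      rw [pow_succ]
      exact fk_step ℓ b r δ t ε _ n x v ψ hℓ hb hr hκ hδ ht hn hψd hψi hψr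
        (fun i h1 h2 => hψx _ (hS i h1 h2)) (fun i h1 h2 => hψ' _ (hS i h1 h2))
        hx0 hx hxn hvn hv h hh
  have hgt : 1 < (1 + ε) / t := by rw [lt_div_iff₀ ht]; linarith
  obtain ⟨k, hk⟩ := pow_unbounded_of_one_lt (2 * r / δ) hgt
  obtain ⟨h, hh⟩ := hmk k
  obtain ⟨a1, a2, a3, a4⟩ := hh.1 1 le_rfl hn
  have hle := norm_deriv_le_div_of_mapsTo_ball (R₂ := 2 * r) a1 (by
    intro z hz
    rw [mem_closedBall, dist_eq_norm]
    have := a4 z hz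
    have := a4 0 (mem_ball_self hδ)
    exact (norm_sub_le _ _).trans (by linarith)) hδ
  rw [a3, hv1] at hle
  have : ‖((((1 + ε) / t) ^ k : ℝ) : ℂ) * ((1:ℝ):ℂ)‖ = ((1 + ε) / t) ^ k := by
    rw [norm_mul, Complex.norm_real, Complex.norm_real, Real.norm_of_nonneg (by positivity)]
    simp
  rw [this] at hle
  linarith

lemma fkA_mul_pos (ℓ b y : ℝ) (hℓ : 1 ≤ ℓ) (hb : 0 < b) (hy : y ≠ 0) :
    0 < fkA ℓ b y * (if 0 < y then 1 else -1) := by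
  have h : 0 < (b * Real.exp (-1 / |y| ^ ℓ) * ℓ * |y| ^ (-ℓ - 1))⁻¹ := by
    have : 0 < |y| := abs_pos.2 hy
    positivity
  unfold fkA
  split_ifs <;> linarith

lemma fk_hasDerivAt (ℓ b y : ℝ) (hy : y ≠ 0) :
    HasDerivAt (flatMap ℓ b 0) ((fkA ℓ b y)⁻¹) y := by
  have key : ∀ s : ℝ, 0 < s * y → (s = 1 ∨ s = -1) →
      HasDerivAt (fun y => b * Real.exp (-(s * y) ^ (-ℓ)))
        (s * (b * Real.exp (-(s * y) ^ (-ℓ)) * ℓ * (s * y) ^ (-ℓ - 1))) y := by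
    intro s hs _
    have h1 : HasDerivAt (fun y => s * y) s y := by
      simpa using (hasDerivAt_id y).const_mul s
    have h2 := ((h1.rpow_const (p := -ℓ) (Or.inl hs.ne')).neg.exp).const_mul b
    refine h2.congr_deriv ?_
    simp only [Pi.neg_apply]
    ring
  have heq : ∀ s : ℝ, (s = 1 ∨ s = -1) → ∀ z, 0 < s * z →
      flatMap ℓ b 0 z = b * Real.exp (-(s * z) ^ (-ℓ)) ∧ |z| = s * z := by
    intro s hs z hz
    have hz0 : z ≠ 0 := by rintro rfl; simp at hz
    have habs : |z| = s * z := by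
      rcases hs with rfl | rfl
      · rw [one_mul] at *; exact abs_of_pos hz
      · rw [neg_one_mul] at *; exact abs_of_neg (by linarith)
    refine ⟨?_, habs⟩
    simp only [flatMap, hz0, if_false, add_zero, habs]
    rw [Real.rpow_neg hz.le, neg_div, one_div]
  have main : ∀ s : ℝ, 0 < s * y → (s = 1 ∨ s = -1) → (if 0 < y then (1:ℝ) else -1) = s →
      HasDerivAt (flatMap ℓ b 0) ((fkA ℓ b y)⁻¹) y := by
    intro s hs hs1 hif
    have hev : flatMap ℓ b 0 =ᶠ[nhds y] (fun y => b * Real.exp (-(s * y) ^ (-ℓ))) := by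
      have hc : ContinuousAt (fun z : ℝ => s * z) y := by fun_prop
      filter_upwards [continuousAt_const.eventually_lt hc hs] with z hz
      exact (heq s hs1 z hz).1
    refine ((key s hs hs1).congr_of_eventuallyEq hev).congr_deriv ?_
    unfold fkA
    rw [hif, (heq s hs1 y hs).2, Real.rpow_neg hs.le ℓ, neg_div, one_div, mul_inv, inv_inv]
    rcases hs1 with rfl | rfl <;> norm_num
  rcases lt_or_gt_of_ne hy with h | h
  · exact main (-1) (by linarith) (Or.inr rfl) (if_neg (by linarith))
  · exact main 1 (by linarith) (Or.inl rfl) (if_pos h)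

/-- `fkF k c = f_c^k(0)`. -/
noncomputable def fkF (ℓ b : ℝ) (k : ℕ) (c : ℝ) : ℝ := (flatMap ℓ b c)^[k] 0

lemma fkF_succ (ℓ b : ℝ) (k : ℕ) (c : ℝ) :
    fkF ℓ b (k+1) c = flatMap ℓ b 0 (fkF ℓ b k c) + c := by
  unfold fkF
  rw [Function.iterate_succ_apply']
  unfold flatMap
  split_ifs <;> simp

lemma fkF_zero (ℓ b c : ℝ) : fkF ℓ b 0 c = 0 := rfl

lemma fkF_one (ℓ b c : ℝ) : fkF ℓ b 1 c = c := by
  rw [fkF_succ, fkF_zero]; simp [flatMap]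

lemma fkF_add_of_eq (ℓ b c : ℝ) (i j k : ℕ) (h : fkF ℓ b i c = fkF ℓ b j c) :
    fkF ℓ b (k + i) c = fkF ℓ b (k + j) c := by
  unfold fkF at *
  rw [Function.iterate_add_apply, Function.iterate_add_apply, h]

/-- Formal derivative of the critical orbit, with the weight `t`. -/
noncomputable def fkV (t : ℝ) (a : ℕ → ℝ) : ℕ → ℝ
  | 0 => 0
  | k+1 => 1 + fkV t a k / (t * a k)

lemma fkV_one (t : ℝ) (a : ℕ → ℝ) : fkV t a 1 = 1 := by simp [fkV]

lemma fkV_prod (t : ℝ) (a : ℕ → ℝ) (ht : t ≠ 0) (m : ℕ) (ha : ∀ i, 1 ≤ i → i < m → a i ≠ 0)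
    (k : ℕ) (hk : 1 ≤ k) (hkm : k ≤ m) :
    fkV t a k * ∏ i ∈ Finset.Ico 1 k, (t * a i) =
      ∑ j ∈ Finset.range k, ∏ i ∈ Finset.Ico 1 (j+1), (t * a i) := by
  induction k, hk using Nat.le_induction with
  | base => simp [fkV_one]
  | succ k hk ih =>
    have h1 := ih (by omega)
    rw [Finset.sum_range_succ, ← h1, Finset.prod_Ico_succ_top hk]
    have h2 := ha k hk (by omega)
    simp only [fkV]
    field_simp
    ring

lemma fkF_hasDerivAt (ℓ b c : ℝ) (m : ℕ) (h : ∀ i, 1 ≤ i → i < m → fkF ℓ b i c ≠ 0)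
    (k : ℕ) (hk : 1 ≤ k) (hkm : k ≤ m) :
    HasDerivAt (fkF ℓ b k) (fkV 1 (fun i => fkA ℓ b (fkF ℓ b i c)) k) c := by
  induction k, hk using Nat.le_induction with
  | base =>
    rw [fkV_one]
    have : fkF ℓ b 1 = id := by funext c; exact fkF_one ℓ b c
    rw [this]; exact hasDerivAt_id c
  | succ k hk ih =>
    have h1 := ih (by omega)
    have h2 := (fk_hasDerivAt ℓ b _ (h k hk (by omega))).comp c h1
    have h3 := h2.add (hasDerivAt_id c)
    have : fkF ℓ b (k+1) = (flatMap ℓ b 0 ∘ fkF ℓ b k) + id := by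
      funext c; simp [fkF_succ]
    rw [this]
    refine h3.congr_deriv ?_
    simp only [fkV, one_mul]
    rw [div_eq_mul_inv]; ring

lemma fk_bound (ℓ b β : ℝ) (hℓ : 1 ≤ ℓ) (hβ0 : 0 < β) (hβ1 : β < ℓ ^ (1 / ℓ))
    (hβ : 2 * β * Real.exp (1 / β ^ ℓ) = b) (s : ℝ) (hs : 0 < s) (hsβ : s ≤ β) :
    b * Real.exp (-1 / s ^ ℓ) ≤ 2 * s := by
  have hℓ0 : 0 < ℓ := by linarith
  have hβℓ : β ^ ℓ ≤ ℓ := by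
    have := Real.rpow_le_rpow hβ0.le hβ1.le hℓ0.le
    rwa [← Real.rpow_mul hℓ0.le, one_div_mul_cancel hℓ0.ne', Real.rpow_one] at this
  have hs' : 0 < s ^ ℓ := Real.rpow_pos_of_pos hs _
  have hβ' : 0 < β ^ ℓ := Real.rpow_pos_of_pos hβ0 _
  set u := (β / s) ^ ℓ with hu
  have hu0 : 0 < u := by positivity
  have hu1 : 1 ≤ u := Real.one_le_rpow ((one_le_div hs).2 hsβ) hℓ0.le
  have hlog : Real.log u = ℓ * (Real.log β - Real.log s) := by
    rw [hu, Real.log_rpow (by positivity), Real.log_div hβ0.ne' hs.ne']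
  have hus : u * (1 / β ^ ℓ) = 1 / s ^ ℓ := by
    rw [hu, Real.div_rpow hβ0.le hs.le]; field_simp
  have h1 := Real.log_le_sub_one_of_pos hu0
  have h2 : ℓ * (1 / β ^ ℓ) ≥ 1 := by
    rw [mul_one_div, ge_iff_le, one_le_div hβ']; exact hβℓ
  have h3 : Real.log β - Real.log s ≤ 1 / s ^ ℓ - 1 / β ^ ℓ := by
    rw [← hus]
    have : ℓ * (Real.log β - Real.log s) ≤ ℓ * (u * (1 / β ^ ℓ) - 1 / β ^ ℓ) := by
      rw [← hlog]; nlinarith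
    exact le_of_mul_le_mul_left this hℓ0
  have h4 : Real.exp (Real.log β + (1 / β ^ ℓ + -1 / s ^ ℓ)) ≤ Real.exp (Real.log s) := by
    apply Real.exp_le_exp.2
    have : -1 / s ^ ℓ = -(1 / s ^ ℓ) := by ring
    linarith
  rw [Real.exp_add, Real.exp_add, Real.exp_log hβ0, Real.exp_log hs] at h4
  rw [← hβ]; linarith

lemma fkF_abs_le (ℓ b β : ℝ) (hb : 0 < b) (hℓ : 1 ≤ ℓ) (hβ0 : 0 < β) (hβ1 : β < ℓ ^ (1 / ℓ))
    (hβ : 2 * β * Real.exp (1 / β ^ ℓ) = b) (c : ℝ) (hc : -β ≤ c) (hc0 : c ≤ 0) (k : ℕ) :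
    |fkF ℓ b k c| ≤ -c := by
  induction k with
  | zero => simp [fkF_zero, hc0]
  | succ k ih =>
    rw [fkF_succ]
    by_cases h : fkF ℓ b k c = 0
    · simp [flatMap, h, abs_of_nonpos hc0]
    · simp only [flatMap, h, if_false, add_zero]
      have h1 := fk_bound ℓ b β hℓ hβ0 hβ1 hβ _ (abs_pos.2 h) (by linarith)
      have h2 : 0 < b * Real.exp (-1 / |fkF ℓ b k c| ^ ℓ) := by positivity
      rw [abs_le]
      constructor <;> linarith

lemma fkF_pos (ℓ b : ℝ) (hb : 0 < b) (c : ℝ) (hc0 : 0 < c) (k : ℕ) (hk : 1 ≤ k) :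
    0 < fkF ℓ b k c := by
  obtain ⟨k, rfl⟩ : ∃ j, k = j + 1 := ⟨k - 1, by omega⟩
  rw [fkF_succ]
  have : 0 ≤ flatMap ℓ b 0 (fkF ℓ b k c) := by
    unfold flatMap
    split_ifs
    · exact le_rfl
    · positivity
  linarith

lemma fkKnead_eq (ℓ b c : ℝ) (k : ℕ) : flatKnead ℓ b c k =
    if 0 < fkF ℓ b k c then 1 else if fkF ℓ b k c = 0 then 0 else -1 := rfl

lemma fk_transversal (ℓ b β : ℝ) (hℓ : 1 ≤ ℓ)
    (hb : 2 * (Real.exp 1 * ℓ) ^ (1 / ℓ) < b)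
    (hβ0 : 0 < β) (hβ1 : β < ℓ ^ (1 / ℓ))
    (hβ : 2 * β * Real.exp (1 / β ^ ℓ) = b)
    (c : ℝ) (hc : -β ≤ c) (m : ℕ) (hm : 1 ≤ m) (hm0 : fkF ℓ b m c = 0)
    (h : ∀ i, 1 ≤ i → i < m → fkF ℓ b i c ≠ 0) :
    ∃ D : ℝ, HasDerivAt (fkF ℓ b m) D c ∧
      0 < D * ((∏ k ∈ Finset.Ico 1 m, flatKnead ℓ b c k : ℤ) : ℝ) := by
  have hℓ0 : 0 < ℓ := by linarith
  have hb0 : 0 < b := by rw [← hβ]; positivity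
  have hc0 : c ≤ 0 := by
    by_contra hcon
    exact (fkF_pos ℓ b hb0 c (not_le.1 hcon) m hm).ne' hm0
  set r := ℓ ^ (1 / ℓ) with hr
  have hr0 : 0 < r := by positivity
  have hκ : 1 / ℓ < Real.log (b / (2 * r)) := by
    rw [Real.lt_log_iff_exp_lt (by positivity), lt_div_iff₀ (by positivity)]
    rw [Real.mul_rpow (Real.exp_pos _).le hℓ0.le, ← Real.exp_mul, one_mul] at hb
    linarith
  have hκ0 : 0 < Real.log (b / (2 * r)) := lt_trans (by positivity) hκ
  have hρ : (Real.log (b / (2 * r))) ^ (-(1/ℓ)) < r := by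
    have h1 : (Real.log (b / (2 * r))) ^ (-(1/ℓ)) < (1 / ℓ) ^ (-(1/ℓ)) := by
      apply Real.rpow_lt_rpow_of_neg (by positivity) hκ
      simp; positivity
    have h2 : (1 / ℓ) ^ (-(1/ℓ)) = r := by
      rw [one_div, Real.inv_rpow hℓ0.le, Real.rpow_neg hℓ0.le, inv_inv, hr, one_div]
    linarith
  set x : ℕ → ℝ := fun i => fkF ℓ b i c with hx
  set a : ℕ → ℝ := fun i => fkA ℓ b (x i) with ha
  have ha0 : ∀ i, 1 ≤ i → i < m → a i ≠ 0 := by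
    intro i h1 h2 h3
    have := fkA_mul_pos ℓ b (x i) hℓ hb0 (h i h1 h2)
    rw [show fkA ℓ b (x i) = 0 from h3] at this
    simp at this
  have hxd : ∀ i j, 1 ≤ i → i ≤ m → 1 ≤ j → j ≤ m → i < j → x i ≠ x j := by
    intro i j h1 h2 h3 h4 hij he
    have := fkF_add_of_eq ℓ b c i j (m - j) he
    rw [show m - j + j = m by omega, hm0] at this
    exact h _ (by omega) (by omega) this
  set Q : ℝ → ℝ := fun t => ∑ j ∈ Finset.range m, ∏ i ∈ Finset.Ico 1 (j+1), (t * a i) with hQ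
  have hQc : Continuous Q := by fun_prop
  have hQ0 : Q 0 = 1 := by
    simp only [hQ]
    rw [Finset.sum_eq_single 0]
    · simp
    · intro j _ hj
      apply Finset.prod_eq_zero (i := 1)
      · simp; omega
      · simp
    · intro h; simp at h; omega
  have hQne : ∀ t, 0 < t → t ≤ 1 → Q t ≠ 0 := by
    intro t ht ht1 hQt
    have h1 := fkV_prod t a ht.ne' m ha0 m hm le_rfl
    have h2 : ∏ i ∈ Finset.Ico 1 m, (t * a i) ≠ 0 := by
      rw [Finset.prod_ne_zero_iff]
      intro i hi
      rw [Finset.mem_Ico] at hi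
      exact mul_ne_zero ht.ne' (ha0 i hi.1 hi.2)
    have h3 : fkV t a m = 0 := by
      have : fkV t a m * ∏ i ∈ Finset.Ico 1 m, (t * a i) = 0 := h1.trans hQt
      exact (mul_eq_zero.1 this).resolve_right h2
    refine fk_no_eigen ℓ b r t m x (fkV t a) hℓ hb0 hr0 hκ0 hρ ht ht1 hm h ?_ ?_ ?_ hm0 h3
      (fkV_one t a) ?_
    · intro i h1 h2
      have h4 := h i h1 h2
      simp only [hx]
      rw [fkF_one, fkF_succ]
      simp [flatMap, h4]
    · intro i _ _
      have := fkF_abs_le ℓ b β hb0 hℓ hβ0 hβ1 hβ c hc hc0 i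
      exact lt_of_le_of_lt this (by linarith)
    · intro i j h1 h2 h3 h4 hij
      rcases lt_or_gt_of_ne hij with h5 | h5
      · exact hxd i j h1 h2 h3 h4 h5
      · exact (hxd j i h3 h4 h1 h2 h5).symm
    · intro i h1 h2
      have h4 := ha0 i h1 h2
      rw [fkV_one]
      change _ = t * a i * _
      simp only [fkV]
      field_simp
      ring
  have hQ1 : 0 < Q 1 := by
    by_contra hcon
    have : (0:ℝ) ∈ Set.Icc (Q 1) (Q 0) := ⟨not_lt.1 hcon, by rw [hQ0]; exact zero_le_one⟩
    obtain ⟨t, ht, ht0⟩ := intermediate_value_Icc' zero_le_one hQc.continuousOn this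
    rcases ht.1.eq_or_lt with h1 | h1
    · rw [← h1, hQ0] at ht0; norm_num at ht0
    · exact hQne t h1 ht.2 ht0
  refine ⟨_, fkF_hasDerivAt ℓ b c m h m hm le_rfl, ?_⟩
  have h1 : fkV 1 a m * ∏ i ∈ Finset.Ico 1 m, (1 * a i) = Q 1 :=
    fkV_prod 1 a one_ne_zero m ha0 m hm le_rfl
  simp only [one_mul] at h1
  change 0 < fkV 1 a m * _
  have h2 : 0 < (∏ i ∈ Finset.Ico 1 m, a i) *
      ((∏ k ∈ Finset.Ico 1 m, flatKnead ℓ b c k : ℤ) : ℝ) := by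
    push_cast
    rw [← Finset.prod_mul_distrib]
    apply Finset.prod_pos
    intro i hi
    rw [Finset.mem_Ico] at hi
    have h3 := fkA_mul_pos ℓ b (x i) hℓ hb0 (h i hi.1 hi.2)
    rw [fkKnead_eq, if_neg (h i hi.1 hi.2)]
    have h5 : (((if 0 < fkF ℓ b i c then 1 else -1 : ℤ)) : ℝ) =
        if 0 < fkF ℓ b i c then 1 else -1 := by
      split_ifs <;> simp
    rw [h5]
    exact h3
  have h3 : 0 < fkV 1 a m * ∏ i ∈ Finset.Ico 1 m, a i := by rw [h1]; exact hQ1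
  have h4 := mul_pos h2 h3
  set A := ∏ i ∈ Finset.Ico 1 m, a i
  have hA : A ≠ 0 := by rintro h; rw [h] at h3; simp at h3
  have : 0 < A ^ 2 := by positivity
  refine (mul_pos_iff_of_pos_left this).1 ?_
  calc _ < _ := h4
    _ = _ := by ring

/-- Numerical code of the first `n` entries of the kneading sequence. -/
def fkCode (i : ℕ → ℤ) : ℕ → ℤ
  | 0 => 0
  | n+1 => 3 * fkCode i n + ∏ k ∈ Finset.Icc 1 (n+1), i k

lemma fkCode_congr (i j : ℕ → ℤ) (n : ℕ) (h : ∀ k, 1 ≤ k → k ≤ n → i k = j k) :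
    fkCode i n = fkCode j n := by
  induction n with
  | zero => rfl
  | succ n ih =>
    simp only [fkCode]
    rw [ih (fun k h1 h2 => h k h1 (by omega))]
    congr 1
    apply Finset.prod_congr rfl
    intro k hk
    rw [Finset.mem_Icc] at hk
    exact h k hk.1 hk.2

lemma fkCode_lt (i j : ℕ → ℤ) (hi : ∀ k, |i k| ≤ 1) (hj : ∀ k, |j k| ≤ 1) (m n : ℕ) (hmn : m ≤ n)
    (h : fkCode i m < fkCode j m) : fkCode i n < fkCode j n := by
  have hp : ∀ i : ℕ → ℤ, (∀ k, |i k| ≤ 1) → ∀ n, |∏ k ∈ Finset.Icc 1 n, i k| ≤ 1 := by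
    intro i hi n
    rw [Finset.abs_prod]
    exact Finset.prod_le_one (fun _ _ => abs_nonneg _) (fun k _ => hi k)
  induction n, hmn using Nat.le_induction with
  | base => exact h
  | succ n _ ih =>
    simp only [fkCode]
    have h1 := abs_le.1 (hp i hi (n+1))
    have h2 := abs_le.1 (hp j hj (n+1))
    omega

lemma fkCode_lt_of_first (i j : ℕ → ℤ) (hi : ∀ k, |i k| ≤ 1) (hj : ∀ k, |j k| ≤ 1) (m n : ℕ)
    (hm : 1 ≤ m) (hmn : m ≤ n) (h : ∀ k, 1 ≤ k → k < m → i k = j k)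
    (hlt : ∏ k ∈ Finset.Icc 1 m, i k < ∏ k ∈ Finset.Icc 1 m, j k) : fkCode i n < fkCode j n := by
  apply fkCode_lt i j hi hj m n hmn
  obtain ⟨p, rfl⟩ : ∃ p, m = p + 1 := ⟨m - 1, by omega⟩
  simp only [fkCode]
  rw [fkCode_congr i j p (fun k h1 h2 => h k h1 (by omega))]
  linarith

lemma fkKnead_abs (ℓ b c : ℝ) (k : ℕ) : |flatKnead ℓ b c k| ≤ 1 := by
  rw [fkKnead_eq]; split_ifs <;> simp

lemma fkKnead_eventually (ℓ b c : ℝ) (k : ℕ) (hc : ContinuousAt (fkF ℓ b k) c)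
    (h : fkF ℓ b k c ≠ 0) : ∀ᶠ y in nhds c, flatKnead ℓ b y k = flatKnead ℓ b c k := by
  rcases lt_or_gt_of_ne h with h | h
  · filter_upwards [hc.eventually_lt continuousAt_const h] with y hy
    rw [fkKnead_eq, fkKnead_eq, if_neg (not_lt.2 hy.le), if_neg hy.ne, if_neg (not_lt.2 h.le),
      if_neg h.ne]
  · filter_upwards [continuousAt_const.eventually_lt hc h] with y hy
    rw [fkKnead_eq, fkKnead_eq, if_pos hy, if_pos h]

lemma fk_sign_deriv (f : ℝ → ℝ) (D c : ℝ) (hf : HasDerivAt f D c) (h0 : f c = 0) (hD : 0 < D) :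
    ∀ᶠ y in nhds c, (c < y → 0 < f y) ∧ (y < c → f y < 0) := by
  have h1 := hf.tendsto_slope
  have h2 : ∀ᶠ y in nhdsWithin c {c}ᶜ, 0 < slope f c y := h1.eventually (lt_mem_nhds hD)
  rw [eventually_nhdsWithin_iff] at h2
  filter_upwards [h2] with y hy
  constructor
  · intro h
    have := hy h.ne'
    rw [slope_def_field, h0, sub_zero] at this
    exact (div_pos_iff_of_pos_right (by linarith)).1 this
  · intro h
    have := hy h.ne
    rw [slope_def_field, h0, sub_zero] at this
    rcases div_pos_iff.1 this with h3 | h3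
    · linarith
    · exact h3.1

lemma fk_local (ℓ b β : ℝ) (hℓ : 1 ≤ ℓ)
    (hb : 2 * (Real.exp 1 * ℓ) ^ (1 / ℓ) < b)
    (hβ0 : 0 < β) (hβ1 : β < ℓ ^ (1 / ℓ))
    (hβ : 2 * β * Real.exp (1 / β ^ ℓ) = b) (n : ℕ)
    (c : ℝ) (hc : -β ≤ c) :
    ∀ᶠ y in nhds c, (c < y → fkCode (flatKnead ℓ b c) n ≤ fkCode (flatKnead ℓ b y) n) ∧
      (y < c → fkCode (flatKnead ℓ b y) n ≤ fkCode (flatKnead ℓ b c) n) := by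
  classical
  have hlocal : ∀ m, (∀ i, 1 ≤ i → i < m → fkF ℓ b i c ≠ 0) →
      ∀ᶠ y in nhds c, ∀ k ∈ Finset.Ico 1 m, flatKnead ℓ b y k = flatKnead ℓ b c k := by
    intro m hm
    rw [Filter.eventually_all_finset]
    intro k hk
    rw [Finset.mem_Ico] at hk
    exact fkKnead_eventually ℓ b c k
      (fkF_hasDerivAt ℓ b c m hm k hk.1 hk.2.le).continuousAt (hm k hk.1 hk.2)
  by_cases hz : ∃ m, 1 ≤ m ∧ m ≤ n ∧ fkF ℓ b m c = 0
  · obtain ⟨hm1, hmn, hm0⟩ := Nat.find_spec hz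
    have hmin := fun i (h : i < Nat.find hz) => Nat.find_min hz h
    set m := Nat.find hz
    have hne : ∀ i, 1 ≤ i → i < m → fkF ℓ b i c ≠ 0 :=
      fun i h1 h2 h3 => hmin i h2 ⟨h1, by omega, h3⟩
    obtain ⟨D, hD, hDP⟩ := fk_transversal ℓ b β hℓ hb hβ0 hβ1 hβ c hc m hm1 hm0 hne
    set P : ℤ := ∏ k ∈ Finset.Ico 1 m, flatKnead ℓ b c k with hP
    have hsg := fk_sign_deriv (fun y => fkF ℓ b m y * (P:ℝ)) _ c (hD.mul_const _)
      (by simp [hm0]) hDP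
    have hIcc : ∀ y, ∏ k ∈ Finset.Icc 1 m, flatKnead ℓ b y k =
        (∏ k ∈ Finset.Ico 1 m, flatKnead ℓ b y k) * flatKnead ℓ b y m := by
      intro y
      rw [← Finset.prod_Ico_succ_top hm1]
      rfl
    have hcz : flatKnead ℓ b c m = 0 := by rw [fkKnead_eq]; simp [hm0]
    filter_upwards [hsg, hlocal m hne] with y hy hk
    have hPy : ∏ k ∈ Finset.Ico 1 m, flatKnead ℓ b y k = P := Finset.prod_congr rfl hk
    constructor
    · intro hcy
      apply le_of_lt
      apply fkCode_lt_of_first _ _ (fkKnead_abs ℓ b c) (fkKnead_abs ℓ b y) m n hm1 hmn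
      · intro k h1 h2
        exact (hk k (Finset.mem_Ico.2 ⟨h1, h2⟩)).symm
      · rw [hIcc, hIcc, hcz, hPy, mul_zero]
        have h1 := hy.1 hcy
        rw [fkKnead_eq]
        rcases mul_pos_iff.1 h1 with ⟨h2, h3⟩ | ⟨h2, h3⟩
        · rw [if_pos h2, mul_one]; exact_mod_cast h3
        · rw [if_neg (by linarith), if_neg h2.ne]
          have : P < 0 := by exact_mod_cast h3
          omega
    · intro hcy
      apply le_of_lt
      apply fkCode_lt_of_first _ _ (fkKnead_abs ℓ b y) (fkKnead_abs ℓ b c) m n hm1 hmn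
      · intro k h1 h2
        exact hk k (Finset.mem_Ico.2 ⟨h1, h2⟩)
      · rw [hIcc, hIcc, hcz, hPy, mul_zero]
        have h1 := hy.2 hcy
        rw [fkKnead_eq]
        rcases mul_neg_iff.1 h1 with ⟨h2, h3⟩ | ⟨h2, h3⟩
        · rw [if_pos h2, mul_one]; exact_mod_cast h3
        · rw [if_neg (by linarith), if_neg h2.ne]
          have : 0 < P := by exact_mod_cast h3
          omega
  · push Not at hz
    filter_upwards [hlocal (n+1) (fun i h1 h2 => hz i h1 (by omega))] with y hk
    have := fkCode_congr (flatKnead ℓ b y) (flatKnead ℓ b c) n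
      (fun k h1 h2 => hk k (Finset.mem_Ico.2 ⟨h1, by omega⟩))
    exact ⟨fun _ => this.ge, fun _ => this.le⟩

lemma fk_mono_of_local (κ : ℝ → ℤ) (a b : ℝ) (hab : a ≤ b)
    (h : ∀ c, a ≤ c → c ≤ b →
      ∀ᶠ y in nhds c, (c < y → κ c ≤ κ y) ∧ (y < c → κ y ≤ κ c)) : κ a ≤ κ b := by
  set S : Set ℝ := {y | a ≤ y ∧ y ≤ b ∧ κ a ≤ κ y} with hS
  have haS : a ∈ S := ⟨le_rfl, hab, le_rfl⟩
  have hbdd : BddAbove S := ⟨b, fun y hy => hy.2.1⟩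
  set s := sSup S with hs
  have has : a ≤ s := le_csSup hbdd haS
  have hsb : s ≤ b := csSup_le ⟨a, haS⟩ (fun y hy => hy.2.1)
  obtain ⟨δ, hδ, hball⟩ := Metric.eventually_nhds_iff_ball.1 (h s has hsb)
  have hsS : κ a ≤ κ s := by
    obtain ⟨y, hyS, hy⟩ := exists_lt_of_lt_csSup ⟨a, haS⟩ (show s - δ < sSup S by linarith)
    have hys : y ≤ s := le_csSup hbdd hyS
    rcases hys.lt_or_eq with h1 | h1
    · refine hyS.2.2.trans ((hball y ?_).2 h1)
      rw [Metric.mem_ball, Real.dist_eq, abs_lt]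
      constructor <;> linarith
    · rw [← h1]; exact hyS.2.2
  rcases hsb.lt_or_eq with h1 | h1
  · exfalso
    set y := min b (s + δ / 2) with hy
    have hsy : s < y := lt_min h1 (by linarith)
    have hyδ : y ≤ s + δ / 2 := min_le_right _ _
    have hyS : y ∈ S := by
      refine ⟨by linarith, min_le_left _ _, hsS.trans ((hball y ?_).1 hsy)⟩
      rw [Metric.mem_ball, Real.dist_eq, abs_lt]
      constructor <;> linarith
    have := le_csSup hbdd hyS
    linarith
  · rw [← h1]; exact hsS

theorem stmt1 (ℓ b β : ℝ) (hℓ : 1 ≤ ℓ)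
    (hb : 2 * (Real.exp 1 * ℓ) ^ (1 / ℓ) < b)
    (hβ0 : 0 < β) (hβ1 : β < ℓ ^ (1 / ℓ))
    (hβ : 2 * β * Real.exp (1 / β ^ ℓ) = b)
    (c c' : ℝ) (hc : -β ≤ c) (hcc' : c ≤ c') :
    KneadLE (flatKnead ℓ b c) (flatKnead ℓ b c') := by

  classical
  have hcode : ∀ n, fkCode (flatKnead ℓ b c) n ≤ fkCode (flatKnead ℓ b c') n := fun n =>
    fk_mono_of_local (fun y => fkCode (flatKnead ℓ b y) n) c c' hcc'
      (fun y hy _ => fk_local ℓ b β hℓ hb hβ0 hβ1 hβ n y (hc.trans hy))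
  by_cases hall : ∀ k, 1 ≤ k → flatKnead ℓ b c k = flatKnead ℓ b c' k
  · exact Or.inr hall
  · left
    push Not at hall
    obtain ⟨hn1, hne⟩ := Nat.find_spec hall
    have hmin := fun i (h : i < Nat.find hall) => Nat.find_min hall h
    set n := Nat.find hall
    have heq : ∀ k, 1 ≤ k → k < n → flatKnead ℓ b c k = flatKnead ℓ b c' k := by
      intro k h1 h2
      by_contra h3
      exact hmin k h2 ⟨h1, h3⟩
    refine ⟨n, hn1, heq, ?_⟩
    obtain ⟨p, hp⟩ : ∃ p, n = p + 1 := ⟨n - 1, by omega⟩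
    have h1 := hcode n
    rw [hp] at h1
    simp only [fkCode] at h1
    rw [fkCode_congr _ _ p (fun k h1 h2 => heq k h1 (by omega)), ← hp] at h1
    have h2 : ∏ k ∈ Finset.Icc 1 n, flatKnead ℓ b c k ≤ ∏ k ∈ Finset.Icc 1 n, flatKnead ℓ b c' k := by
      linarith
    refine lt_of_le_of_ne h2 (fun h3 => ?_)
    have hIcc : ∀ y, ∏ k ∈ Finset.Icc 1 n, flatKnead ℓ b y k =
        (∏ k ∈ Finset.Ico 1 n, flatKnead ℓ b y k) * flatKnead ℓ b y n := by
      intro y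
      rw [← Finset.prod_Ico_succ_top hn1]
      rfl
    have hIco : ∏ k ∈ Finset.Ico 1 n, flatKnead ℓ b c k = ∏ k ∈ Finset.Ico 1 n, flatKnead ℓ b c' k :=
      Finset.prod_congr rfl (fun k hk => heq k (Finset.mem_Ico.1 hk).1 (Finset.mem_Ico.1 hk).2)
    rw [hIcc, hIcc, ← hIco] at h3
    rcases mul_eq_mul_left_iff.1 h3 with h4 | h4
    · exact hne h4
    · obtain ⟨k, hk, hk0⟩ := Finset.prod_eq_zero_iff.1 h4
      rw [Finset.mem_Ico] at hk
      have hz : ∀ y, flatKnead ℓ b y k = 0 → flatKnead ℓ b y n = flatKnead ℓ b y (n - k) := by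
        intro y hy
        have hF : fkF ℓ b k y = fkF ℓ b 0 y := by
          rw [fkF_zero]
          rw [fkKnead_eq] at hy
          by_contra h6
          rw [if_neg h6] at hy
          split_ifs at hy <;> simp at hy
        have := fkF_add_of_eq ℓ b y k 0 (n - k) hF
        rw [show n - k + k = n by omega, add_zero] at this
        rw [fkKnead_eq, fkKnead_eq, this]
      apply hne
      rw [hz c hk0, hz c' (by rw [← heq k hk.1 hk.2]; exact hk0)]
      exact heq _ (by omega) (by omega)
end

section
/- For every integer L ≥ 1 there exists ℓ₀ > 1 such that for all real ℓ₋, ℓ₊ ≥ ℓ₀, every integer q ≥ 1 and all c, ĉ ∈ ℝ the following holds: if f_c^q(0) = 0, f_c^j(0) ≠ 0 for all 1 ≤ j < q, #{1 ≤ j < q : f_c^j(0) < 0} ≤ L, and the kneading sequences of f_c and f_ĉ coincide (K(f_c) = K(f_ĉ)), then c = ĉ. -/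
/-- The unimodal map `f_{c,ℓ₋,ℓ₊}(x) = |x|^{ℓ₋} + c` for `x ≤ 0` and `|x|^{ℓ₊} + c` for `x ≥ 0`. -/
noncomputable def fml (lm lp c : ℝ) (x : ℝ) : ℝ :=
  if x ≤ 0 then |x| ^ lm + c else |x| ^ lp + c

/-- The kneading sequence of `f_{c,ℓ₋,ℓ₊}`: `i_k = sign (f_c^k(0))` for `k ≥ 1`. -/
noncomputable def fmlKnead (lm lp c : ℝ) (k : ℕ) : ℤ :=
  if 0 < (fml lm lp c)^[k] 0 then 1
  else if (fml lm lp c)^[k] 0 = 0 then 0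
  else -1


namespace FML

lemma tangent {a b p : ℝ} (ha : 0 < a) (hb : 0 ≤ b) (hp : 1 ≤ p) :
    a ^ p + p * a ^ (p - 1) * (b - a) ≤ b ^ p := by
  have h := one_add_mul_self_le_rpow_one_add (s := b / a - 1) (by
    have : 0 ≤ b / a := by positivity
    linarith) hp
  have e1 : (1 + (b / a - 1)) = b / a := by ring
  rw [e1, Real.div_rpow hb ha.le, le_div_iff₀ (by positivity)] at h
  have e2 : a ^ p = a ^ (p - 1) * a := by
    rw [Real.rpow_sub_one ha.ne']; field_simp
  calc a ^ p + p * a ^ (p - 1) * (b - a) = (1 + p * (b / a - 1)) * a ^ p := by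
        rw [e2]; field_simp
    _ ≤ b ^ p := h

lemma dist2 {a b p R : ℝ} (ha : 0 < a) (hb : 0 < b) (hp : 1 ≤ p)
    (hR : R = |Real.log (a ^ p) - Real.log (b ^ p)|) :
    b ^ (p - 1) ≤ Real.exp R * a ^ (p - 1) := by
  rw [Real.log_rpow ha, Real.log_rpow hb, ← mul_sub, abs_mul, abs_of_nonneg (by linarith : 0 ≤ p)] at hR
  rw [Real.rpow_def_of_pos ha, Real.rpow_def_of_pos hb, ← Real.exp_add]
  apply Real.exp_le_exp.2
  have h1 := neg_abs_le (Real.log a - Real.log b)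
  have h2 := abs_nonneg (Real.log a - Real.log b)
  nlinarith [mul_nonneg (by linarith : 0 ≤ p - 1) (by linarith :  0 ≤ |Real.log a - Real.log b| + (Real.log a - Real.log b))]

lemma dist1 {a b p R : ℝ} (ha : 0 < a) (hb : 0 < b) (hp : 1 ≤ p)
    (hR : R = |Real.log (a ^ p) - Real.log (b ^ p)|) :
    |a ^ p - b ^ p| ≤ Real.exp R * (p * a ^ (p - 1)) * |a - b| := by
  have hR0 : 0 ≤ R := hR ▸ abs_nonneg _
  have hE : 1 ≤ Real.exp R := Real.one_le_exp hR0
  have hd : 0 < p * a ^ (p - 1) := by positivity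
  rcases le_total b a with h | h
  · have h1 : b ^ p ≤ a ^ p := Real.rpow_le_rpow hb.le h (by linarith)
    rw [abs_of_nonneg (by linarith), abs_of_nonneg (by linarith)]
    have := tangent ha hb.le hp
    calc a ^ p - b ^ p ≤ 1 * (p * a ^ (p - 1)) * (a - b) := by linarith
      _ ≤ _ := by
        apply mul_le_mul_of_nonneg_right _ (by linarith)
        exact mul_le_mul_of_nonneg_right hE hd.le
  · have h1 : a ^ p ≤ b ^ p := Real.rpow_le_rpow ha.le h (by linarith)
    rw [abs_of_nonpos (by linarith), abs_of_nonpos (by linarith)]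
    have := tangent hb ha.le hp
    have h2 := dist2 ha hb hp hR
    calc -(a ^ p - b ^ p) ≤ (p * b ^ (p - 1)) * (b - a) := by linarith
      _ ≤ (p * (Real.exp R * a ^ (p - 1))) * (b - a) := by
        apply mul_le_mul_of_nonneg_right _ (by linarith)
        exact mul_le_mul_of_nonneg_left h2 (by linarith)
      _ = _ := by ring

lemma dist3 {a b p R : ℝ} (ha : 0 < a) (hb : 0 < b) (hp : 1 ≤ p)
    (hR : R = |Real.log (a ^ p) - Real.log (b ^ p)|) :
    a ≤ Real.exp R * b := by
  rw [Real.log_rpow ha, Real.log_rpow hb, ← mul_sub, abs_mul, abs_of_nonneg (by linarith : 0 ≤ p)] at hR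
  conv_lhs => rw [← Real.exp_log ha]
  conv_rhs => rw [← Real.exp_log hb]
  rw [← Real.exp_add]
  apply Real.exp_le_exp.2
  have h1 := le_abs_self (Real.log a - Real.log b)
  have h2 := abs_nonneg (Real.log a - Real.log b)
  nlinarith

lemma dist4 {a b p R X : ℝ} (ha : 0 < a) (hb : 0 < b) (hX : 0 < X) (hpX : X ≤ p)
    (hR : R = |Real.log (a ^ p) - Real.log (b ^ p)|) (hRX : X ≤ R) :
    X / 2 * a ≤ p * |a - b| := by
  have hp : 0 < p := by linarith
  rw [Real.log_rpow ha, Real.log_rpow hb, ← mul_sub, abs_mul, abs_of_nonneg hp.le] at hR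
  -- for `M ≥ m`, `log M - log m ≤ M / m - 1`
  have key : ∀ M m : ℝ, 0 < m → m ≤ M → X ≤ p * (Real.log M - Real.log m) →
      X / 2 * M ≤ p * (M - m) := by
    intro M m hm hmM h
    have hM : 0 < M := by linarith
    have h1 : Real.log (M / m) ≤ M / m - 1 := Real.log_le_sub_one_of_pos (by positivity)
    rw [Real.log_div hM.ne' hm.ne'] at h1
    have h2 : X ≤ p * (M / m - 1) := h.trans (mul_le_mul_of_nonneg_left h1 hp.le)
    have h3 : X * m ≤ p * (M - m) := by
      have : p * (M / m - 1) * m = p * (M - m) := by field_simp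
      nlinarith
    have h4 : X * (M - m) ≤ p * (M - m) := mul_le_mul_of_nonneg_right hpX (by linarith)
    nlinarith
  rcases le_total b a with h | h
  · have hl : Real.log b ≤ Real.log a := Real.log_le_log hb h
    rw [abs_of_nonneg (by linarith)] at hR
    rw [abs_of_nonneg (by linarith)]
    exact key a b hb h (by linarith)
  · have hl : Real.log a ≤ Real.log b := Real.log_le_log ha h
    rw [abs_of_nonpos (by linarith)] at hR
    rw [abs_of_nonpos (by linarith)]
    have := key b a ha h (by linarith)
    nlinarith

lemma expand {a b p : ℝ} (ha : 1 ≤ a) (hb : 1 ≤ b) (hp : 1 ≤ p) :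
    p * |a - b| ≤ |a ^ p - b ^ p| := by
  have key : ∀ M m : ℝ, 1 ≤ m → m ≤ M → p * (M - m) ≤ M ^ p - m ^ p := by
    intro M m hm hmM
    have := tangent (a := m) (b := M) (by linarith) (by linarith) hp
    have h1 : 1 ≤ m ^ (p - 1) := Real.one_le_rpow hm (by linarith)
    have : p * (M - m) ≤ p * m ^ (p - 1) * (M - m) := by
      apply mul_le_mul_of_nonneg_right _ (by linarith)
      nlinarith
    linarith
  rcases le_total b a with h | h
  · rw [abs_of_nonneg (by linarith : 0 ≤ a - b)]
    exact (key a b hb h).trans (le_abs_self _)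
  · rw [abs_of_nonpos (by linarith : a - b ≤ 0), abs_sub_comm]
    have := key b a ha h
    exact le_trans (by linarith) (le_abs_self _)

lemma logdiff {a b : ℝ} (ha : 1 ≤ a) (hb : 1 ≤ b) :
    |Real.log a - Real.log b| ≤ |a - b| := by
  have key : ∀ M m : ℝ, 1 ≤ m → m ≤ M → Real.log M - Real.log m ≤ M - m := by
    intro M m hm hmM
    have hM : 0 < M := by linarith
    have hm0 : 0 < m := by linarith
    have h1 : Real.log (M / m) ≤ M / m - 1 := Real.log_le_sub_one_of_pos (by positivity)
    rw [Real.log_div hM.ne' hm0.ne'] at h1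
    have : M / m - 1 ≤ M - m := by
      rw [div_sub_one hm0.ne', div_le_iff₀ hm0]; nlinarith
    linarith
  rcases le_total b a with h | h
  · have := key a b hb h
    have hl : Real.log b ≤ Real.log a := Real.log_le_log (by linarith) h
    rw [abs_of_nonneg (by linarith), abs_of_nonneg (by linarith)]; linarith
  · have := key b a ha h
    have hl : Real.log a ≤ Real.log b := Real.log_le_log (by linarith) h
    rw [abs_of_nonpos (by linarith), abs_of_nonpos (by linarith)]; linarith

structure Orb (L : ℕ) (ℓ : ℝ) (N : ℕ) (Λ : ℝ) (X p : ℕ → ℝ) : Prop where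
  hΛ : 1 ≤ Λ
  hp : ∀ j, ℓ ≤ p j
  h0 : X 0 = -Λ
  hN : X N = 0
  hne : ∀ j, j < N → X j ≠ 0
  hstep : ∀ j, j < N → |X j| ^ p j = X (j + 1) + Λ
  hle2 : ∀ j, j ≤ N → |X j| ≤ 2
  hY4 : ∀ j, j ≤ N → X j + Λ ≤ 4
  hpp : ∀ i j, 0 < X i * X j → p i = p j
  hcard : ((Finset.range N).filter (fun l => X l < 0)).card ≤ L

noncomputable def dd (X p : ℕ → ℝ) (j : ℕ) : ℝ := p j * |X j| ^ (p j - 1)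

noncomputable def PP (X p : ℕ → ℝ) (j : ℕ) : ℝ := ∏ l ∈ Finset.range j, dd X p l

noncomputable def AA (X p : ℕ → ℝ) (j : ℕ) : ℝ := p j * PP X p j / |X j|

/-- log distortion between leader and follower -/
noncomputable def rho (X : ℕ → ℝ) (Λ : ℝ) (j m : ℕ) : ℝ :=
  |Real.log (X m + Λ) - Real.log (X (j + m) + Λ)|

noncomputable def SS (X : ℕ → ℝ) (Λ : ℝ) (j m : ℕ) : ℝ :=
  ∑ l ∈ Finset.range m, rho X Λ j (l + 1)

noncomputable def Phi (B lam : ℝ) : ℕ → ℝ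
  | 0 => 0
  | n + 1 => Phi B lam n + 8 + B * Real.exp (lam * (Phi B lam n + 8))

noncomputable def cc (X : ℕ → ℝ) (m : ℕ) : ℕ := by
  classical exact ((Finset.range (m + 1)).filter (fun l => X l ≤ 0)).card

section
variable {L : ℕ} {ℓ : ℝ} {N : ℕ} {Λ : ℝ} {X p : ℕ → ℝ}

lemma Orb.dd_pos (h : Orb L ℓ N Λ X p) (hl : 2 ≤ ℓ) {j : ℕ} (hj : j < N) : 0 < dd X p j := by
  have := h.hp j
  have := abs_pos.2 (h.hne j hj)
  unfold dd
  have : 0 < p j := by linarith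
  positivity

lemma Orb.PP_pos (h : Orb L ℓ N Λ X p) (hl : 2 ≤ ℓ) {j : ℕ} (hj : j ≤ N) : 0 < PP X p j := by
  unfold PP
  apply Finset.prod_pos
  intro i hi
  exact h.dd_pos hl (by have := Finset.mem_range.1 hi; omega)

lemma Orb.AA_pos (h : Orb L ℓ N Λ X p) (hl : 2 ≤ ℓ) {j : ℕ} (hj : j < N) : 0 < AA X p j := by
  have := h.hp j
  have := abs_pos.2 (h.hne j hj)
  have := h.PP_pos hl hj.le
  unfold AA
  have : 0 < p j := by linarith
  positivity

lemma Orb.dd_eq (h : Orb L ℓ N Λ X p) {j : ℕ} (hj : j < N) :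
    dd X p j = p j * (X (j+1) + Λ) / |X j| := by
  have := abs_pos.2 (h.hne j hj)
  unfold dd
  rw [Real.rpow_sub_one this.ne', h.hstep j hj]; ring

lemma Orb.PP_succ (h : Orb L ℓ N Λ X p) {j : ℕ} (hj : j < N) :
    PP X p (j+1) = AA X p j * (X (j+1) + Λ) := by
  unfold AA
  have : PP X p (j+1) = PP X p j * dd X p j := by unfold PP; rw [Finset.prod_range_succ]
  rw [this, h.dd_eq hj]; ring

lemma PP_succ' (j : ℕ) : PP X p (j+1) = PP X p j * dd X p j := by
  unfold PP; rw [Finset.prod_range_succ]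

lemma Orb.Y_pos (h : Orb L ℓ N Λ X p) {j : ℕ} (hj : j < N) : 0 < X (j+1) + Λ := by
  rw [← h.hstep j hj]
  exact Real.rpow_pos_of_pos (abs_pos.2 (h.hne j hj)) _

lemma cc_mono {a b : ℕ} (hab : a ≤ b) : cc X a ≤ cc X b := by
  classical
  unfold cc
  apply Finset.card_le_card
  apply Finset.filter_subset_filter
  intro i hi
  simp only [Finset.mem_range] at *
  omega

lemma cc_succ {a : ℕ} (h : X (a+1) ≤ 0) : cc X (a+1) = cc X a + 1 := by
  classical
  unfold cc
  rw [Finset.range_add_one (n := a + 1), Finset.filter_insert, if_pos h, Finset.card_insert_of_notMem]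
  simp

lemma Orb.cc_le (h : Orb L ℓ N Λ X p) {j : ℕ} (hj : j ≤ N) : cc X j ≤ L + 1 := by
  classical
  refine (cc_mono hj).trans ?_
  have : cc X N ≤ (insert N ((Finset.range N).filter (fun l => X l < 0))).card := by
    unfold cc
    apply Finset.card_le_card
    intro i hi
    simp only [Finset.mem_filter, Finset.mem_range, Finset.mem_insert] at *
    rcases eq_or_ne i N with e | e
    · exact Or.inl e
    · right
      have hi' : i < N := by omega
      exact ⟨hi', lt_of_le_of_ne hi.2 (h.hne i hi')⟩
  refine this.trans ((Finset.card_insert_le _ _).trans ?_)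
  have := h.hcard
  omega

lemma rho_nonneg (j m : ℕ) : 0 ≤ rho X Λ j m := abs_nonneg _

lemma SS_succ (j m : ℕ) : SS X Λ j (m+1) = SS X Λ j m + rho X Λ j (m+1) := by
  unfold SS; rw [Finset.sum_range_succ]

lemma SS_mono (j : ℕ) {m n : ℕ} (h : m ≤ n) : SS X Λ j m ≤ SS X Λ j n := by
  induction n, h using Nat.le_induction with
  | base => exact le_rfl
  | succ n hn ih => rw [SS_succ]; have := rho_nonneg (X := X) (Λ := Λ) j (n+1); linarith

lemma SS_nonneg (j m : ℕ) : 0 ≤ SS X Λ j m :=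
  Finset.sum_nonneg (fun _ _ => rho_nonneg _ _)

lemma Phi_succ (B lam : ℝ) (n : ℕ) :
    Phi B lam (n+1) = Phi B lam n + 8 + B * Real.exp (lam * (Phi B lam n + 8)) := rfl

lemma Phi_mono {B lam : ℝ} (hB : 0 ≤ B) {m n : ℕ} (h : m ≤ n) : Phi B lam m ≤ Phi B lam n := by
  induction n, h using Nat.le_induction with
  | base => exact le_rfl
  | succ n hn ih => rw [Phi_succ]; have := Real.exp_pos (lam * (Phi B lam n + 8)); nlinarith

/-- uniform bound on the distortion sum -/
lemma Orb.SS_bound (h : Orb L ℓ N Λ X p) (hl : 2 ≤ ℓ) {B lam : ℝ} (hB : 0 ≤ B) (hlam : 0 ≤ lam)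
    {j t : ℕ} (hjN : j + t ≤ N)
    (hs : ∀ m, m < t → 0 < X m * X (j+m))
    (hr : ∀ m, m < t → rho X Λ j (m+1) < B * Real.exp (lam * SS X Λ j m)) :
    ∀ m, m ≤ t → SS X Λ j m ≤ Phi B lam (2 * L + 2) + 8 := by
  have habs : ∀ m, j + m ≤ N → 0 < X m → 0 < X (j+m) → |X m - X (j+m)| ≤ 4 := by
    intro m hm h1 h2
    have a1 := h.hle2 m (by omega)
    have a2 := h.hle2 (j+m) hm
    rw [abs_le] at *
    constructor <;> linarith [a1.1, a1.2, a2.1, a2.2]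
  have main : ∀ m, m ≤ t → SS X Λ j m ≤ Phi B lam (cc X m + cc X (j+m)) ∨
      (0 < X m ∧ 0 < X (j+m) ∧
        SS X Λ j m ≤ Phi B lam (cc X m + cc X (j+m)) + 2 * |X m - X (j+m)|) := by
    intro m
    induction m with
    | zero =>
      intro _
      left
      have : SS X Λ j 0 = 0 := by simp [SS]
      rw [this]
      have : Phi B lam 0 ≤ Phi B lam (cc X 0 + cc X (j+0)) := Phi_mono hB (Nat.zero_le _)
      simpa [Phi] using this
    | succ m ih =>
      intro hm
      have ih := ih (by omega)
      have hsm := hs m (by omega)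
      have hrm := hr m (by omega)
      have hc1 : cc X m ≤ cc X (m+1) := cc_mono (by omega)
      have hc2 : cc X (j+m) ≤ cc X (j+(m+1)) := cc_mono (by omega)
      rw [SS_succ]
      by_cases hpos : 0 < X (m+1) ∧ 0 < X (j+(m+1))
      · right
        refine ⟨hpos.1, hpos.2, ?_⟩
        have hPhi : Phi B lam (cc X m + cc X (j+m)) ≤ Phi B lam (cc X (m+1) + cc X (j+(m+1))) :=
          Phi_mono hB (by omega)
        have hrho : rho X Λ j (m+1) ≤ |X (m+1) - X (j+(m+1))| := by
          unfold rho
          have := logdiff (a := X (m+1) + Λ) (b := X (j+(m+1)) + Λ) (by linarith [h.hΛ]) (by linarith [h.hΛ])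
          simpa using this
        rcases ih with ih | ⟨p1, p2, ih⟩
        · have := abs_nonneg (X (m+1) - X (j+(m+1)))
          linarith
        · have e1 := h.hstep m (by omega)
          have e2 := h.hstep (j+m) (by omega)
          have hpe := h.hpp _ _ hsm
          rw [← hpe] at e2
          rw [abs_of_pos p1] at e1
          rw [abs_of_pos p2] at e2
          have hpm := h.hp m
          have one : ∀ z : ℝ, 0 < z → 1 ≤ z ^ p m → 1 ≤ z := by
            intro z hz hz1
            by_contra hlt
            have := Real.rpow_lt_one hz.le (not_le.1 hlt) (by linarith : 0 < p m)
            linarith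
          have g1 : 1 ≤ X m := one _ p1 (by rw [e1]; linarith [h.hΛ])
          have g2 : 1 ≤ X (j+m) := one _ p2 (by rw [e2]; have := hpos.2; rw [← add_assoc] at this; linarith [h.hΛ])
          have ex := expand g1 g2 (by linarith : 1 ≤ p m)
          rw [e1, e2] at ex
          have e3 : X (m + 1) + Λ - (X (j + m + 1) + Λ) = X (m+1) - X (j+(m+1)) := by
            rw [← add_assoc]; ring
          rw [e3] at ex
          have := abs_nonneg (X m - X (j+m))
          nlinarith
      · left
        have hcs : cc X m + cc X (j+m) + 1 ≤ cc X (m+1) + cc X (j+(m+1)) := by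
          rw [not_and_or, not_lt, not_lt] at hpos
          rcases hpos with hpos | hpos
          · have := cc_succ hpos; omega
          · have := cc_succ (X := X) (a := j+m) (by rw [← add_assoc] at hpos; exact hpos)
            rw [← add_assoc] at *
            omega
        refine le_trans ?_ (Phi_mono hB hcs)
        rw [Phi_succ]
        have hS : SS X Λ j m ≤ Phi B lam (cc X m + cc X (j+m)) + 8 := by
          rcases ih with ih | ⟨p1, p2, ih⟩
          · linarith
          · have := habs m (by omega) p1 p2
            linarith
        have : B * Real.exp (lam * SS X Λ j m) ≤
            B * Real.exp (lam * (Phi B lam (cc X m + cc X (j+m)) + 8)) := by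
          apply mul_le_mul_of_nonneg_left _ hB
          apply Real.exp_le_exp.2
          exact mul_le_mul_of_nonneg_left hS hlam
        linarith
  intro m hm
  have hP : Phi B lam (cc X m + cc X (j+m)) ≤ Phi B lam (2 * L + 2) := by
    apply Phi_mono hB
    have := h.cc_le (j := m) (by omega)
    have := h.cc_le (j := j+m) (by omega)
    omega
  rcases main m hm with ih | ⟨p1, p2, ih⟩
  · linarith
  · have := habs m (by omega) p1 p2
    linarith

end
end FML

namespace FML
section
variable {L : ℕ} {ℓ : ℝ} {N : ℕ} {Λ : ℝ} {X p : ℕ → ℝ}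

lemma abs_sub_abs_eq {x y : ℝ} (h : 0 < x * y) : |(|x| - |y|)| = |x - y| := by
  rcases pos_and_pos_or_neg_and_neg_of_mul_pos h with ⟨h1, h2⟩ | ⟨h1, h2⟩
  · rw [abs_of_pos h1, abs_of_pos h2]
  · rw [abs_of_neg h1, abs_of_neg h2, ← abs_neg]; ring_nf

lemma Orb.pair (h : Orb L ℓ N Λ X p) (hl : 2 ≤ ℓ) {j m : ℕ} (hjm : j + m < N)
    (hs : 0 < X m * X (j+m)) :
    |X (m+1) - X (j+(m+1))| ≤ Real.exp (rho X Λ j (m+1)) * dd X p m * |X m - X (j+m)| ∧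
    |X (m+1) - X (j+(m+1))| ≤ Real.exp (rho X Λ j (m+1)) * dd X p (j+m) * |X m - X (j+m)| ∧
    dd X p m ≤ Real.exp (rho X Λ j (m+1)) * dd X p (j+m) ∧
    dd X p (j+m) ≤ Real.exp (rho X Λ j (m+1)) * dd X p m ∧
    |X m| ≤ Real.exp (rho X Λ j (m+1)) * |X (j+m)| := by
  have ha := abs_pos.2 (h.hne m (by omega))
  have hb := abs_pos.2 (h.hne (j+m) hjm)
  have hpe := h.hpp _ _ hs
  have hp1 : 1 ≤ p m := by linarith [h.hp m]
  have e1 := h.hstep m (by omega)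
  have e2 := h.hstep (j+m) hjm
  rw [← hpe] at e2
  have hR : rho X Λ j (m+1) = |Real.log (|X m| ^ p m) - Real.log (|X (j+m)| ^ p m)| := by
    rw [e1, e2]; unfold rho; rw [← add_assoc]
  have hR' : rho X Λ j (m+1) = |Real.log (|X (j+m)| ^ p m) - Real.log (|X m| ^ p m)| := by
    rw [hR, abs_sub_comm]
  have hI : |X (m+1) - X (j+(m+1))| = |(|X m| ^ p m) - |X (j+m)| ^ p m| := by
    rw [e1, e2, ← add_assoc]; congr 1; ring
  have hJ := abs_sub_abs_eq hs
  have d1 := dist1 ha hb hp1 hR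
  have d1' := dist1 hb ha hp1 hR'
  have d2 := dist2 ha hb hp1 hR
  have d2' := dist2 hb ha hp1 hR'
  have d3 := dist3 ha hb hp1 hR
  rw [hJ] at d1
  rw [abs_sub_comm, abs_sub_comm |X (j+m)|, hJ] at d1'
  unfold dd
  rw [← hpe, hI]
  refine ⟨d1, d1', ?_, ?_, d3⟩
  · calc p m * |X m| ^ (p m - 1) ≤ p m * (Real.exp (rho X Λ j (m + 1)) * |X (j+m)| ^ (p m - 1)) :=
          mul_le_mul_of_nonneg_left d2' (by linarith)
      _ = _ := by ring
  · calc p m * |X (j+m)| ^ (p m - 1) ≤ p m * (Real.exp (rho X Λ j (m + 1)) * |X m| ^ (p m - 1)) :=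
          mul_le_mul_of_nonneg_left d2 (by linarith)
      _ = _ := by ring

lemma Orb.follow (h : Orb L ℓ N Λ X p) (hl : 2 ≤ ℓ) {j t : ℕ} (hj : 1 ≤ j) (hjt : j + t ≤ N)
    (hs : ∀ m, m < t → 0 < X m * X (j+m)) :
    ∀ m, m ≤ t →
      |X m - X (j+m)| ≤ Real.exp (SS X Λ j m) * PP X p m * (X j + Λ) ∧
      |X m - X (j+m)| * PP X p j ≤ Real.exp (SS X Λ j m) * PP X p (j+m) * (X j + Λ) ∧
      PP X p j * PP X p m ≤ Real.exp (SS X Λ j m) * PP X p (j+m) ∧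
      PP X p (j+m) ≤ Real.exp (SS X Λ j m) * (PP X p j * PP X p m) := by
  intro m
  induction m with
  | zero =>
    intro _
    have hY : 0 < X j + Λ := by
      obtain ⟨i, rfl⟩ : ∃ i, j = i + 1 := ⟨j-1, by omega⟩
      exact h.Y_pos (by omega)
    have e0 : |X 0 - X (j+0)| = X j + Λ := by
      rw [h.h0, add_zero, abs_of_neg (by linarith)]; ring
    have e1 : SS X Λ j 0 = 0 := by simp [SS]
    have e2 : PP X p 0 = 1 := by simp [PP]
    rw [e0, e1, e2]
    simp
    linarith
  | succ m ih =>
    intro hm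
    obtain ⟨i1, i2, i3, i4⟩ := ih (by omega)
    obtain ⟨f1, f2, f3, f4, f5⟩ := h.pair hl (by omega) (hs m (by omega))
    have d1 := h.dd_pos hl (j := m) (by omega)
    have d2 := h.dd_pos hl (j := j + m) (by omega)
    have q1 := h.PP_pos hl (j := m) (by omega)
    have q2 := h.PP_pos hl (j := j+m) (by omega)
    have q3 := h.PP_pos hl (j := j) (by omega)
    have E1 := Real.exp_pos (rho X Λ j (m+1))
    have E2 := Real.exp_pos (SS X Λ j m)
    have PE : PP X p (j+(m+1)) = PP X p (j+m) * dd X p (j+m) := by rw [← add_assoc, PP_succ']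
    rw [SS_succ, PP_succ', PE, Real.exp_add]
    refine ⟨?_, ?_, ?_, ?_⟩
    · calc _ ≤ _ := f1
        _ ≤ Real.exp (rho X Λ j (m+1)) * dd X p m * (Real.exp (SS X Λ j m) * PP X p m * (X j + Λ)) :=
          mul_le_mul_of_nonneg_left i1 (by positivity)
        _ = _ := by ring
    · calc _ ≤ (Real.exp (rho X Λ j (m+1)) * dd X p (j+m) * |X m - X (j+m)|) * PP X p j :=
            mul_le_mul_of_nonneg_right f2 q3.le
        _ = Real.exp (rho X Λ j (m+1)) * dd X p (j+m) * (|X m - X (j+m)| * PP X p j) := by ring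
        _ ≤ Real.exp (rho X Λ j (m+1)) * dd X p (j+m) * (Real.exp (SS X Λ j m) * PP X p (j+m) * (X j + Λ)) :=
          mul_le_mul_of_nonneg_left i2 (by positivity)
        _ = _ := by ring
    · calc _ = (PP X p j * PP X p m) * dd X p m := by ring
        _ ≤ (Real.exp (SS X Λ j m) * PP X p (j+m)) * (Real.exp (rho X Λ j (m+1)) * dd X p (j+m)) :=
          mul_le_mul i3 f3 d1.le (by positivity)
        _ = _ := by ring
    · calc _ ≤ (Real.exp (SS X Λ j m) * (PP X p j * PP X p m)) * (Real.exp (rho X Λ j (m+1)) * dd X p m) :=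
          mul_le_mul i4 f4 d2.le (by positivity)
        _ = _ := by ring

lemma Orb.T (h : Orb L ℓ N Λ X p) (hl : 2 ≤ ℓ) {B lam : ℝ} (hB : 0 < B) (hlam : 1 ≤ lam)
    (hlB : B * Real.exp (lam * (Phi B lam (2*L+2) + 8)) ≤ ℓ) {j : ℕ} (hj : 1 ≤ j) (hjN : j < N) :
    ∃ (t : ℕ) (S : ℝ), j + t ≤ N ∧ 0 ≤ S ∧ S ≤ Phi B lam (2*L+2) + 8 ∧
      (∀ m, m < t → 0 < X m * X (j+m)) ∧
      (∀ m, m ≤ t → PP X p j * PP X p m ≤ Real.exp S * PP X p (j+m)) ∧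
      (B / 2 * Real.exp ((lam - 1) * S) ≤ (X j + Λ) * AA X p t) ∧
      (j + t < N → B / 2 * AA X p (j-1) ≤ AA X p (j+t)) ∧
      (∀ m, m < t → AA X p (j+m) ≤ Real.exp S * PP X p j * AA X p m) := by
  classical
  have hex : ∃ t, X t * X (j+t) ≤ 0 ∨ B * Real.exp (lam * SS X Λ j t) ≤ rho X Λ j (t+1) := by
    refine ⟨N - j, Or.inl ?_⟩
    rw [show j + (N - j) = N by omega, h.hN, mul_zero]
  set t := Nat.find hex with ht
  have htN : j + t ≤ N := by
    have : t ≤ N - j := Nat.find_min' hex (Or.inl (by rw [show j + (N - j) = N by omega, h.hN, mul_zero]))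
    omega
  have hmin : ∀ m, m < t → 0 < X m * X (j+m) ∧ rho X Λ j (m+1) < B * Real.exp (lam * SS X Λ j m) := by
    intro m hm
    have := Nat.find_min hex hm
    rw [not_or, not_le, not_le] at this
    exact this
  have hterm := Nat.find_spec hex
  rw [← ht] at hterm
  have hs : ∀ m, m < t → 0 < X m * X (j+m) := fun m hm => (hmin m hm).1
  have hS := h.SS_bound hl hB.le (by linarith) htN hs (fun m hm => (hmin m hm).2) t le_rfl
  have hfol := h.follow hl hj htN hs
  set S := SS X Λ j t with hSdef
  have hS0 : 0 ≤ S := SS_nonneg _ _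
  have hXt : 0 < |X t| := abs_pos.2 (h.hne t (by omega))
  have hpX : B * Real.exp (lam * S) ≤ ℓ := by
    refine le_trans ?_ hlB
    apply mul_le_mul_of_nonneg_left _ hB.le
    apply Real.exp_le_exp.2
    exact mul_le_mul_of_nonneg_left hS (by linarith)
  have hBe : 0 < B * Real.exp (lam * S) := by positivity
  have hIt : B * Real.exp (lam * S) / 2 * |X t| ≤ p t * |X t - X (j+t)| ∧
      (j + t < N → B * Real.exp (lam * S) / 2 * |X (j+t)| ≤ p (j+t) * |X t - X (j+t)|) := by
    by_cases hsgn : X t * X (j+t) ≤ 0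
    · have g : |X t| ≤ |X t - X (j+t)| ∧ |X (j+t)| ≤ |X t - X (j+t)| := by
        constructor
        · apply sq_le_sq.1; nlinarith [sq_nonneg (X (j+t))]
        · apply sq_le_sq.1; nlinarith [sq_nonneg (X t)]
      refine ⟨?_, fun _ => ?_⟩
      · exact mul_le_mul (by linarith [h.hp t]) g.1 (abs_nonneg _) (by linarith [h.hp t])
      · exact mul_le_mul (by linarith [h.hp (j+t)]) g.2 (abs_nonneg _) (by linarith [h.hp (j+t)])
    · have hrho := hterm.resolve_left hsgn
      have hsg := not_le.1 hsgn
      have hjt : j + t < N := by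
        rcases htN.lt_or_eq with h1 | h1
        · exact h1
        · rw [h1, h.hN, mul_zero] at hsgn; exact absurd le_rfl hsgn
      have hb := abs_pos.2 (h.hne _ hjt)
      have hpe := h.hpp _ _ hsg
      have e1 := h.hstep t (by omega)
      have e2 := h.hstep (j+t) hjt
      rw [← hpe] at e2
      have hR : rho X Λ j (t+1) = |Real.log (|X t| ^ p t) - Real.log (|X (j+t)| ^ p t)| := by
        rw [e1, e2]; unfold rho; rw [← add_assoc]
      have hR' : rho X Λ j (t+1) = |Real.log (|X (j+t)| ^ p t) - Real.log (|X t| ^ p t)| := by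
        rw [hR, abs_sub_comm]
      have hJ := abs_sub_abs_eq hsg
      have k1 := dist4 hXt hb hBe (by linarith [h.hp t]) hR hrho
      have k2 := dist4 hb hXt hBe (by linarith [h.hp t]) hR' hrho
      rw [abs_sub_comm, hJ] at k2
      rw [hJ] at k1
      rw [← hpe]
      exact ⟨k1, fun _ => k2⟩
  have hY : 0 < X j + Λ := by
    have := h.Y_pos (j := j-1) (by omega)
    rwa [Nat.sub_add_cancel hj] at this
  have hexp : Real.exp (lam * S) = Real.exp S * Real.exp ((lam - 1) * S) := by
    rw [← Real.exp_add]; congr 1; ring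
  have hES := Real.exp_pos S
  have hE1 : 1 ≤ Real.exp ((lam - 1) * S) := Real.one_le_exp (mul_nonneg (by linarith) hS0)
  refine ⟨t, S, htN, hS0, hS, hs, ?_, ?_, ?_, ?_⟩
  · intro m hm
    refine (hfol m hm).2.2.1.trans ?_
    apply mul_le_mul_of_nonneg_right _ (h.PP_pos hl (by omega)).le
    exact Real.exp_le_exp.2 (SS_mono j hm)
  · have f := (hfol t le_rfl).1
    rw [← hSdef] at f
    have hpt : 0 < p t := by linarith [h.hp t]
    have : B * Real.exp (lam * S) / 2 * |X t| ≤ p t * (Real.exp S * PP X p t * (X j + Λ)) :=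
      hIt.1.trans (mul_le_mul_of_nonneg_left f hpt.le)
    rw [hexp] at this
    unfold AA
    rw [← mul_div_assoc, le_div_iff₀ hXt]
    have h2 : Real.exp S * (B / 2 * Real.exp ((lam - 1) * S) * |X t|) ≤
        Real.exp S * ((X j + Λ) * (p t * PP X p t)) := by linarith
    exact le_of_mul_le_mul_left h2 hES
  · intro hlt
    have f := (hfol t le_rfl).2.1
    rw [← hSdef] at f
    have hpt : 0 < p (j+t) := by linarith [h.hp (j+t)]
    have hb := abs_pos.2 (h.hne _ hlt)
    have hPj := h.PP_succ (j := j-1) (by omega)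
    rw [Nat.sub_add_cancel hj] at hPj
    have hA := h.AA_pos hl (j := j-1) (by omega)
    have f2 : |X t - X (j+t)| * AA X p (j-1) ≤ Real.exp S * PP X p (j+t) := by
      rw [hPj] at f
      have : (|X t - X (j+t)| * AA X p (j-1)) * (X j + Λ) ≤ (Real.exp S * PP X p (j+t)) * (X j + Λ) := by
        linarith
      exact le_of_mul_le_mul_right this hY
    have k := hIt.2 hlt
    unfold AA at f2 hA ⊢
    rw [le_div_iff₀ hb]
    set A := p (j-1) * PP X p (j-1) / |X (j-1)|
    have s1 : B * Real.exp (lam * S) / 2 * |X (j+t)| * A ≤ p (j+t) * (Real.exp S * PP X p (j+t)) := by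
      calc _ ≤ p (j+t) * |X t - X (j+t)| * A := mul_le_mul_of_nonneg_right k hA.le
        _ = p (j+t) * (|X t - X (j+t)| * A) := by ring
        _ ≤ _ := mul_le_mul_of_nonneg_left f2 hpt.le
    have s2 : Real.exp S * (B / 2 * A * |X (j+t)|) ≤ Real.exp S * (p (j+t) * PP X p (j+t)) := by
      have z : 0 ≤ Real.exp S * (B / 2 * A * |X (j+t)|) := by positivity
      calc Real.exp S * (B / 2 * A * |X (j+t)|) ≤ Real.exp S * (B / 2 * A * |X (j+t)|) * Real.exp ((lam - 1) * S) := le_mul_of_one_le_right z hE1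
        _ = B * Real.exp (lam * S) / 2 * |X (j+t)| * A := by rw [hexp]; ring
        _ ≤ _ := by linarith
    exact le_of_mul_le_mul_left s2 hES
  · intro m hm
    have f := (hfol m hm.le).2.2.2
    obtain ⟨_, _, _, _, f5⟩ := h.pair hl (j := j) (m := m) (by omega) (hs m hm)
    have ha := abs_pos.2 (h.hne m (by omega))
    have hb := abs_pos.2 (h.hne (j+m) (by omega))
    have hpe := h.hpp _ _ (hs m hm)
    have hpm : 0 < p m := by linarith [h.hp m]
    have q2 := h.PP_pos hl (j := j+m) (by omega)
    have q1 := h.PP_pos hl (j := m) (by omega)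
    have q3 := h.PP_pos hl (j := j) (by omega)
    unfold AA
    rw [← hpe, div_le_iff₀ hb]
    have hSm : Real.exp (SS X Λ j m) * Real.exp (rho X Λ j (m+1)) ≤ Real.exp S := by
      rw [← Real.exp_add, ← SS_succ]
      exact Real.exp_le_exp.2 (SS_mono j hm)
    have c1 : PP X p (j+m) * |X m| ≤ (Real.exp S * (PP X p j * PP X p m)) * |X (j+m)| := by
      calc _ ≤ (Real.exp (SS X Λ j m) * (PP X p j * PP X p m)) * (Real.exp (rho X Λ j (m+1)) * |X (j+m)|) :=
            mul_le_mul f f5 ha.le (by positivity)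
        _ = (Real.exp (SS X Λ j m) * Real.exp (rho X Λ j (m+1))) * ((PP X p j * PP X p m) * |X (j+m)|) := by ring
        _ ≤ Real.exp S * ((PP X p j * PP X p m) * |X (j+m)|) :=
            mul_le_mul_of_nonneg_right hSm (by positivity)
        _ = _ := by ring
    calc p m * PP X p (j+m) = p m * ((PP X p (j+m) * |X m|) / |X m|) := by
          field_simp
      _ ≤ p m * (((Real.exp S * (PP X p j * PP X p m)) * |X (j+m)|) / |X m|) := by
          gcongr
      _ = _ := by ring

end
end FML

namespace FML
section
variable {L : ℕ} {ℓ : ℝ} {N : ℕ} {Λ : ℝ} {X p : ℕ → ℝ}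

lemma Orb.lemX (h : Orb L ℓ N Λ X p) (hl : 2 ≤ ℓ) {B lam M M' : ℝ} (hB : 2 < B) (hlam : 1 ≤ lam)
    (hlB : B * Real.exp (lam * (Phi B lam (2*L+2) + 8)) ≤ ℓ) (hM' : 1 ≤ M')
    (hMM : Real.exp (Phi B lam (2*L+2) + 8) * M ≤ M')
    {j s : ℕ} (hjN : j < N) (hi : ∀ i, 1 ≤ i → i < j → M' ≤ PP X p i)
    (hs : s < j) (hA : AA X p (j-1) < AA X p s) : M ≤ PP X p j := by
  obtain ⟨n', hn', hmax⟩ := Finset.exists_max_image (Finset.Icc s (j-1)) (AA X p)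
    ⟨s, by simp; omega⟩
  rw [Finset.mem_Icc] at hn'
  have h1 : AA X p s ≤ AA X p n' := hmax s (by simp; omega)
  have hne : n' ≠ j - 1 := by
    rintro rfl; linarith
  obtain ⟨t, S, ht, hS0, hS, -, hb, -, hd, -⟩ := h.T hl (by linarith) hlam hlB (j := n'+1) (by omega) (by omega)
  have hlt : ¬ (n' + 1 + t ≤ j - 1) := by
    intro hle
    have a := hd (by omega)
    rw [Nat.add_sub_cancel] at a
    have b := hmax (n'+1+t) (by simp; omega)
    have c := h.AA_pos hl (j := n') (by omega)
    nlinarith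
  have k := hb (j - (n'+1)) (by omega)
  rw [show n' + 1 + (j - (n'+1)) = j by omega] at k
  have a1 := hi (n'+1) (by omega) (by omega)
  have a2 := hi (j-(n'+1)) (by omega) (by omega)
  have hE : Real.exp S ≤ Real.exp (Phi B lam (2*L+2) + 8) := Real.exp_le_exp.2 hS
  have hP := h.PP_pos hl (j := j) (by omega)
  have hEp := Real.exp_pos (Phi B lam (2*L+2) + 8)
  have k1 : M' * M' ≤ PP X p (n'+1) * PP X p (j-(n'+1)) := mul_le_mul a1 a2 (by linarith) (by linarith)
  have k2 : Real.exp S * PP X p j ≤ Real.exp (Phi B lam (2*L+2) + 8) * PP X p j :=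
    mul_le_mul_of_nonneg_right hE hP.le
  have k3 : M' ≤ M' * M' := by nlinarith
  have : Real.exp (Phi B lam (2*L+2) + 8) * M ≤ Real.exp (Phi B lam (2*L+2) + 8) * PP X p j := by linarith
  exact le_of_mul_le_mul_left this hEp

lemma step (L : ℕ) {M : ℝ} (hM : 1 ≤ M) : ∃ M' ℓ1 : ℝ, M ≤ M' ∧ 2 ≤ ℓ1 ∧
    ∀ (ℓ : ℝ) (N : ℕ) (Λ : ℝ) (X p : ℕ → ℝ), ℓ1 ≤ ℓ → Orb L ℓ N Λ X p →
      ∀ j, 1 ≤ j → j < N → (∀ i, 1 ≤ i → i < j → M' ≤ PP X p i) → M ≤ PP X p j := by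
  set B : ℝ := 4 * M ^ (L+2) with hBdef
  set lam : ℝ := L + 2 with hlamdef
  set S0 : ℝ := Phi B lam (2*L+2) + 8 with hS0def
  have hML : 1 ≤ M ^ (L+2) := one_le_pow₀ hM
  have hB : 2 < B := by linarith
  have hlam : 1 ≤ lam := by have : (0:ℝ) ≤ L := Nat.cast_nonneg L; linarith
  have hS0 : 0 ≤ S0 := by
    have : Phi B lam 0 ≤ Phi B lam (2*L+2) := Phi_mono (by linarith) (by omega)
    have e : Phi B lam 0 = 0 := rfl
    linarith
  have hE0 : 1 ≤ Real.exp S0 := Real.one_le_exp hS0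
  refine ⟨Real.exp S0 * M, max 2 (B * Real.exp (lam * S0)), by nlinarith, le_max_left _ _, ?_⟩
  intro ℓ N Λ X p hℓ h j hj hjN hi
  have hl : 2 ≤ ℓ := (le_max_left _ _).trans hℓ
  have hlB : B * Real.exp (lam * S0) ≤ ℓ := (le_max_right _ _).trans hℓ
  obtain ⟨t, S, ht, hSn, hS, hsg, -, hc, -, he⟩ := h.T hl (by linarith) hlam hlB hj hjN
  have hPj := h.PP_pos hl (j := j) hjN.le
  by_cases hA : AA X p (j-1) < AA X p (t % j)
  · exact h.lemX hl hB hlam hlB (M' := Real.exp S0 * M) (by nlinarith) le_rfl hjN hi (Nat.mod_lt _ hj) hA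
  rw [not_lt] at hA
  have hES := Real.exp_pos S
  have hit : ∀ k, t % j + k * j ≤ t → AA X p (t % j + k * j) ≤ (Real.exp S * PP X p j) ^ k * AA X p (t % j) := by
    intro k
    induction k with
    | zero => intro _; simp
    | succ k ih =>
      intro hk
      have hk' : t % j + k * j + j ≤ t := by rw [add_mul, one_mul] at hk; omega
      have i1 := ih (by omega)
      have i2 := he (t % j + k * j) (by omega)
      rw [show t % j + (k+1) * j = j + (t % j + k * j) by ring, pow_succ]
      calc _ ≤ _ := i2
        _ ≤ Real.exp S * PP X p j * ((Real.exp S * PP X p j) ^ k * AA X p (t % j)) :=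
          mul_le_mul_of_nonneg_left i1 (by positivity)
        _ = _ := by ring
  have htd : t % j + (t / j) * j = t := by rw [mul_comm]; exact Nat.mod_add_div t j
  have hAt := hit (t / j) htd.le
  rw [htd] at hAt
  -- number of turns
  have hneg : ∀ k, k * j ≤ t → X (k * j) < 0 := by
    intro k
    induction k with
    | zero => intro _; rw [zero_mul, h.h0]; linarith [h.hΛ]
    | succ k ih =>
      intro hk
      have hk' : k * j + j ≤ t := by rw [add_mul, one_mul] at hk; omega
      have i1 := ih (by omega)
      have i2 := hsg (k * j) (by omega)
      rw [show (k+1) * j = j + k * j by ring]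
      by_contra hcon
      rw [not_lt] at hcon
      have := mul_nonpos_of_nonpos_of_nonneg i1.le hcon
      linarith
  have hN' : t / j + 1 ≤ L := by
    refine le_trans ?_ h.hcard
    have : (Finset.image (fun k => k * j) (Finset.range (t / j + 1))).card = t / j + 1 := by
      rw [Finset.card_image_of_injective, Finset.card_range]
      intro a b hab
      exact Nat.eq_of_mul_eq_mul_right hj hab
    rw [← this]
    apply Finset.card_le_card
    intro x hx
    rw [Finset.mem_image] at hx
    obtain ⟨k, hk, rfl⟩ := hx
    rw [Finset.mem_range] at hk
    have hkt : k * j ≤ t := by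
      calc k * j ≤ (t / j) * j := Nat.mul_le_mul_right _ (by omega)
        _ ≤ t := Nat.div_mul_le_self _ _
    rw [Finset.mem_filter, Finset.mem_range]
    exact ⟨by omega, hneg k hkt⟩
  have hY : 0 < X j + Λ := by
    have := h.Y_pos (j := j-1) (by omega)
    rwa [Nat.sub_add_cancel hj] at this
  have hPs := h.PP_succ (j := j-1) (by omega)
  rw [Nat.sub_add_cancel hj] at hPs
  set n := t / j with hn
  have g1 : (X j + Λ) * AA X p t ≤ PP X p j * (Real.exp S * PP X p j) ^ n := by
    calc (X j + Λ) * AA X p t ≤ (X j + Λ) * ((Real.exp S * PP X p j) ^ n * AA X p (t % j)) :=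
          mul_le_mul_of_nonneg_left hAt hY.le
      _ ≤ (X j + Λ) * ((Real.exp S * PP X p j) ^ n * AA X p (j-1)) := by
          apply mul_le_mul_of_nonneg_left _ hY.le
          exact mul_le_mul_of_nonneg_left hA (by positivity)
      _ = (AA X p (j-1) * (X j + Λ)) * (Real.exp S * PP X p j) ^ n := by ring
      _ = _ := by rw [← hPs]
  have g2 : Real.exp S ^ n ≤ Real.exp ((lam - 1) * S) := by
    rw [← Real.exp_nat_mul]
    apply Real.exp_le_exp.2
    apply mul_le_mul_of_nonneg_right _ hSn
    have : (n:ℝ) + 1 ≤ L := by exact_mod_cast hN'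
    linarith
  have g3 : B / 2 ≤ PP X p j ^ (n+1) := by
    have hEn : 0 < Real.exp S ^ n := by positivity
    have : Real.exp S ^ n * (B / 2) ≤ Real.exp S ^ n * PP X p j ^ (n+1) := by
      calc Real.exp S ^ n * (B / 2) ≤ Real.exp ((lam - 1) * S) * (B / 2) :=
            mul_le_mul_of_nonneg_right g2 (by linarith)
        _ ≤ _ := by
          have := hc.trans g1
          rw [mul_pow] at this
          calc _ = _ := by ring
            _ ≤ _ := this
            _ = _ := by ring
    exact le_of_mul_le_mul_left this hEn
  by_contra hcon
  rw [not_le] at hcon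
  have g4 : PP X p j ^ (n+1) ≤ M ^ (n+1) := pow_le_pow_left₀ hPj.le hcon.le _
  have g5 : M ^ (n+1) ≤ M ^ (L+2) := pow_le_pow_right₀ hM (by omega)
  linarith

lemma Orb.dd_ge (h : Orb L ℓ N Λ X p) (hl : 2 ≤ ℓ) {j : ℕ} (hj : j < N) (hX : 0 ≤ X (j+1)) :
    ℓ / 2 ≤ dd X p j := by
  rw [h.dd_eq hj]
  have ha := abs_pos.2 (h.hne j hj)
  rw [le_div_iff₀ ha]
  have h1 := h.hle2 j hj.le
  have h2 := h.hp j
  have h3 := h.hΛ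
  calc ℓ / 2 * |X j| ≤ ℓ / 2 * 2 := mul_le_mul_of_nonneg_left h1 (by linarith)
    _ = ℓ * 1 := by ring
    _ ≤ p j * (X (j+1) + Λ) := mul_le_mul h2 (by linarith) (by norm_num) (by linarith)

lemma rank (L n : ℕ) : ∀ M : ℝ, 1 ≤ M → ∃ ℓ1 : ℝ, 4 ≤ ℓ1 ∧
    ∀ (ℓ : ℝ) (N : ℕ) (Λ : ℝ) (X p : ℕ → ℝ), ℓ1 ≤ ℓ → Orb L ℓ N Λ X p →
      ∀ j, 1 ≤ j → j ≤ N → ((Finset.Icc 1 j).filter (fun l => X l < 0)).card ≤ n →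
        M ≤ PP X p j := by
  -- the inductive step in `j`, given how to handle negative positions
  have inner : ∀ (M : ℝ), 1 ≤ M → ∀ (ℓ : ℝ) (N : ℕ) (Λ : ℝ) (X p : ℕ → ℝ) (n : ℕ), 4 ≤ ℓ → 2 * M ≤ ℓ →
      Orb L ℓ N Λ X p →
      (∀ j, 1 ≤ j → j < N → X j < 0 → ((Finset.Icc 1 j).filter (fun l => X l < 0)).card ≤ n →
        M ≤ PP X p j) →
      ∀ j, 1 ≤ j → j ≤ N → ((Finset.Icc 1 j).filter (fun l => X l < 0)).card ≤ n →
        M ≤ PP X p j := by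
    intro M hM ℓ N Λ X p n h4 h2 h hneg j
    induction j with
    | zero => intro h0; omega
    | succ j ih =>
      intro _ hjN hc
      by_cases hX : X (j+1) < 0
      · refine hneg (j+1) (by omega) ?_ hX hc
        rcases hjN.lt_or_eq with h' | h'
        · exact h'
        · rw [h', h.hN] at hX; exact absurd hX (lt_irrefl _)
      · rw [not_lt] at hX
        have hd := h.dd_ge (by linarith) (j := j) (by omega) hX
        have hP1 : 1 ≤ PP X p j := by
          rcases Nat.eq_zero_or_pos j with rfl | hj
          · simp [PP]
          · refine hM.trans (ih hj (by omega) (le_trans ?_ hc))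
            apply Finset.card_le_card
            apply Finset.filter_subset_filter
            exact Finset.Icc_subset_Icc_right (by omega)
        rw [PP_succ']
        nlinarith
  induction n with
  | zero =>
    intro M hM
    refine ⟨max 4 (2*M), le_max_left _ _, ?_⟩
    intro ℓ N Λ X p hℓ h
    refine inner M hM ℓ N Λ X p 0 ((le_max_left _ _).trans hℓ) ((le_max_right _ _).trans hℓ) h ?_
    intro j hj hjN hX hc
    exfalso
    have : j ∈ (Finset.Icc 1 j).filter (fun l => X l < 0) := by
      rw [Finset.mem_filter, Finset.mem_Icc]; exact ⟨⟨hj, le_rfl⟩, hX⟩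
    have := Finset.card_pos.2 ⟨j, this⟩
    omega
  | succ n IH =>
    intro M hM
    obtain ⟨M', ℓ1, hMM, hℓ1, hstep⟩ := step L hM
    obtain ⟨ℓ2, hℓ2, hr⟩ := IH M' (by linarith)
    refine ⟨max (max ℓ1 ℓ2) (2*M), le_trans hℓ2 ((le_max_right _ _).trans (le_max_left _ _)), ?_⟩
    intro ℓ N Λ X p hℓ h
    have k1 : ℓ1 ≤ ℓ := ((le_max_left _ _).trans (le_max_left _ _)).trans hℓ
    have k2 : ℓ2 ≤ ℓ := ((le_max_right _ _).trans (le_max_left _ _)).trans hℓ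
    refine inner M hM ℓ N Λ X p (n+1) (by linarith) ((le_max_right _ _).trans hℓ) h ?_
    intro j hj hjN hX hc
    refine hstep ℓ N Λ X p k1 h j hj hjN ?_
    intro i hi hij
    refine hr ℓ N Λ X p k2 h i hi (by omega) ?_
    have hlt : ((Finset.Icc 1 i).filter (fun l => X l < 0)).card <
        ((Finset.Icc 1 j).filter (fun l => X l < 0)).card := by
      apply Finset.card_lt_card
      rw [Finset.ssubset_iff_of_subset]
      · refine ⟨j, ?_, ?_⟩
        · rw [Finset.mem_filter, Finset.mem_Icc]; exact ⟨⟨hj, le_rfl⟩, hX⟩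
        · rw [Finset.mem_filter, Finset.mem_Icc]; omega
      · apply Finset.filter_subset_filter
        exact Finset.Icc_subset_Icc_right (by omega)
    omega

lemma sum_small (L : ℕ) : ∃ ℓ1 : ℝ, 4 ≤ ℓ1 ∧
    ∀ (ℓ : ℝ) (N : ℕ) (Λ : ℝ) (X p : ℕ → ℝ), ℓ1 ≤ ℓ → Orb L ℓ N Λ X p →
      ∑ i ∈ Finset.range N, (PP X p (i+1))⁻¹ < 1 := by
  set M : ℝ := 2 * L + 3 with hMd
  have hL0 : (0:ℝ) ≤ L := Nat.cast_nonneg L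
  have hM : 1 ≤ M := by linarith
  obtain ⟨ℓ1, h4, hr⟩ := rank L L M hM
  refine ⟨ℓ1, h4, ?_⟩
  intro ℓ N Λ X p hℓ h
  have hl2 : 2 ≤ ℓ := by linarith
  have hcard : ∀ j, j ≤ N → ((Finset.Icc 1 j).filter (fun l => X l < 0)).card ≤ L := by
    intro j hj
    refine le_trans (Finset.card_le_card ?_) h.hcard
    intro i hi
    rw [Finset.mem_filter, Finset.mem_Icc] at hi
    rw [Finset.mem_filter, Finset.mem_range]
    refine ⟨?_, hi.2⟩
    rcases (hi.1.2.trans hj).lt_or_eq with h' | h'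
    · exact h'
    · exfalso; have := hi.2; rw [h', h.hN] at this; exact lt_irrefl _ this
  have hbig : ∀ j, 1 ≤ j → j ≤ N → M ≤ PP X p j := fun j h1 h2 => hr ℓ N Λ X p hℓ h j h1 h2 (hcard j h2)
  have hinv : ∀ j, 1 ≤ j → j ≤ N → (PP X p j)⁻¹ ≤ M⁻¹ := fun j h1 h2 =>
    inv_anti₀ (by linarith) (hbig j h1 h2)
  rcases Nat.eq_zero_or_pos N with h0 | hN
  · subst h0; simp
  have key : ∀ j, 1 ≤ j → j ≤ N → ∑ i ∈ Finset.range j, (PP X p (i+1))⁻¹ + (PP X p j)⁻¹ ≤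
      2 * M⁻¹ * (1 + ((Finset.Icc 1 j).filter (fun l => X l < 0)).card) := by
    intro j hj
    induction j, hj using Nat.le_induction with
    | base =>
      intro h1
      have := hinv 1 le_rfl h1
      have hMi : 0 < M⁻¹ := by positivity
      have hc : (0:ℝ) ≤ (((Finset.Icc 1 1).filter (fun l => X l < 0)).card : ℝ) := Nat.cast_nonneg _
      rw [Finset.sum_range_one, zero_add]
      nlinarith
    | succ j hj ih =>
      intro hjN
      have ih := ih (by omega)
      rw [Finset.sum_range_succ]
      have hMi : 0 < M⁻¹ := by positivity
      have hPj := h.PP_pos hl2 (j := j) (by omega)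
      by_cases hX : X (j+1) < 0
      · have e : ((Finset.Icc 1 (j+1)).filter (fun l => X l < 0)).card =
            ((Finset.Icc 1 j).filter (fun l => X l < 0)).card + 1 := by
          rw [← Finset.insert_Icc_right_eq_Icc_add_one (by omega), Finset.filter_insert, if_pos hX, Finset.card_insert_of_notMem]
          simp
        rw [e]
        push_cast
        have a1 := hinv (j+1) (by omega) hjN
        have a2 : 0 < (PP X p j)⁻¹ := by positivity
        linarith
      · rw [not_lt] at hX
        have e : ((Finset.Icc 1 j).filter (fun l => X l < 0)).card ≤
            ((Finset.Icc 1 (j+1)).filter (fun l => X l < 0)).card := by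
          apply Finset.card_le_card
          apply Finset.filter_subset_filter
          exact Finset.Icc_subset_Icc_right (by omega)
        have e' : (((Finset.Icc 1 j).filter (fun l => X l < 0)).card : ℝ) ≤
            ((Finset.Icc 1 (j+1)).filter (fun l => X l < 0)).card := by exact_mod_cast e
        have hd := h.dd_ge hl2 (j := j) (by omega) hX
        have hP : 2 * PP X p j ≤ PP X p (j+1) := by rw [PP_succ']; nlinarith
        have a1 : (PP X p (j+1))⁻¹ ≤ (2 * PP X p j)⁻¹ := inv_anti₀ (by positivity) hP
        rw [mul_inv] at a1
        nlinarith
  have k := key N hN le_rfl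
  have hc : (((Finset.Icc 1 N).filter (fun l => X l < 0)).card : ℝ) ≤ L := by exact_mod_cast hcard N le_rfl
  have hP := h.PP_pos hl2 (j := N) le_rfl
  have hPi : 0 < (PP X p N)⁻¹ := by positivity
  have hMi : 0 < M⁻¹ := by positivity
  have hMM : M⁻¹ * M = 1 := inv_mul_cancel₀ (by linarith)
  nlinarith

end
end FML

namespace FML

noncomputable def gg (lm lp c : ℝ) (j : ℕ) : ℝ := (fml lm lp c)^[j] 0

lemma gg_zero (lm lp c : ℝ) : gg lm lp c 0 = 0 := rfl

lemma gg_succ (lm lp c : ℝ) (j : ℕ) : gg lm lp c (j+1) = fml lm lp c (gg lm lp c j) := by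
  unfold gg; rw [Function.iterate_succ_apply']

lemma gg_one {lm : ℝ} (lp c : ℝ) (h : 1 < lm) : gg lm lp c 1 = c := by
  rw [gg_succ, gg_zero, fml, if_pos le_rfl, abs_zero, Real.zero_rpow (by linarith), zero_add]

noncomputable def qq (lm lp x : ℝ) : ℝ := if x ≤ 0 then lm else lp

lemma fml_eq (lm lp c x : ℝ) : fml lm lp c x = |x| ^ qq lm lp x + c := by
  unfold fml qq; split_ifs <;> rfl

lemma le_fml (lm lp c x : ℝ) : c ≤ fml lm lp c x := by
  rw [fml_eq]
  have : 0 ≤ |x| ^ qq lm lp x := Real.rpow_nonneg (abs_nonneg _) _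
  linarith

lemma setup {L : ℕ} {ℓ lm lp c : ℝ} {q : ℕ} (hℓ : 2 ≤ ℓ) (hm : ℓ ≤ lm) (hp : ℓ ≤ lp) (hq : 2 ≤ q)
    (hz : gg lm lp c q = 0) (hnz : ∀ j, 1 ≤ j → j < q → gg lm lp c j ≠ 0)
    (hc : ((Finset.range (q-1)).filter (fun l => gg lm lp c (l+1) < 0)).card ≤ L) :
    Orb L ℓ (q-1) (-c) (fun j => gg lm lp c (j+1)) (fun j => qq lm lp (gg lm lp c (j+1))) := by
  have hg1 := gg_one lp c (by linarith : 1 < lm)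
  have hge : ∀ j, 1 ≤ j → c ≤ gg lm lp c j := by
    intro j hj
    obtain ⟨i, rfl⟩ : ∃ i, j = i + 1 := ⟨j-1, by omega⟩
    rw [gg_succ]; exact le_fml _ _ _ _
  have hc0 : c < 0 := by
    have h1 := hge q (by omega)
    rw [hz] at h1
    refine lt_of_le_of_ne h1 ?_
    have := hnz 1 le_rfl (by omega)
    rwa [hg1] at this
  have hΛ : 1 ≤ -c := by
    by_contra hcon
    rw [not_le] at hcon
    have : ∀ j, 1 ≤ j → gg lm lp c j < 0 := by
      intro j hj
      induction j, hj using Nat.le_induction with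
      | base => rw [hg1]; exact hc0
      | succ j hj ih =>
        rw [gg_succ, fml, if_pos ih.le]
        have h1 : |gg lm lp c j| ≤ -c := by rw [abs_of_neg ih]; linarith [hge j hj]
        have h2 : |gg lm lp c j| ^ lm ≤ (-c) ^ lm := Real.rpow_le_rpow (abs_nonneg _) h1 (by linarith)
        have h3 : (-c) ^ lm < (-c) ^ (1:ℝ) :=
          Real.rpow_lt_rpow_of_exponent_gt (by linarith) hcon (by linarith)
        rw [Real.rpow_one] at h3
        linarith
    have := this q (by omega)
    rw [hz] at this
    exact lt_irrefl _ this
  set x2 := gg lm lp c 2 with hx2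
  have ex2 : x2 = (-c) ^ lm + c := by
    rw [hx2, gg_succ, hg1, fml, if_pos hc0.le, abs_of_neg hc0]
  have hpow2 : ∀ x y : ℝ, 1 ≤ x → 2 ≤ y → x ^ 2 ≤ x ^ y := by
    intro x y hx hy
    rw [← Real.rpow_natCast]
    exact Real.rpow_le_rpow_of_exponent_le hx (by exact_mod_cast hy)
  have hx2c : (-c)^2 + c ≤ x2 := by rw [ex2]; linarith [hpow2 (-c) lm hΛ (by linarith)]
  have hx20 : 0 ≤ x2 := by nlinarith
  have hinv : x2 ^ lp ≤ x2 - c := by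
    by_contra hcon
    rw [not_le] at hcon
    have hpos : 0 < x2 := by
      refine lt_of_le_of_ne hx20 ?_
      intro he
      rw [← he, Real.zero_rpow (by linarith)] at hcon
      linarith
    have : ∀ j, 2 ≤ j → x2 ≤ gg lm lp c j := by
      intro j hj
      induction j, hj using Nat.le_induction with
      | base => exact le_rfl
      | succ j hj ih =>
        rw [gg_succ, fml, if_neg (by linarith), abs_of_pos (by linarith)]
        have := Real.rpow_le_rpow hx20 ih (by linarith : 0 ≤ lp)
        linarith
    have := this q hq
    linarith
  have hle : ∀ j, 1 ≤ j → gg lm lp c j ≤ x2 := by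
    intro j hj
    induction j, hj using Nat.le_induction with
    | base => rw [hg1]; linarith
    | succ j hj ih =>
      rw [gg_succ, fml]
      split_ifs with hs
      · rw [ex2]
        have : |gg lm lp c j| ≤ -c := by rw [abs_of_nonpos hs]; linarith [hge j hj]
        have := Real.rpow_le_rpow (abs_nonneg _) this (by linarith : 0 ≤ lm)
        linarith
      · rw [not_le] at hs
        rw [abs_of_pos hs]
        have := Real.rpow_le_rpow hs.le ih (by linarith : 0 ≤ lp)
        linarith
  have hΛ2 : -c ≤ 2 := by
    by_contra hcon
    rw [not_le] at hcon
    have h1 : -c < x2 := by nlinarith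
    have h2 := hpow2 x2 lp (by linarith) (by linarith)
    nlinarith
  have hx22 : x2 ≤ 2 := by
    by_contra hcon
    rw [not_le] at hcon
    have h2 := hpow2 x2 lp (by linarith) (by linarith)
    nlinarith
  refine ⟨hΛ, ?_, ?_, ?_, ?_, ?_, ?_, ?_, ?_, hc⟩
  · intro j; unfold qq; split_ifs <;> assumption
  · show gg lm lp c (0+1) = - -c
    rw [zero_add, hg1, neg_neg]
  · show gg lm lp c (q-1+1) = 0
    rw [Nat.sub_add_cancel (by omega), hz]
  · intro j hj
    exact hnz (j+1) (by omega) (by omega)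
  · intro j hj
    show |gg lm lp c (j+1)| ^ qq lm lp (gg lm lp c (j+1)) = gg lm lp c (j+1+1) + -c
    rw [gg_succ lm lp c (j+1), fml_eq]; ring
  · intro j _
    have a := hge (j+1) (by omega)
    have b := hle (j+1) (by omega)
    exact abs_le.2 ⟨by linarith, by linarith⟩
  · intro j _
    have b := hle (j+1) (by omega)
    show gg lm lp c (j+1) + -c ≤ 4
    linarith
  · intro i j hij
    show qq lm lp (gg lm lp c (i+1)) = qq lm lp (gg lm lp c (j+1))
    unfold qq
    rcases pos_and_pos_or_neg_and_neg_of_mul_pos hij with ⟨h1, h2⟩ | ⟨h1, h2⟩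
    · rw [if_neg (not_le.2 h1), if_neg (not_le.2 h2)]
    · rw [if_pos h1.le, if_pos h2.le]

/-- real-valued sign -/
noncomputable def sg (x : ℝ) : ℝ := ((SignType.sign x : SignType) : ℝ)

lemma sg_pos {x : ℝ} (h : 0 < x) : sg x = 1 := by simp [sg, sign_pos h]
lemma sg_neg {x : ℝ} (h : x < 0) : sg x = -1 := by simp [sg, sign_neg h]

lemma sg_cases {x : ℝ} (h : x ≠ 0) : sg x = 1 ∨ sg x = -1 := by
  rcases lt_or_gt_of_ne h with h | h
  · right; exact sg_neg h
  · left; exact sg_pos h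

lemma fml_deriv {lm lp x : ℝ} {u : ℝ → ℝ} {u' c : ℝ} (hx : u c = x) (hx0 : x ≠ 0)
    (hu : HasDerivAt u u' c) :
    HasDerivAt (fun c => fml lm lp c (u c))
      (1 + sg x * (qq lm lp x * |x| ^ (qq lm lp x - 1)) * u') c := by
  subst hx
  rcases lt_or_gt_of_ne hx0 with h | h
  · have hev : ∀ᶠ y in nhds c, u y < 0 := hu.continuousAt.eventually (gt_mem_nhds h)
    have h1 : HasDerivAt (fun y => (-(u y)) ^ lm + y) (-u' * lm * (-(u c)) ^ (lm - 1) + 1) c :=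
      (hu.neg.rpow_const (Or.inl (by simpa using h.ne))).add (hasDerivAt_id c)
    have e : qq lm lp (u c) = lm := by unfold qq; rw [if_pos h.le]
    rw [e, sg_neg h, abs_of_neg h]
    have h2 := h1.congr_of_eventuallyEq (f₁ := fun c => fml lm lp c (u c)) (by
      filter_upwards [hev] with y hy
      rw [fml, if_pos hy.le, abs_of_neg hy])
    refine h2.congr_deriv ?_
    ring
  · have hev : ∀ᶠ y in nhds c, 0 < u y := hu.continuousAt.eventually (lt_mem_nhds h)
    have h1 : HasDerivAt (fun y => (u y) ^ lp + y) (u' * lp * (u c) ^ (lp - 1) + 1) c :=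
      (hu.rpow_const (Or.inl h.ne')).add (hasDerivAt_id c)
    have e : qq lm lp (u c) = lp := by unfold qq; rw [if_neg (not_le.2 h)]
    rw [e, sg_pos h, abs_of_pos h]
    have h2 := h1.congr_of_eventuallyEq (f₁ := fun c => fml lm lp c (u c)) (by
      filter_upwards [hev] with y hy
      rw [fml, if_neg (not_le.2 hy), abs_of_pos hy])
    refine h2.congr_deriv ?_
    ring

lemma transv (L : ℕ) : ∃ ℓ0 : ℝ, 4 ≤ ℓ0 ∧ ∀ lm lp : ℝ, ℓ0 ≤ lm → ℓ0 ≤ lp → ∀ (N : ℕ) (c : ℝ),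
    gg lm lp c (N+1) = 0 → (∀ j, 1 ≤ j → j < N+1 → gg lm lp c j ≠ 0) →
    ((Finset.range N).filter (fun l => gg lm lp c (l+1) < 0)).card ≤ L →
    ∃ r, HasDerivAt (fun c => gg lm lp c (N+1)) r c ∧
      0 < (∏ l ∈ Finset.range N, sg (gg lm lp c (l+1))) * r := by
  obtain ⟨ℓ0, h4, hsum⟩ := sum_small L
  refine ⟨ℓ0, h4, ?_⟩
  intro lm lp hm hp N c hz hnz hc
  have hbase : HasDerivAt (fun c => gg lm lp c (0+1)) 1 c := by
    have : (fun c => gg lm lp c (0+1)) = id := by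
      funext c; rw [zero_add, gg_one lp c (by linarith)]; rfl
    rw [this]; exact hasDerivAt_id c
  rcases Nat.eq_zero_or_pos N with rfl | hN
  · exact ⟨1, hbase, by simp⟩
  have h := setup (L := L) (q := N+1) (by linarith : 2 ≤ ℓ0) hm hp (by omega) hz hnz hc
  have hs := hsum ℓ0 _ _ _ _ le_rfl h
  simp only [Nat.add_sub_cancel] at h hs
  set X : ℕ → ℝ := fun j => gg lm lp c (j+1) with hX
  set p : ℕ → ℝ := fun j => qq lm lp (gg lm lp c (j+1)) with hpd
  set ep : ℕ → ℝ := fun j => ∏ l ∈ Finset.range j, sg (X l) with hep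
  have hl2 : 2 ≤ ℓ0 := by linarith
  have ep1 : ∀ j, j ≤ N → ep j = 1 ∨ ep j = -1 := by
    intro j
    induction j with
    | zero => intro _; left; simp [hep]
    | succ j ih =>
      intro hj
      have e : ep (j+1) = ep j * sg (X j) := by simp only [hep]; rw [Finset.prod_range_succ]
      rw [e]
      rcases ih (by omega) with a | a <;> rcases sg_cases (h.hne j (by omega)) with b | b <;>
        rw [a, b] <;> norm_num
  have key : ∀ j, j ≤ N → HasDerivAt (fun c => gg lm lp c (j+1))
      (ep j * PP X p j * (1 + ∑ i ∈ Finset.range j, (ep (i+1) * PP X p (i+1))⁻¹)) c := by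
    intro j
    induction j with
    | zero =>
      intro _
      simpa [hep, PP] using hbase
    | succ j ih =>
      intro hj
      have d := fml_deriv (lm := lm) (lp := lp) (x := X j) (u := fun c => gg lm lp c (j+1)) rfl (h.hne j (by omega)) (ih (by omega))
      have e : (fun c => gg lm lp c (j+1+1)) = fun c => fml lm lp c (gg lm lp c (j+1)) := by
        funext c; rw [gg_succ]
      rw [e]
      refine d.congr_deriv ?_
      have e1 : ep (j+1) = ep j * sg (X j) := by simp only [hep]; rw [Finset.prod_range_succ]
      have e2 : PP X p (j+1) = PP X p j * (qq lm lp (X j) * |X j| ^ (qq lm lp (X j) - 1)) := by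
        rw [PP_succ']; rfl
      have hP := h.PP_pos hl2 hj
      have hne : ep (j+1) * PP X p (j+1) ≠ 0 := by
        rcases ep1 _ hj with a | a <;> rw [a]
        · linarith
        · intro hh; linarith
      symm
      rw [Finset.sum_range_succ, ← add_assoc, mul_add, mul_inv_cancel₀ hne, e1, e2]
      ring
  refine ⟨_, key N le_rfl, ?_⟩
  have hP := h.PP_pos hl2 (le_refl N)
  have hsq : ep N * ep N = 1 := by rcases ep1 N le_rfl with a | a <;> rw [a] <;> norm_num
  have hsum2 : |∑ i ∈ Finset.range N, (ep (i+1) * PP X p (i+1))⁻¹| < 1 := by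
    refine lt_of_le_of_lt (Finset.abs_sum_le_sum_abs _ _) (lt_of_le_of_lt (le_of_eq ?_) hs)
    apply Finset.sum_congr rfl
    intro i hi
    have hi' := Finset.mem_range.1 hi
    have hPi := h.PP_pos hl2 (j := i+1) (by omega)
    rw [abs_inv, abs_mul, abs_of_pos hPi]
    rcases ep1 (i+1) (by omega) with a | a <;> rw [a] <;> simp
  have h1 := (abs_lt.1 hsum2).1
  show 0 < ep N * (ep N * PP X p N * (1 + ∑ i ∈ Finset.range N, (ep (i+1) * PP X p (i+1))⁻¹))
  rw [← mul_assoc, ← mul_assoc, hsq, one_mul]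
  exact mul_pos hP (by linarith)

lemma gg_cont {lm lp : ℝ} (hm : 0 < lm) (hp : 0 < lp) (j : ℕ) : Continuous (fun c => gg lm lp c j) := by
  induction j with
  | zero => exact continuous_const
  | succ j ih =>
    have : (fun c => gg lm lp c (j+1)) = fun c =>
        if gg lm lp c j ≤ 0 then |gg lm lp c j| ^ lm + c else |gg lm lp c j| ^ lp + c := by
      funext c; rw [gg_succ, fml]
    rw [this]
    refine Continuous.if_le ?_ ?_ ih continuous_const ?_
    · exact (ih.abs.rpow_const (fun _ => Or.inr hm.le)).add continuous_id
    · exact (ih.abs.rpow_const (fun _ => Or.inr hp.le)).add continuous_id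
    · intro c hc
      rw [hc, abs_zero, Real.zero_rpow hm.ne', Real.zero_rpow hp.ne']

open Filter Topology in
lemma deriv_sign {h : ℝ → ℝ} {r z : ℝ} (hd : HasDerivAt h r z) (hz : h z = 0) (hr : 0 < r) :
    (∀ᶠ y in 𝓝[<] z, h y < 0) ∧ (∀ᶠ y in 𝓝[>] z, 0 < h y) := by
  have h1 := hasDerivAt_iff_tendsto_slope.1 hd
  have h2 : ∀ᶠ y in 𝓝[≠] z, 0 < slope h z y := h1.eventually (lt_mem_nhds hr)
  constructor
  · have h3 : ∀ᶠ y in 𝓝[<] z, 0 < slope h z y := h2.filter_mono (nhdsWithin_mono _ (fun y hy => ne_of_lt hy))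
    filter_upwards [h3, self_mem_nhdsWithin] with y hy hyz
    rw [slope_def_field, hz, sub_zero] at hy
    have : y - z < 0 := sub_neg.2 hyz
    by_contra hcon
    exact absurd hy (not_lt.2 (div_nonpos_of_nonneg_of_nonpos (not_lt.1 hcon) this.le))
  · have h3 : ∀ᶠ y in 𝓝[>] z, 0 < slope h z y := h2.filter_mono (nhdsWithin_mono _ (fun y hy => ne_of_gt hy))
    filter_upwards [h3, self_mem_nhdsWithin] with y hy hyz
    rw [slope_def_field, hz, sub_zero] at hy
    have : 0 < y - z := sub_pos.2 hyz
    by_contra hcon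
    exact absurd hy (not_lt.2 (div_nonpos_of_nonpos_of_nonneg (not_lt.1 hcon) this.le))

open Filter Topology in
lemma lemZ {h : ℝ → ℝ} (hc : Continuous h) {a b : ℝ} (hab : a < b)
    (hd : ∀ x ∈ Set.Icc a b, h x = 0 → ∃ r, 0 < r ∧ HasDerivAt h r x) (ha : 0 ≤ h a) : 0 < h b := by
  by_contra hb
  rw [not_lt] at hb
  obtain ⟨a', ha1, ha2, ha3⟩ : ∃ a', a ≤ a' ∧ a' < b ∧ 0 < h a' := by
    rcases ha.lt_or_eq with h0 | h0
    · exact ⟨a, le_rfl, hab, h0⟩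
    · obtain ⟨r, hr, hdr⟩ := hd a ⟨le_rfl, hab.le⟩ h0.symm
      have h1 := (deriv_sign hdr h0.symm hr).2
      have h2 : ∀ᶠ y in 𝓝[>] a, y < b := nhdsWithin_le_nhds (gt_mem_nhds hab)
      obtain ⟨y, hy1, hy2, hy3⟩ := (h1.and (h2.and self_mem_nhdsWithin)).exists
      exact ⟨y, le_of_lt hy3, hy2, hy1⟩
  have hK : IsCompact (Set.Icc a' b ∩ {x | h x ≤ 0}) :=
    isCompact_Icc.inter_right (isClosed_le hc continuous_const)
  obtain ⟨z, ⟨⟨hz1, hz2⟩, hz3⟩, hzmin⟩ := hK.exists_isLeast ⟨b, ⟨ha2.le, le_rfl⟩, hb⟩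
  have hz3 : h z ≤ 0 := hz3
  have hlt : a' < z := by
    refine lt_of_le_of_ne hz1 ?_
    rintro rfl; linarith
  have hpos : ∀ y, a' ≤ y → y < z → 0 < h y := by
    intro y h1 h2
    by_contra hcon
    have := hzmin ⟨⟨h1, by linarith⟩, not_lt.1 hcon⟩
    linarith
  have hz0 : h z = 0 := by
    obtain ⟨y, ⟨hy1, hy2⟩, hy3⟩ := intermediate_value_Icc' hz1 hc.continuousOn ⟨hz3, ha3.le⟩
    rcases hy2.lt_or_eq with h1 | h1
    · have := hpos y hy1 h1; linarith
    · rw [← h1]; exact hy3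
  obtain ⟨r, hr, hdr⟩ := hd z ⟨by linarith, hz2⟩ hz0
  have h1 := (deriv_sign hdr hz0 hr).1
  have h2 : ∀ᶠ y in 𝓝[<] z, a' < y := nhdsWithin_le_nhds (lt_mem_nhds hlt)
  obtain ⟨y, hy1, hy2, hy3⟩ := (h1.and (h2.and self_mem_nhdsWithin)).exists
  have := hpos y hy2.le hy3
  linarith

lemma uniq (L : ℕ) : ∃ ℓ0 : ℝ, 1 < ℓ0 ∧ ∀ lm lp : ℝ, ℓ0 ≤ lm → ℓ0 ≤ lp → ∀ (N : ℕ) (c c' : ℝ),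
    gg lm lp c (N+1) = 0 → (∀ j, 1 ≤ j → j < N+1 → gg lm lp c j ≠ 0) →
    ((Finset.range N).filter (fun l => gg lm lp c (l+1) < 0)).card ≤ L →
    (∀ j, 1 ≤ j → SignType.sign (gg lm lp c j) = SignType.sign (gg lm lp c' j)) → c = c' := by
  obtain ⟨ℓ0, h4, htr⟩ := transv L
  refine ⟨ℓ0, by linarith, ?_⟩
  intro lm lp hm hp N c c' hz hnz hcard hsign
  set U : ℕ → Set ℝ := fun j => {d | ∀ l, 1 ≤ l → l ≤ j → SignType.sign (gg lm lp d l) = SignType.sign (gg lm lp c l)} with hU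
  set ep : ℕ → ℝ := fun j => ∏ l ∈ Finset.range j, sg (gg lm lp c (l+1)) with hep
  have hder : ∀ j, j ≤ N → ∀ d ∈ U j, ep j * gg lm lp d (j+1) = 0 →
      ∃ r, 0 < r ∧ HasDerivAt (fun d => ep j * gg lm lp d (j+1)) r d := by
    intro j hj d hd h0
    have hepne : ep j ≠ 0 := by
      apply Finset.prod_ne_zero_iff.2
      intro l hl
      have := Finset.mem_range.1 hl
      rcases sg_cases (hnz (l+1) (by omega) (by omega)) with a | a <;> rw [a] <;> norm_num
    have hg0 : gg lm lp d (j+1) = 0 := (mul_eq_zero.1 h0).resolve_left hepne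
    have hnz' : ∀ l, 1 ≤ l → l < j+1 → gg lm lp d l ≠ 0 := by
      intro l h1 h2 h3
      have := hd l h1 (by omega)
      rw [h3, sign_zero] at this
      exact hnz l h1 (by omega) (sign_eq_zero_iff.1 this.symm)
    have hcd : ((Finset.range j).filter (fun l => gg lm lp d (l+1) < 0)).card ≤ L := by
      refine le_trans (Finset.card_le_card ?_) hcard
      intro l hl
      rw [Finset.mem_filter, Finset.mem_range] at hl ⊢
      refine ⟨by omega, ?_⟩
      have := hd (l+1) (by omega) (by omega)
      rw [sign_neg hl.2] at this
      exact sign_eq_neg_one_iff.1 this.symm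
    obtain ⟨r, hr, hr0⟩ := htr lm lp hm hp j d hg0 hnz' hcd
    have e : ∏ l ∈ Finset.range j, sg (gg lm lp d (l+1)) = ep j := by
      apply Finset.prod_congr rfl
      intro l hl
      have := Finset.mem_range.1 hl
      unfold sg
      rw [hd (l+1) (by omega) (by omega)]
    rw [e] at hr0
    exact ⟨_, hr0, hr.const_mul _⟩
  have hcont : ∀ j, Continuous (fun d => ep j * gg lm lp d (j+1)) := fun j =>
    continuous_const.mul (gg_cont (by linarith) (by linarith) _)
  have hord : ∀ j, j ≤ N → (U j).OrdConnected := by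
    intro j
    induction j with
    | zero =>
      intro _
      refine ⟨fun a _ b _ x _ => ?_⟩
      intro l h1 h2; omega
    | succ j ih =>
      intro hj
      have hUj := ih (by omega)
      refine ⟨fun a ha b hb x hx => ?_⟩
      have ha' : a ∈ U j := fun l h1 h2 => ha l h1 (by omega)
      have hb' : b ∈ U j := fun l h1 h2 => hb l h1 (by omega)
      have hsub := hUj.out ha' hb'
      have hepj : ep j = 1 ∨ ep j = -1 := by
        have : ∀ i, i ≤ N → ep i = 1 ∨ ep i = -1 := by
          intro i
          induction i with
          | zero => intro _; left; simp [hep]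
          | succ i ih =>
            intro hi
            have e : ep (i+1) = ep i * sg (gg lm lp c (i+1)) := by simp only [hep]; rw [Finset.prod_range_succ]
            rw [e]
            rcases ih (by omega) with a | a <;> rcases sg_cases (hnz (i+1) (by omega) (by omega)) with b | b <;>
              rw [a, b] <;> norm_num
        exact this j (by omega)
      have hepne : ep j ≠ 0 := by rcases hepj with a | a <;> rw [a] <;> norm_num
      have hgc := hnz (j+1) (by omega) (by omega)
      have sa := ha (j+1) (by omega) le_rfl
      have sb := hb (j+1) (by omega) le_rfl
      have hA : SignType.sign (ep j * gg lm lp a (j+1)) = SignType.sign (ep j * gg lm lp c (j+1)) := by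
        rw [sign_mul, sa, ← sign_mul]
      have hB : SignType.sign (ep j * gg lm lp b (j+1)) = SignType.sign (ep j * gg lm lp c (j+1)) := by
        rw [sign_mul, sb, ← sign_mul]
      have hXs : SignType.sign (ep j * gg lm lp x (j+1)) = SignType.sign (ep j * gg lm lp c (j+1)) := by
        rcases lt_or_gt_of_ne (mul_ne_zero hepne hgc) with hneg | hpos
        · rw [sign_neg hneg] at hB ⊢
          rw [sign_eq_neg_one_iff] at hB ⊢
          by_contra hcon
          rw [not_lt] at hcon
          rcases hx.2.lt_or_eq with hlt | heq
          · have := lemZ (hcont j) hlt (fun y hy h0 => hder j (by omega) y (hsub ⟨hx.1.trans hy.1, hy.2⟩) h0) hcon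
            linarith
          · rw [heq] at hcon; linarith
        · rw [sign_pos hpos] at hA ⊢
          rw [sign_eq_one_iff] at hA ⊢
          rcases hx.1.lt_or_eq with hlt | heq
          · exact lemZ (hcont j) hlt (fun y hy h0 => hder j (by omega) y (hsub ⟨hy.1, hy.2.trans hx.2⟩) h0) hA.le
          · rw [← heq]; exact hA
      intro l h1 h2
      rcases h2.lt_or_eq with h3 | h3
      · exact hsub hx l h1 (by omega)
      · subst h3
        have e : ∀ y : ℝ, gg lm lp y (j+1) = ep j * (ep j * gg lm lp y (j+1)) := by
          intro y; rcases hepj with a | a <;> rw [a] <;> ring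
        rw [e x, e c, sign_mul, hXs, ← sign_mul]
  have hcU : c ∈ U N := fun l _ _ => rfl
  have hcU' : c' ∈ U N := fun l h1 _ => (hsign l h1).symm
  have hz' : gg lm lp c' (N+1) = 0 := by
    have := hsign (N+1) (by omega)
    rw [hz, sign_zero] at this
    exact sign_eq_zero_iff.1 this.symm
  have hO := hord N le_rfl
  have main : ∀ a b : ℝ, a ∈ U N → b ∈ U N → gg lm lp a (N+1) = 0 → gg lm lp b (N+1) = 0 → ¬ a < b := by
    intro a b ha hb ha0 hb0 hlt
    have := lemZ (hcont N) hlt (fun y hy h0 => hder N le_rfl y (hO.out ha hb hy) h0) (by rw [ha0, mul_zero])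
    rw [hb0, mul_zero] at this
    exact lt_irrefl _ this
  rcases lt_trichotomy c c' with h1 | h1 | h1
  · exact absurd h1 (main _ _ hcU hcU' hz hz')
  · exact h1
  · exact absurd h1 (main _ _ hcU' hcU hz' hz)

lemma knead_sign (lm lp c : ℝ) (k : ℕ) :
    fmlKnead lm lp c k = ((SignType.sign (gg lm lp c k) : SignType) : ℤ) := by
  unfold fmlKnead
  change (if 0 < gg lm lp c k then (1:ℤ) else if gg lm lp c k = 0 then 0 else -1) = _
  rcases lt_trichotomy (gg lm lp c k) 0 with h | h | h
  · rw [if_neg (not_lt.2 h.le), if_neg h.ne, sign_neg h]; rfl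
  · rw [h]; simp
  · rw [if_pos h, sign_pos h]; rfl

end FML

theorem stmt2 (L : ℕ) (hL : 1 ≤ L) :
    ∃ ℓ₀ : ℝ, 1 < ℓ₀ ∧
      ∀ lm lp : ℝ, ℓ₀ ≤ lm → ℓ₀ ≤ lp →
        ∀ q : ℕ, 1 ≤ q → ∀ c chat : ℝ,
          (fml lm lp c)^[q] 0 = 0 →
          (∀ j, 1 ≤ j → j < q → (fml lm lp c)^[j] 0 ≠ 0) →
          Set.ncard {j : ℕ | 1 ≤ j ∧ j < q ∧ (fml lm lp c)^[j] 0 < 0} ≤ L →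
          (∀ k, 1 ≤ k → fmlKnead lm lp c k = fmlKnead lm lp chat k) →
          c = chat := by
  obtain ⟨ℓ0, h1, hu⟩ := FML.uniq L
  refine ⟨ℓ0, h1, ?_⟩
  intro lm lp hm hp q hq c chat hz hnz hcard hk
  obtain ⟨N, rfl⟩ : ∃ N, q = N + 1 := ⟨q-1, by omega⟩
  refine hu lm lp hm hp N c chat hz hnz ?_ ?_
  · refine le_trans ?_ hcard
    have hfin : {j : ℕ | 1 ≤ j ∧ j < N+1 ∧ (fml lm lp c)^[j] 0 < 0}.Finite :=
      (Set.finite_lt_nat (N+1)).subset (fun j hj => hj.2.1)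
    rw [← Finset.card_image_of_injective _ (add_left_injective 1), ← Set.ncard_coe_finset]
    apply Set.ncard_le_ncard _ hfin
    intro x hx
    rw [Finset.mem_coe, Finset.mem_image] at hx
    obtain ⟨l, hl, rfl⟩ := hx
    rw [Finset.mem_filter, Finset.mem_range] at hl
    exact ⟨by simp, by simpa using hl.1, hl.2⟩
  · intro j hj
    have := hk j hj
    rw [FML.knead_sign, FML.knead_sign] at this
    revert this
    generalize SignType.sign (FML.gg lm lp c j) = a
    generalize SignType.sign (FML.gg lm lp chat j) = b
    revert a b
    decide
end
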